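/- arXiv:2601.10888 — 4 statements merged into one kernel-verified Lean document; each statement's English description precedes it below -/
import Mathlib

section
/- Let T = (e₁,…,e₄) be any list of four 4-tuples of pairwise distinct indices in {1,…,7} such that every index in {1,…,7} occurs in at least one eᵢ. Then the cross-ratio degree of T is at most 2: there exists a nonzero polynomial q ∈ ℂ[x₁,…,x₄] such that for every (a₁,…,a₄) ∈ (ℂ∖{0,1})⁴ with q(a₁,…,a₄) ≠ 0, the set of tuples (p₁,…,p₇) of pairwise distinct points of ℙ¹(ℂ) with p₁ = ∞, p₂ = 0, p₃ = 1 and CR(p_{eᵢ,1},p_{eᵢ,2},p_{eᵢ,3},p_{eᵢ,4}) = aᵢ for i = 1,…,4 has at most 2 elements. In particular, the maximal cross-ratio degree for 7 points in ℙ¹ is at most 2. -/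
open OnePoint

/-- Cross-ratio of four points of `ℙ¹(ℂ) = OnePoint ℂ`:
`CR(z₁,z₂,z₃,z₄) = ((z₃−z₁)(z₄−z₂))/((z₃−z₂)(z₄−z₁))` when all points are finite,
extended to one point at infinity by omitting the two factors containing it. -/
noncomputable def CR : OnePoint ℂ → OnePoint ℂ → OnePoint ℂ → OnePoint ℂ → ℂ
  | Option.none,    Option.some z₂, Option.some z₃, Option.some z₄ => (z₄ - z₂) / (z₃ - z₂)
  | Option.some z₁, Option.none,    Option.some z₃, Option.some z₄ => (z₃ - z₁) / (z₄ - z₁)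
  | Option.some z₁, Option.some z₂, Option.none,    Option.some z₄ => (z₄ - z₂) / (z₄ - z₁)
  | Option.some z₁, Option.some z₂, Option.some z₃, Option.none    => (z₃ - z₁) / (z₃ - z₂)
  | Option.some z₁, Option.some z₂, Option.some z₃, Option.some z₄ =>
      ((z₃ - z₁) * (z₄ - z₂)) / ((z₃ - z₂) * (z₄ - z₁))
  | _, _, _, _ => 0

/-- A bracket: an antisymmetric function of two points, nonzero on distinct points and satisfying
the Plücker relation, as given by `det (x, y)` for homogeneous coordinates of points of `ℙ¹`. -/
structure IsBracket {V : Type*} (D : V → V → ℂ) : Prop where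
  anti : ∀ x y, D x y = -D y x
  plucker : ∀ x y u v, D x y * D u v - D x u * D y v + D x v * D y u = 0
  ne_zero : ∀ x y, x ≠ y → D x y ≠ 0

/-- The cross-ratio of `a, b, c, d` with respect to the bracket `D` equals `t`. -/
def CrossRel {V : Type*} (D : V → V → ℂ) (t : ℂ) (a b c d : V) : Prop :=
  D c a * D d b = t * (D c b * D d a)

/-- Two brackets describe projectively equivalent configurations on `W`. -/
def Agree {V : Type*} (D D' : V → V → ℂ) (W : Finset V) : Prop :=
  ∃ (k : ℂ) (μ : V → ℂ), k ≠ 0 ∧ (∀ x ∈ W, μ x ≠ 0) ∧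
    ∀ x ∈ W, ∀ y ∈ W, D' x y = k * μ x * μ y * D x y

/-- The affine coordinate of `x` in which `u, v, w` are at `∞, 0, 1`. -/
noncomputable def coord {V : Type*} (D : V → V → ℂ) (u v w x : V) : ℂ :=
  D x v * D w u / (D x u * D w v)

section Bracket

variable {V : Type*} {D D' : V → V → ℂ} {u v w : V}

lemma IsBracket.self (hD : IsBracket D) (x : V) : D x x = 0 := by
  have := hD.anti x x
  grind

lemma IsBracket.coord_zero (hD : IsBracket D) : coord D u v w v = 0 := by
  simp [coord, hD.self]

lemma IsBracket.coord_one (hD : IsBracket D) (h : [u, v, w].Nodup) : coord D u v w w = 1 := by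
  have h1 := hD.ne_zero w u (by grind)
  have h2 := hD.ne_zero w v (by grind)
  rw [coord]
  field_simp

lemma IsBracket.eq_coord_sub (hD : IsBracket D) (h : [u, v, w].Nodup) {x y : V} (hx : x ≠ u)
    (hy : y ≠ u) :
    D x y = D w v / (D w u * D v u) * D x u * D y u * (coord D u v w x - coord D u v w y) := by
  have h1 := hD.ne_zero w u (by grind)
  have h2 := hD.ne_zero w v (by grind)
  have h3 := hD.ne_zero v u (by grind)
  have h4 := hD.ne_zero x u hx
  have h5 := hD.ne_zero y u hy
  have h6 := hD.plucker x y u v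
  rw [hD.anti u v] at h6
  simp only [coord]
  field_simp
  linear_combination -h6

lemma CrossRel.coord_affine (hD : IsBracket D) (h : [u, v, w].Nodup) {t : ℂ} {b c d : V}
    (hr : CrossRel D t u b c d) (hb : b ≠ u) (hc : c ≠ u) (hd : d ≠ u) :
    coord D u v w d - coord D u v w b = t * (coord D u v w c - coord D u v w b) := by
  have h1 := hD.ne_zero w u (by grind)
  have h2 := hD.ne_zero w v (by grind)
  have h3 := hD.ne_zero v u (by grind)
  have h4 := hD.ne_zero b u hb
  have h5 := hD.ne_zero c u hc
  have h6 := hD.ne_zero d u hd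
  rw [CrossRel, hD.eq_coord_sub h hd hb, hD.eq_coord_sub h hc hb] at hr
  field_simp at hr
  linear_combination hr

lemma CrossRel.coord_cross (hD : IsBracket D) (h : [u, v, w].Nodup) {t : ℂ} {a b c d : V}
    (hr : CrossRel D t a b c d) (ha : a ≠ u) (hb : b ≠ u) (hc : c ≠ u) (hd : d ≠ u) :
    (coord D u v w c - coord D u v w a) * (coord D u v w d - coord D u v w b) =
      t * ((coord D u v w c - coord D u v w b) * (coord D u v w d - coord D u v w a)) := by
  have h1 := hD.ne_zero w u (by grind)
  have h2 := hD.ne_zero w v (by grind)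
  have h3 := hD.ne_zero v u (by grind)
  have h4 := hD.ne_zero b u hb
  have h5 := hD.ne_zero c u hc
  have h6 := hD.ne_zero d u hd
  have h7 := hD.ne_zero a u ha
  rw [CrossRel, hD.eq_coord_sub h hc ha, hD.eq_coord_sub h hd hb, hD.eq_coord_sub h hc hb,
    hD.eq_coord_sub h hd ha] at hr
  field_simp at hr
  linear_combination hr

lemma agree_of_coord_eq (hD : IsBracket D) (hD' : IsBracket D') (h : [u, v, w].Nodup)
    {W : Finset V} (hW : ∀ x ∈ W, x ≠ u → coord D u v w x = coord D' u v w x) :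
    Agree D D' W := by
  classical
  have hne : ∀ {E : V → V → ℂ}, IsBracket E → E w v / (E w u * E v u) ≠ 0 := fun hE =>
    div_ne_zero (hE.ne_zero w v (by grind))
      (mul_ne_zero (hE.ne_zero w u (by grind)) (hE.ne_zero v u (by grind)))
  have hK := hne hD
  have hK' := hne hD'
  have heq := fun x y => @IsBracket.eq_coord_sub _ D u v w hD h x y
  have heq' := fun x y => @IsBracket.eq_coord_sub _ D' u v w hD' h x y
  generalize D w v / (D w u * D v u) = K at *
  generalize D' w v / (D' w u * D' v u) = K' at *
  refine ⟨K' / K, fun x => if x = u then K / K' else D' x u / D x u, by positivity, ?_, ?_⟩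
  · intro x _
    dsimp only
    split_ifs with hx
    · positivity
    · exact div_ne_zero (hD'.ne_zero x u hx) (hD.ne_zero x u hx)
  · intro x hxW y hyW
    dsimp only
    by_cases hx : x = u <;> by_cases hy : y = u
    · subst hx hy
      simp [hD.self, hD'.self]
    · have := hD.ne_zero y u hy
      subst hx
      rw [if_pos rfl, if_neg hy, hD.anti x y, hD'.anti x y]
      field_simp
    · have := hD.ne_zero x u hx
      subst hy
      rw [if_pos rfl, if_neg hx]
      field_simp
    · have h1 := hD.ne_zero x u hx
      have h2 := hD.ne_zero y u hy
      rw [if_neg hx, if_neg hy, heq x y hx hy, heq' x y hx hy, hW x hxW hx, hW y hyW hy]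
      field_simp

lemma Agree.coord_eq (hD : IsBracket D) (h : [u, v, w].Nodup) {W : Finset V}
    (hA : Agree D D' W) (hu : u ∈ W) (hv : v ∈ W) (hw : w ∈ W) {x : V} (hx : x ∈ W) (hxu : x ≠ u) :
    coord D u v w x = coord D' u v w x := by
  obtain ⟨k, μ, hk, hμ, hA⟩ := hA
  have h1 := hD.ne_zero w v (by grind)
  have h2 := hD.ne_zero x u hxu
  have h3 := hμ u hu
  have h4 := hμ v hv
  have h5 := hμ w hw
  have h6 := hμ x hx
  rw [coord, coord, hA x hx v hv, hA w hw u hu, hA x hx u hu, hA w hw v hv]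
  field_simp

end Bracket

/-- A family `𝒟` of brackets whose cross-ratios on each of the four-element sets `e i` are
prescribed up to the order of the points, with values in `O i` satisfying the genericity
conditions which make the fibre small. -/
structure Datum {V : Type*} (𝒟 : Set (V → V → ℂ)) (O : Fin 4 → Set ℂ) (e : Fin 4 → Finset V) :
    Prop where
  bracket : ∀ D ∈ 𝒟, IsBracket D
  card : ∀ i, (e i).card = 4
  rel : ∀ i a b c d, a ∈ e i → b ∈ e i → c ∈ e i → d ∈ e i → [a, b, c, d].Nodup →
    ∃ t ∈ O i, ∀ D ∈ 𝒟, CrossRel D t a b c d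
  ne_zero : ∀ i, ∀ t ∈ O i, t ≠ 0
  ne_one : ∀ i, ∀ t ∈ O i, t ≠ 1
  ne : ∀ i j, i ≠ j → ∀ t ∈ O i, ∀ s ∈ O j, t ≠ s
  ne_mul : ∀ i j k, [i, j, k].Nodup → ∀ t ∈ O i, ∀ s ∈ O j, ∀ r ∈ O k, t ≠ s * r

/-- Any two members of `𝒟` agree on `W`. -/
def AllAgree {V : Type*} (𝒟 : Set (V → V → ℂ)) (W : Finset V) : Prop :=
  ∀ D₁ ∈ 𝒟, ∀ D₂ ∈ 𝒟, Agree D₁ D₂ W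

/-- Among any three members of `𝒟`, two agree on `W`. -/
def TwoAgree {V : Type*} (𝒟 : Set (V → V → ℂ)) (W : Finset V) : Prop :=
  ∀ D₁ ∈ 𝒟, ∀ D₂ ∈ 𝒟, ∀ D₃ ∈ 𝒟, Agree D₁ D₂ W ∨ Agree D₁ D₃ W ∨ Agree D₂ D₃ W

section Datum

variable {V : Type*} {𝒟 : Set (V → V → ℂ)} {O : Fin 4 → Set ℂ} {e : Fin 4 → Finset V}
  {W : Finset V}

lemma AllAgree.twoAgree (h : AllAgree 𝒟 W) : TwoAgree 𝒟 W :=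
  fun D₁ h₁ D₂ h₂ _ _ => Or.inl (h D₁ h₁ D₂ h₂)

/-- Three roots of a nonzero quadratic polynomial cannot be distinct. -/
lemma eq_of_quadratic {α β γ x y z : ℂ} (hα : α ≠ 0) (hx : α * x ^ 2 + β * x + γ = 0)
    (hy : α * y ^ 2 + β * y + γ = 0) (hz : α * z ^ 2 + β * z + γ = 0) :
    x = y ∨ x = z ∨ y = z := by
  by_contra! hne
  obtain ⟨h1, h2, h3⟩ := hne
  have e1 : α * (x + y) + β = 0 :=
    mul_left_cancel₀ (sub_ne_zero.2 h1) (by linear_combination hx - hy)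
  have e2 : α * (x + z) + β = 0 :=
    mul_left_cancel₀ (sub_ne_zero.2 h2) (by linear_combination hx - hz)
  exact h3 (mul_left_cancel₀ hα (by linear_combination e1 - e2))

lemma Datum.allAgree_of_coord (h : Datum 𝒟 O e) {u v w : V} (hn : [u, v, w].Nodup)
    (hW : ∀ D ∈ 𝒟, ∀ D' ∈ 𝒟, ∀ x ∈ W, x ≠ u → coord D u v w x = coord D' u v w x) :
    AllAgree 𝒟 W :=
  fun D hD D' hD' => agree_of_coord_eq (h.bracket D hD) (h.bracket D' hD') hn (hW D hD D' hD')

lemma Datum.twoAgree_of_quadratic (h : Datum 𝒟 O e) {u v w y : V} (hn : [u, v, w].Nodup)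
    {α β γ : ℂ} (hα : α ≠ 0)
    (hq : ∀ D ∈ 𝒟, α * coord D u v w y ^ 2 + β * coord D u v w y + γ = 0)
    (hW : ∀ D ∈ 𝒟, ∀ D' ∈ 𝒟, coord D u v w y = coord D' u v w y →
      ∀ x ∈ W, x ≠ u → coord D u v w x = coord D' u v w x) : TwoAgree 𝒟 W := by
  have key : ∀ D ∈ 𝒟, ∀ D' ∈ 𝒟, coord D u v w y = coord D' u v w y → Agree D D' W :=
    fun D hD D' hD' he =>
      agree_of_coord_eq (h.bracket D hD) (h.bracket D' hD') hn (hW D hD D' hD' he)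
  intro D₁ h₁ D₂ h₂ D₃ h₃
  rcases eq_of_quadratic hα (hq D₁ h₁) (hq D₂ h₂) (hq D₃ h₃) with he | he | he
  · exact Or.inl (key _ h₁ _ h₂ he)
  · exact Or.inr (Or.inl (key _ h₁ _ h₃ he))
  · exact Or.inr (Or.inr (key _ h₂ _ h₃ he))

section Finset

variable [DecidableEq V] {s : Finset V} {a b c d : V}

lemma Finset.exists_eq_four_of_mem_one (hs : s.card = 4) (ha : a ∈ s) :
    ∃ b c d, s = {a, b, c, d} ∧ [a, b, c, d].Nodup := by
  obtain ⟨b, c, d, h1, h2, h3, he⟩ := Finset.card_eq_three.1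
    (show (s.erase a).card = 3 by rw [Finset.card_erase_of_mem ha, hs])
  refine ⟨b, c, d, ?_, ?_⟩
  · rw [← he, Finset.insert_erase ha]
  · have : a ∉ s.erase a := Finset.notMem_erase a s
    rw [he] at this
    grind

lemma Finset.exists_eq_four_of_mem_two (hs : s.card = 4) (ha : a ∈ s) (hb : b ∈ s)
    (hn : [a, b].Nodup) : ∃ c d, s = {a, b, c, d} ∧ [a, b, c, d].Nodup := by
  obtain ⟨x, y, z, he, hx⟩ := Finset.exists_eq_four_of_mem_one hs ha
  have : b = x ∨ b = y ∨ b = z := by grind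
  rcases this with rfl | rfl | rfl
  · exact ⟨y, z, by grind, by grind⟩
  · exact ⟨x, z, by grind, by grind⟩
  · exact ⟨x, y, by grind, by grind⟩

lemma Finset.exists_eq_four_of_mem_three (hs : s.card = 4) (ha : a ∈ s) (hb : b ∈ s)
    (hc : c ∈ s) (hn : [a, b, c].Nodup) : ∃ d, s = {a, b, c, d} ∧ [a, b, c, d].Nodup := by
  obtain ⟨x, y, he, hx⟩ := Finset.exists_eq_four_of_mem_two hs ha hb (by grind)
  have : c = x ∨ c = y := by grind
  rcases this with rfl | rfl
  · exact ⟨y, by grind, by grind⟩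
  · exact ⟨x, by grind, by grind⟩

lemma Finset.eq_four_of_mem (hs : s.card = 4) (ha : a ∈ s) (hb : b ∈ s)
    (hc : c ∈ s) (hd : d ∈ s) (hn : [a, b, c, d].Nodup) : s = {a, b, c, d} := by
  obtain ⟨x, he, hx⟩ := Finset.exists_eq_four_of_mem_three hs ha hb hc (by grind)
  grind

end Finset

variable [DecidableEq V]

lemma Datum.edge_ne (h : Datum 𝒟 O e) (h𝒟 : 𝒟.Nonempty) {i j : Fin 4} (hij : i ≠ j) :
    e i ≠ e j := by
  intro he
  obtain ⟨D, hD⟩ := h𝒟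
  have hb := h.bracket D hD
  obtain ⟨a, ha⟩ := Finset.card_pos.1 (show 0 < (e i).card by rw [h.card]; norm_num)
  obtain ⟨b, c, d, hs, hn⟩ := Finset.exists_eq_four_of_mem_one (h.card i) ha
  obtain ⟨t, ht, h1⟩ := h.rel i a b c d (by grind) (by grind) (by grind) (by grind) hn
  obtain ⟨s, hs', h2⟩ := h.rel j a b c d (by grind) (by grind) (by grind) (by grind) hn
  refine h.ne i j hij t ht s hs' ?_
  exact mul_right_cancel₀ (mul_ne_zero (hb.ne_zero c b (by grind)) (hb.ne_zero d a (by grind)))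
    ((h1 D hD).symm.trans (h2 D hD))

/-- A point of an edge is determined by the other points of that edge. -/
lemma Datum.agree_insert (h : Datum 𝒟 O e) {D D' : V → V → ℂ} (hD : D ∈ 𝒟) (hD' : D' ∈ 𝒟)
    (hA : Agree D D' W) {i : Fin 4} {x : V} (hx : x ∈ e i) (hi : ∀ y ∈ e i, y ≠ x → y ∈ W) :
    Agree D D' (insert x W) := by
  obtain ⟨a, b, c, hs, hn⟩ := Finset.exists_eq_four_of_mem_one (h.card i) hx
  have hn' : [a, b, c].Nodup := by grind
  have ha : a ∈ W := hi a (by grind) (by grind)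
  have hb : b ∈ W := hi b (by grind) (by grind)
  have hc : c ∈ W := hi c (by grind) (by grind)
  obtain ⟨t, -, ht⟩ := h.rel i a b c x (by grind) (by grind) (by grind) (by grind) (by grind)
  have key : ∀ E ∈ 𝒟, coord E a b c x = t := by
    intro E hE
    have hEb := h.bracket E hE
    have := (ht E hE).coord_affine hEb hn' (by grind) (by grind) (by grind)
    rw [hEb.coord_zero, hEb.coord_one hn'] at this
    linear_combination this
  refine agree_of_coord_eq (h.bracket D hD) (h.bracket D' hD') hn' fun y hy hya => ?_
  rcases Finset.mem_insert.1 hy with rfl | hy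
  · rw [key D hD, key D' hD']
  · exact hA.coord_eq (h.bracket D hD) hn' ha hb hc hy hya

lemma Datum.allAgree_insert (h : Datum 𝒟 O e) (hA : AllAgree 𝒟 W) {i : Fin 4} {x : V}
    (hx : x ∈ e i) (hi : ∀ y ∈ e i, y ≠ x → y ∈ W) : AllAgree 𝒟 (insert x W) :=
  fun D hD D' hD' => h.agree_insert hD hD' (hA D hD D' hD') hx hi

lemma Datum.twoAgree_insert (h : Datum 𝒟 O e) (hA : TwoAgree 𝒟 W) {i : Fin 4} {x : V}
    (hx : x ∈ e i) (hi : ∀ y ∈ e i, y ≠ x → y ∈ W) : TwoAgree 𝒟 (insert x W) :=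
  fun D₁ h₁ D₂ h₂ D₃ h₃ => (hA D₁ h₁ D₂ h₂ D₃ h₃).imp
    (fun hA => h.agree_insert h₁ h₂ hA hx hi)
    (Or.imp (fun hA => h.agree_insert h₁ h₃ hA hx hi) fun hA => h.agree_insert h₂ h₃ hA hx hi)

lemma Datum.allAgree_edge (h : Datum 𝒟 O e) (i : Fin 4) : AllAgree 𝒟 (e i) := by
  obtain ⟨x, hx⟩ := Finset.card_pos.1 (show 0 < (e i).card by rw [h.card]; norm_num)
  obtain ⟨a, b, c, hs, hn⟩ := Finset.exists_eq_four_of_mem_one (h.card i) hx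
  have h3 : AllAgree 𝒟 {a, b, c} := by
    intro D hD D' hD'
    have hb := h.bracket D hD
    have hb' := h.bracket D' hD'
    have hn' : [a, b, c].Nodup := by grind
    refine agree_of_coord_eq hb hb' hn' fun y hy hya => ?_
    have : y = b ∨ y = c := by grind
    rcases this with rfl | rfl
    · rw [hb.coord_zero, hb'.coord_zero]
    · rw [hb.coord_one hn', hb'.coord_one hn']
  rw [hs]
  exact h.allAgree_insert h3 hx (by grind)

lemma Datum.allAgree_two (h : Datum 𝒟 O e) {i j : Fin 4} (hc : (e i ∪ e j).card = 5) :
    AllAgree 𝒟 (e i ∪ e j) := by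
  have h1 := Finset.card_sdiff_add_card (e j) (e i)
  rw [Finset.union_comm, hc, h.card i] at h1
  obtain ⟨x, hx⟩ := Finset.card_eq_one.1 (show (e j \ e i).card = 1 by omega)
  have hx' : ∀ y, (y ∈ e j ∧ y ∉ e i) ↔ y = x := fun y => by
    rw [← Finset.mem_sdiff, hx, Finset.mem_singleton]
  have hu : e i ∪ e j = insert x (e i) := by grind
  rw [hu]
  exact h.allAgree_insert (h.allAgree_edge i) (i := j) (by grind) (by grind)

lemma Datum.five_le_card (h : Datum 𝒟 O e) (h𝒟 : 𝒟.Nonempty) {i j : Fin 4} (hij : i ≠ j) :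
    5 ≤ (e i ∪ e j).card := by
  by_contra! hlt
  have hi := Finset.eq_of_subset_of_card_le (Finset.subset_union_left (s₁ := e i) (s₂ := e j))
    (by rw [h.card]; omega)
  have hj := Finset.eq_of_subset_of_card_le (Finset.subset_union_right (s₁ := e i) (s₂ := e j))
    (by rw [h.card]; omega)
  exact h.edge_ne h𝒟 hij (hi.trans hj.symm)

lemma Datum.six_le_card (h : Datum 𝒟 O e) (h𝒟 : 𝒟.Nonempty) {i j k : Fin 4}
    (hn : [i, j, k].Nodup) : 6 ≤ (e i ∪ e j ∪ e k).card := by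
  by_contra! hlt
  have hij := h.five_le_card h𝒟 (show i ≠ j by grind)
  have hik := h.edge_ne h𝒟 (show i ≠ k by grind)
  have hjk := h.edge_ne h𝒟 (show j ≠ k by grind)
  set U := e i ∪ e j ∪ e k with hU
  have hsub : e i ∪ e j ⊆ U := Finset.subset_union_left
  have hU5 : U.card = 5 := by have := Finset.card_le_card hsub; omega
  have missing : ∀ m, e m ⊆ U → ∃ x ∈ U, ∀ y, y ∈ e m ↔ y ∈ U ∧ y ≠ x := fun m hm => by
    obtain ⟨x, hx⟩ := Finset.card_eq_one.1
      (show (U \ e m).card = 1 by rw [Finset.card_sdiff_of_subset hm, h.card, hU5])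
    have hx' : ∀ y, (y ∈ U ∧ y ∉ e m) ↔ y = x := fun y => by
      rw [← Finset.mem_sdiff, hx, Finset.mem_singleton]
    exact ⟨x, ((hx' x).2 rfl).1, fun y => ⟨fun hy => ⟨hm hy, by grind⟩, by grind⟩⟩
  obtain ⟨a, haU, ha'⟩ := missing i (by grind)
  obtain ⟨b, hbU, hb'⟩ := missing j (by grind)
  obtain ⟨c, hcU, hc'⟩ := missing k (by grind)
  have hne : e i ≠ e j := h.edge_ne h𝒟 (by grind)
  have hab : a ≠ b := fun hab => hne (by ext y; rw [ha', hb', hab])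
  have hac : a ≠ c := fun hab => hik (by ext y; rw [ha', hc', hab])
  have hbc : b ≠ c := fun hab => hjk (by ext y; rw [hb', hc', hab])
  clear_value U
  obtain ⟨v, w, he, hvw⟩ := Finset.exists_eq_four_of_mem_two (h.card i) (a := b) (b := c)
    (by grind) (by grind) (by grind)
  have hn3 : [v, w, a].Nodup := by grind
  obtain ⟨t, ht, h1⟩ := h.rel i v w c b (by grind) (by grind) (by grind) (by grind) (by grind)
  obtain ⟨s, hs, h2⟩ := h.rel j v w a c (by grind) (by grind) (by grind) (by grind) (by grind)
  obtain ⟨r, hr, h3⟩ := h.rel k v w a b (by grind) (by grind) (by grind) (by grind) (by grind)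
  obtain ⟨D, hD⟩ := h𝒟
  have hDb := h.bracket D hD
  have g1 := (h1 D hD).coord_affine hDb hn3 (by grind) (by grind) (by grind)
  have g2 := (h2 D hD).coord_affine hDb hn3 (by grind) (by grind) (by grind)
  have g3 := (h3 D hD).coord_affine hDb hn3 (by grind) (by grind) (by grind)
  rw [hDb.coord_zero] at g1 g2 g3
  rw [hDb.coord_one hn3] at g2 g3
  exact h.ne_mul k i j (by grind) r hr t ht s hs (by linear_combination g1 + t * g2 - g3)

lemma Datum.exists_rel (h : Datum 𝒟 O e) (i : Fin 4) {a b c d : V} (he : e i = {a, b, c, d})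
    (hn : [a, b, c, d].Nodup) : ∃ t ∈ O i, ∀ D ∈ 𝒟, CrossRel D t a b c d :=
  h.rel i a b c d (by simp [he]) (by simp [he]) (by simp [he]) (by simp [he]) hn

/-- Three edges forming the complements of the three pairs in a partition of six points. -/
lemma Datum.twoAgree_octahedron (h : Datum 𝒟 O e) {i j k : Fin 4} {a b c d f g : V}
    (hn : [a, b, c, d, f, g].Nodup) (hi : e i = {a, b, c, d}) (hj : e j = {a, b, f, g})
    (hk : e k = {c, d, f, g}) : TwoAgree 𝒟 {a, b, c, d, f, g} := by
  have hn3 : [a, b, c].Nodup := by grind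
  obtain ⟨t, ht, h1⟩ := h.exists_rel i hi (by grind)
  obtain ⟨s, hs, h2⟩ := h.exists_rel j hj (by grind)
  obtain ⟨r, hr, h3⟩ := h.exists_rel k hk (by grind)
  have key : ∀ D ∈ 𝒟, coord D a b c d = t ∧ coord D a b c g = s * coord D a b c f ∧
      (coord D a b c f - 1) * (coord D a b c g - coord D a b c d) =
        r * ((coord D a b c f - coord D a b c d) * (coord D a b c g - 1)) := by
    intro D hD
    have hb := h.bracket D hD
    have g1 := (h1 D hD).coord_affine hb hn3 (by grind) (by grind) (by grind)
    have g2 := (h2 D hD).coord_affine hb hn3 (by grind) (by grind) (by grind)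
    have g3 := (h3 D hD).coord_cross hb hn3 (by grind) (by grind) (by grind) (by grind)
    rw [hb.coord_zero] at g1 g2
    rw [hb.coord_one hn3] at g1 g3
    exact ⟨by linear_combination g1, by linear_combination g2, g3⟩
  refine h.twoAgree_of_quadratic (y := f) (α := s * (1 - r)) (β := r + r * s * t - s - t)
    (γ := t - r * t) hn3 ?_ ?_ ?_
  · exact mul_ne_zero (h.ne_zero j s hs) (sub_ne_zero.2 (h.ne_one k r hr).symm)
  · intro D hD
    obtain ⟨g1, g2, g3⟩ := key D hD
    rw [g1, g2] at g3
    linear_combination g3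
  · intro D hD D' hD' he x hx hxa
    have hb := h.bracket D hD
    have hb' := h.bracket D' hD'
    obtain ⟨g1, g2, g3⟩ := key D hD
    obtain ⟨g1', g2', g3'⟩ := key D' hD'
    have : x = b ∨ x = c ∨ x = d ∨ x = f ∨ x = g := by grind
    rcases this with rfl | rfl | rfl | rfl | rfl
    · rw [hb.coord_zero, hb'.coord_zero]
    · rw [hb.coord_one hn3, hb'.coord_one hn3]
    · rw [g1, g1']
    · exact he
    · rw [g2, g2', he]

lemma Datum.twoAgree_of_mem_one (h : Datum 𝒟 O e) (h𝒟 : 𝒟.Nonempty) {i j k : Fin 4}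
    (hn : [i, j, k].Nodup) (hc : (e i ∪ e j ∪ e k).card = 6) {x : V} (hx : x ∈ e i)
    (hxj : x ∉ e j) (hxk : x ∉ e k) : TwoAgree 𝒟 (e i ∪ e j ∪ e k) := by
  have h5 := h.five_le_card h𝒟 (show j ≠ k by grind)
  have hxW : x ∉ e j ∪ e k := by simp [hxj, hxk]
  have hsub : insert x (e j ∪ e k) ⊆ e i ∪ e j ∪ e k := by grind
  have hle := Finset.card_le_card hsub
  rw [Finset.card_insert_of_notMem hxW] at hle
  have heq := Finset.eq_of_subset_of_card_le hsub
    (by rw [Finset.card_insert_of_notMem hxW]; omega)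
  have hall := h.allAgree_two (i := j) (j := k) (by omega)
  rw [← heq]
  refine (h.allAgree_insert hall hx fun y hy hyx => ?_).twoAgree
  have : y ∈ insert x (e j ∪ e k) := by rw [heq]; simp [hy]
  exact Finset.mem_of_mem_insert_of_ne this hyx

lemma Datum.twoAgree_three (h : Datum 𝒟 O e) (h𝒟 : 𝒟.Nonempty) {i j k : Fin 4}
    (hn : [i, j, k].Nodup) (hc : (e i ∪ e j ∪ e k).card = 6) :
    TwoAgree 𝒟 (e i ∪ e j ∪ e k) := by
  by_cases hi : ∃ x ∈ e i, x ∉ e j ∧ x ∉ e k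
  · obtain ⟨x, hx, hxj, hxk⟩ := hi
    exact h.twoAgree_of_mem_one h𝒟 hn hc hx hxj hxk
  by_cases hj : ∃ x ∈ e j, x ∉ e i ∧ x ∉ e k
  · obtain ⟨x, hx, hxi, hxk⟩ := hj
    have hu : e i ∪ e j ∪ e k = e j ∪ e i ∪ e k := by rw [Finset.union_comm (e i)]
    rw [hu] at hc ⊢
    exact h.twoAgree_of_mem_one h𝒟 (by grind) hc hx hxi hxk
  by_cases hk : ∃ x ∈ e k, x ∉ e i ∧ x ∉ e j
  · obtain ⟨x, hx, hxi, hxj⟩ := hk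
    have hu : e i ∪ e j ∪ e k = e k ∪ e i ∪ e j := by
      rw [Finset.union_assoc, Finset.union_comm, Finset.union_comm (e j), Finset.union_right_comm]
    rw [hu] at hc ⊢
    exact h.twoAgree_of_mem_one h𝒟 (by grind) hc hx hxi hxj
  push Not at hi hj hk
  have inter : ∀ m n, e i ∪ e j ∪ e k = e m ∪ e n → (e m ∩ e n).card = 2 := by
    intro m n hmn
    have := Finset.card_union_add_card_inter (e m) (e n)
    rw [← hmn, hc, h.card, h.card] at this
    omega
  have hij := inter i j (by ext y; simp only [Finset.mem_union]; grind)
  have hik := inter i k (by ext y; simp only [Finset.mem_union]; grind)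
  have hjk := inter j k (by ext y; simp only [Finset.mem_union]; grind)
  have hdisj : ∀ y ∈ e i, y ∈ e j → y ∉ e k := by
    intro y hyi hyj hyk
    have h1 := Finset.card_union_add_card_inter (e i ∩ e j) (e i ∩ e k)
    have h2 : e i ∩ e j ∪ e i ∩ e k = e i := by
      ext z; simp only [Finset.mem_union, Finset.mem_inter]; grind
    have h3 : 0 < ((e i ∩ e j) ∩ (e i ∩ e k)).card := Finset.card_pos.2 ⟨y, by simp [*]⟩
    rw [h2, h.card, hij, hik] at h1
    omega
  obtain ⟨a, b, hab, h1⟩ := Finset.card_eq_two.1 hij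
  obtain ⟨c, d, hcd, h2⟩ := Finset.card_eq_two.1 hik
  obtain ⟨f, g, hfg, h3⟩ := Finset.card_eq_two.1 hjk
  have h1' : ∀ y, (y ∈ e i ∧ y ∈ e j) ↔ (y = a ∨ y = b) := fun y => by
    rw [← Finset.mem_inter, h1]; simp
  have h2' : ∀ y, (y ∈ e i ∧ y ∈ e k) ↔ (y = c ∨ y = d) := fun y => by
    rw [← Finset.mem_inter, h2]; simp
  have h3' : ∀ y, (y ∈ e j ∧ y ∈ e k) ↔ (y = f ∨ y = g) := fun y => by
    rw [← Finset.mem_inter, h3]; simp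
  clear inter hij hik hjk h1 h2 h3
  have ha := (h1' a).2 (Or.inl rfl)
  have hb := (h1' b).2 (Or.inr rfl)
  have hc' := (h2' c).2 (Or.inl rfl)
  have hd := (h2' d).2 (Or.inr rfl)
  have hf := (h3' f).2 (Or.inl rfl)
  have hg := (h3' g).2 (Or.inr rfl)
  have hn6 : [a, b, c, d, f, g].Nodup := by
    simp only [List.nodup_cons, List.mem_cons, List.not_mem_nil, or_false, not_or]
    grind
  have ei : e i = {a, b, c, d} :=
    Finset.eq_four_of_mem (h.card i) ha.1 hb.1 hc'.1 hd.1 (by grind)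
  have ej : e j = {a, b, f, g} :=
    Finset.eq_four_of_mem (h.card j) ha.2 hb.2 hf.1 hg.1 (by grind)
  have ek : e k = {c, d, f, g} :=
    Finset.eq_four_of_mem (h.card k) hc'.2 hd.2 hf.2 hg.2 (by grind)
  have hU : e i ∪ e j ∪ e k = {a, b, c, d, f, g} := by
    rw [ei, ej, ek]; ext y; simp only [Finset.mem_union, Finset.mem_insert, Finset.mem_singleton]
    tauto
  rw [hU]
  exact h.twoAgree_octahedron hn6 ei ej ek

/-- A common point on all four edges, every two edges sharing one further point. -/
lemma Datum.allAgree_tetrahedron (h : Datum 𝒟 O e) {i j l m : Fin 4}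
    (hi : [i, j, l, m].Nodup) {u a b c f g k : V}
    (hn : [u, a, b, c, f, g, k].Nodup) (hW : ∀ x ∈ W, x ∈ [u, a, b, c, f, g, k])
    (h0 : e i = {u, a, b, c}) (h1 : e j = {u, a, g, f}) (h2 : e l = {u, b, k, f})
    (h3 : e m = {u, c, g, k}) : AllAgree 𝒟 W := by
  have hn3 : [u, a, b].Nodup := by grind
  obtain ⟨t, ht, r0⟩ := h.exists_rel i h0 (by grind)
  obtain ⟨s, hs, r1⟩ := h.exists_rel j h1 (by grind)
  obtain ⟨r, hr, r2⟩ := h.exists_rel l h2 (by grind)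
  obtain ⟨q, hq, r3⟩ := h.exists_rel m h3 (by grind)
  have key : ∀ D ∈ 𝒟, coord D u a b c = t ∧ coord D u a b f = s * coord D u a b g ∧
      coord D u a b f - 1 = r * (coord D u a b k - 1) ∧
      coord D u a b k - t = q * (coord D u a b g - t) := by
    intro D hD
    have hb := h.bracket D hD
    have g0 := (r0 D hD).coord_affine hb hn3 (by grind) (by grind) (by grind)
    have g1 := (r1 D hD).coord_affine hb hn3 (by grind) (by grind) (by grind)
    have g2 := (r2 D hD).coord_affine hb hn3 (by grind) (by grind) (by grind)
    have g3 := (r3 D hD).coord_affine hb hn3 (by grind) (by grind) (by grind)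
    rw [hb.coord_zero] at g0 g1
    rw [hb.coord_one hn3] at g0 g2
    have g0' : coord D u a b c = t := by linear_combination g0
    rw [g0'] at g3
    exact ⟨g0', by linear_combination g1, g2, g3⟩
  have hsrq : s - r * q ≠ 0 := sub_ne_zero.2 (h.ne_mul j l m (by grind) s hs r hr q hq)
  refine h.allAgree_of_coord hn3 fun D hD D' hD' x hx hxu => ?_
  have hb := h.bracket D hD
  have hb' := h.bracket D' hD'
  obtain ⟨g0, g1, g2, g3⟩ := key D hD
  obtain ⟨g0', g1', g2', g3'⟩ := key D' hD'
  have hg : coord D u a b g = coord D' u a b g :=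
    mul_left_cancel₀ hsrq (by linear_combination g2 - g2' - g1 + g1' + r * (g3 - g3'))
  have : x = a ∨ x = b ∨ x = c ∨ x = f ∨ x = g ∨ x = k := by simpa [hxu] using hW x hx
  rcases this with rfl | rfl | rfl | rfl | rfl | rfl
  · rw [hb.coord_zero, hb'.coord_zero]
  · rw [hb.coord_one hn3, hb'.coord_one hn3]
  · rw [g0, g0']
  · rw [g1, g1', hg]
  · exact hg
  · linear_combination g3 - g3' + q * hg

/-- A common point on all four edges, two pairs of edges sharing two further points. -/
lemma Datum.allAgree_square (h : Datum 𝒟 O e) {i j l m : Fin 4}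
    (hi : [i, j, l, m].Nodup) {u a b c d f g : V}
    (hn : [u, a, b, c, d, f, g].Nodup) (hW : ∀ x ∈ W, x ∈ [u, a, b, c, d, f, g])
    (h0 : e i = {u, a, b, c}) (h1 : e j = {u, a, b, d}) (h2 : e l = {u, f, g, c})
    (h3 : e m = {u, f, g, d}) : AllAgree 𝒟 W := by
  have hn3 : [u, a, b].Nodup := by grind
  obtain ⟨t, ht, r0⟩ := h.exists_rel i h0 (by grind)
  obtain ⟨s, hs, r1⟩ := h.exists_rel j h1 (by grind)
  obtain ⟨r, hr, r2⟩ := h.exists_rel l h2 (by grind)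
  obtain ⟨q, hq, r3⟩ := h.exists_rel m h3 (by grind)
  have key : ∀ D ∈ 𝒟, coord D u a b c = t ∧ coord D u a b d = s ∧
      t - coord D u a b f = r * (coord D u a b g - coord D u a b f) ∧
      s - coord D u a b f = q * (coord D u a b g - coord D u a b f) := by
    intro D hD
    have hb := h.bracket D hD
    have g0 := (r0 D hD).coord_affine hb hn3 (by grind) (by grind) (by grind)
    have g1 := (r1 D hD).coord_affine hb hn3 (by grind) (by grind) (by grind)
    have g2 := (r2 D hD).coord_affine hb hn3 (by grind) (by grind) (by grind)
    have g3 := (r3 D hD).coord_affine hb hn3 (by grind) (by grind) (by grind)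
    rw [hb.coord_zero, hb.coord_one hn3] at g0 g1
    have g0' : coord D u a b c = t := by linear_combination g0
    have g1' : coord D u a b d = s := by linear_combination g1
    rw [g0'] at g2
    rw [g1'] at g3
    exact ⟨g0', g1', g2, g3⟩
  have hrq : r - q ≠ 0 := sub_ne_zero.2 (h.ne l m (by grind) r hr q hq)
  refine h.allAgree_of_coord hn3 fun D hD D' hD' x hx hxu => ?_
  have hb := h.bracket D hD
  have hb' := h.bracket D' hD'
  obtain ⟨g0, g1, g2, g3⟩ := key D hD
  obtain ⟨g0', g1', g2', g3'⟩ := key D' hD'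
  have hgf : coord D u a b g - coord D u a b f = coord D' u a b g - coord D' u a b f :=
    mul_left_cancel₀ hrq (by linear_combination g3 - g3' - g2 + g2')
  have hf : coord D u a b f = coord D' u a b f := by linear_combination g2' - g2 - r * hgf
  have : x = a ∨ x = b ∨ x = c ∨ x = d ∨ x = f ∨ x = g := by simpa [hxu] using hW x hx
  rcases this with rfl | rfl | rfl | rfl | rfl | rfl
  · rw [hb.coord_zero, hb'.coord_zero]
  · rw [hb.coord_one hn3, hb'.coord_one hn3]
  · rw [g0, g0']
  · rw [g1, g1']
  · exact hf
  · linear_combination hgf + hf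

/-- Two points common to the same three edges. -/
lemma Datum.twoAgree_common_pair (h : Datum 𝒟 O e) {i j l m : Fin 4}
    {u v w a b c d : V}
    (hn : [u, v, w, a, b, c, d].Nodup) (hW : ∀ x ∈ W, x ∈ [u, v, w, a, b, c, d])
    (h0 : e i = {u, v, w, a}) (h1 : e j = {u, v, w, b}) (h2 : e l = {u, v, c, d})
    (h3 : e m = {a, b, c, d}) : TwoAgree 𝒟 W := by
  have hn3 : [u, v, w].Nodup := by grind
  obtain ⟨t, ht, r0⟩ := h.exists_rel i h0 (by grind)
  obtain ⟨s, hs, r1⟩ := h.exists_rel j h1 (by grind)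
  obtain ⟨r, hr, r2⟩ := h.exists_rel l h2 (by grind)
  obtain ⟨q, hq, r3⟩ := h.exists_rel m h3 (by grind)
  have key : ∀ D ∈ 𝒟, coord D u v w a = t ∧ coord D u v w b = s ∧
      coord D u v w d = r * coord D u v w c ∧
      (coord D u v w c - t) * (coord D u v w d - s) =
        q * ((coord D u v w c - s) * (coord D u v w d - t)) := by
    intro D hD
    have hb := h.bracket D hD
    have g0 := (r0 D hD).coord_affine hb hn3 (by grind) (by grind) (by grind)
    have g1 := (r1 D hD).coord_affine hb hn3 (by grind) (by grind) (by grind)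
    have g2 := (r2 D hD).coord_affine hb hn3 (by grind) (by grind) (by grind)
    have g3 := (r3 D hD).coord_cross hb hn3 (by grind) (by grind) (by grind) (by grind)
    rw [hb.coord_zero, hb.coord_one hn3] at g0 g1
    rw [hb.coord_zero] at g2
    have g0' : coord D u v w a = t := by linear_combination g0
    have g1' : coord D u v w b = s := by linear_combination g1
    rw [g0', g1'] at g3
    exact ⟨g0', g1', by linear_combination g2, g3⟩
  refine h.twoAgree_of_quadratic (y := c) (α := r * (1 - q)) (β := q * (t + s * r) - s - t * r)
    (γ := t * s * (1 - q)) hn3 ?_ ?_ ?_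
  · exact mul_ne_zero (h.ne_zero l r hr) (sub_ne_zero.2 (h.ne_one m q hq).symm)
  · intro D hD
    obtain ⟨-, -, g2, g3⟩ := key D hD
    rw [g2] at g3
    linear_combination g3
  · intro D hD D' hD' he x hx hxu
    have hb := h.bracket D hD
    have hb' := h.bracket D' hD'
    obtain ⟨g0, g1, g2, -⟩ := key D hD
    obtain ⟨g0', g1', g2', -⟩ := key D' hD'
    have : x = v ∨ x = w ∨ x = a ∨ x = b ∨ x = c ∨ x = d := by simpa [hxu] using hW x hx
    rcases this with rfl | rfl | rfl | rfl | rfl | rfl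
    · rw [hb.coord_zero, hb'.coord_zero]
    · rw [hb.coord_one hn3, hb'.coord_one hn3]
    · rw [g0, g0']
    · rw [g1, g1']
    · exact he
    · rw [g2, g2', he]

/-- Two points on three edges each, lying together on two edges with a third common point. -/
lemma Datum.twoAgree_common_triple (h : Datum 𝒟 O e) {i j l m : Fin 4}
    {u v w a b y z : V}
    (hn : [u, v, w, a, b, y, z].Nodup) (hW : ∀ x ∈ W, x ∈ [u, v, w, a, b, y, z])
    (h0 : e i = {v, b, z, y}) (h1 : e j = {u, a, z, y}) (h2 : e l = {u, v, w, a})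
    (h3 : e m = {u, v, w, b}) : TwoAgree 𝒟 W := by
  have hn3 : [u, v, w].Nodup := by grind
  obtain ⟨t, ht, r0⟩ := h.exists_rel i h0 (by grind)
  obtain ⟨s, hs, r1⟩ := h.exists_rel j h1 (by grind)
  obtain ⟨r, hr, r2⟩ := h.exists_rel l h2 (by grind)
  obtain ⟨q, hq, r3⟩ := h.exists_rel m h3 (by grind)
  have key : ∀ D ∈ 𝒟, coord D u v w a = r ∧ coord D u v w b = q ∧
      coord D u v w y = s * coord D u v w z + (1 - s) * r ∧
      coord D u v w z * (coord D u v w y - q) =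
        t * ((coord D u v w z - q) * coord D u v w y) := by
    intro D hD
    have hb := h.bracket D hD
    have g0 := (r0 D hD).coord_cross hb hn3 (by grind) (by grind) (by grind) (by grind)
    have g1 := (r1 D hD).coord_affine hb hn3 (by grind) (by grind) (by grind)
    have g2 := (r2 D hD).coord_affine hb hn3 (by grind) (by grind) (by grind)
    have g3 := (r3 D hD).coord_affine hb hn3 (by grind) (by grind) (by grind)
    rw [hb.coord_zero, hb.coord_one hn3] at g2 g3
    rw [hb.coord_zero] at g0
    have g2' : coord D u v w a = r := by linear_combination g2
    have g3' : coord D u v w b = q := by linear_combination g3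
    rw [g2'] at g1
    rw [g3'] at g0
    exact ⟨g2', g3', by linear_combination g1, by linear_combination g0⟩
  refine h.twoAgree_of_quadratic (y := z) (α := s * (1 - t))
    (β := (1 - s) * r * (1 - t) - q + t * q * s) (γ := t * q * (1 - s) * r) hn3 ?_ ?_ ?_
  · exact mul_ne_zero (h.ne_zero j s hs) (sub_ne_zero.2 (h.ne_one i t ht).symm)
  · intro D hD
    obtain ⟨-, -, g1, g0⟩ := key D hD
    rw [g1] at g0
    linear_combination g0
  · intro D hD D' hD' he x hx hxu
    have hb := h.bracket D hD
    have hb' := h.bracket D' hD'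
    obtain ⟨g0, g1, g2, -⟩ := key D hD
    obtain ⟨g0', g1', g2', -⟩ := key D' hD'
    have : x = v ∨ x = w ∨ x = a ∨ x = b ∨ x = y ∨ x = z := by simpa [hxu] using hW x hx
    rcases this with rfl | rfl | rfl | rfl | rfl | rfl
    · rw [hb.coord_zero, hb'.coord_zero]
    · rw [hb.coord_one hn3, hb'.coord_one hn3]
    · rw [g0, g0']
    · rw [g1, g1']
    · rw [g2, g2', he]
    · exact he

/-- Two points on three edges each, lying together on two edges without further common points;
each remaining edge contains the residual pair of one of these edges. -/
lemma Datum.allAgree_parallel (h : Datum 𝒟 O e) {i j l m : Fin 4}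
    (hi : [i, j, l, m].Nodup) {u v w a b c d : V}
    (hn : [u, v, w, a, b, c, d].Nodup) (hW : ∀ x ∈ W, x ∈ [u, v, w, a, b, c, d])
    (h0 : e i = {v, a, b, w}) (h1 : e j = {u, w, c, d}) (h2 : e l = {u, v, a, b})
    (h3 : e m = {u, v, c, d}) : AllAgree 𝒟 W := by
  have hn3 : [u, v, a].Nodup := by grind
  obtain ⟨t, ht, r0⟩ := h.exists_rel i h0 (by grind)
  obtain ⟨s, hs, r1⟩ := h.exists_rel j h1 (by grind)
  obtain ⟨r, hr, r2⟩ := h.exists_rel l h2 (by grind)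
  obtain ⟨q, hq, r3⟩ := h.exists_rel m h3 (by grind)
  have key : ∀ D ∈ 𝒟, coord D u v a b = r ∧ coord D u v a d = q * coord D u v a c ∧
      coord D u v a d - coord D u v a w = s * (coord D u v a c - coord D u v a w) ∧
      (r - t * (r - 1)) * coord D u v a w = r := by
    intro D hD
    have hb := h.bracket D hD
    have g0 := (r0 D hD).coord_cross hb hn3 (by grind) (by grind) (by grind) (by grind)
    have g1 := (r1 D hD).coord_affine hb hn3 (by grind) (by grind) (by grind)
    have g2 := (r2 D hD).coord_affine hb hn3 (by grind) (by grind) (by grind)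
    have g3 := (r3 D hD).coord_affine hb hn3 (by grind) (by grind) (by grind)
    rw [hb.coord_zero] at g0 g2 g3
    rw [hb.coord_one hn3] at g0 g2
    have g2' : coord D u v a b = r := by linear_combination g2
    rw [g2'] at g0
    exact ⟨g2', by linear_combination g3, g1, by linear_combination g0⟩
  have hqs : q - s ≠ 0 := sub_ne_zero.2 (h.ne m j (by grind) q hq s hs)
  refine h.allAgree_of_coord hn3 fun D hD D' hD' x hx hxu => ?_
  have hb := h.bracket D hD
  have hb' := h.bracket D' hD'
  obtain ⟨g0, g1, g2, g3⟩ := key D hD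
  obtain ⟨g0', g1', g2', g3'⟩ := key D' hD'
  have hw : coord D u v a w = coord D' u v a w := by
    have hne : r - t * (r - 1) ≠ 0 := fun h0 => h.ne_zero l r hr (by rw [← g3, h0, zero_mul])
    exact mul_left_cancel₀ hne (g3.trans g3'.symm)
  have hc : coord D u v a c = coord D' u v a c :=
    mul_left_cancel₀ hqs (by linear_combination g2 - g2' - g1 + g1' + (1 - s) * hw)
  have : x = v ∨ x = w ∨ x = a ∨ x = b ∨ x = c ∨ x = d := by simpa [hxu] using hW x hx
  rcases this with rfl | rfl | rfl | rfl | rfl | rfl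
  · rw [hb.coord_zero, hb'.coord_zero]
  · exact hw
  · rw [hb.coord_one hn3, hb'.coord_one hn3]
  · rw [g0, g0']
  · exact hc
  · rw [g1, g1', hc]

/-- Two points on three edges each, lying together on two edges without further common points;
each remaining edge meets the residual pairs of both of these edges. -/
lemma Datum.twoAgree_crossed (h : Datum 𝒟 O e) {i j l m : Fin 4}
    {u v w a b c d : V}
    (hn : [u, v, w, a, b, c, d].Nodup) (hW : ∀ x ∈ W, x ∈ [u, v, w, a, b, c, d])
    (h0 : e i = {v, a, c, w}) (h1 : e j = {u, b, d, w}) (h2 : e l = {u, v, a, b})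
    (h3 : e m = {u, v, c, d}) : TwoAgree 𝒟 W := by
  have hn3 : [u, v, a].Nodup := by grind
  obtain ⟨t, ht, r0⟩ := h.exists_rel i h0 (by grind)
  obtain ⟨s, hs, r1⟩ := h.exists_rel j h1 (by grind)
  obtain ⟨r, hr, r2⟩ := h.exists_rel l h2 (by grind)
  obtain ⟨q, hq, r3⟩ := h.exists_rel m h3 (by grind)
  have key : ∀ D ∈ 𝒟, coord D u v a b = r ∧ coord D u v a d = q * coord D u v a c ∧
      coord D u v a w = r * (1 - s) + s * q * coord D u v a c ∧
      coord D u v a c * (coord D u v a w - 1) =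
        t * ((coord D u v a c - 1) * coord D u v a w) := by
    intro D hD
    have hb := h.bracket D hD
    have g0 := (r0 D hD).coord_cross hb hn3 (by grind) (by grind) (by grind) (by grind)
    have g1 := (r1 D hD).coord_affine hb hn3 (by grind) (by grind) (by grind)
    have g2 := (r2 D hD).coord_affine hb hn3 (by grind) (by grind) (by grind)
    have g3 := (r3 D hD).coord_affine hb hn3 (by grind) (by grind) (by grind)
    rw [hb.coord_zero] at g0 g2 g3
    rw [hb.coord_one hn3] at g0 g2
    have g2' : coord D u v a b = r := by linear_combination g2
    have g3' : coord D u v a d = q * coord D u v a c := by linear_combination g3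
    rw [g2', g3'] at g1
    exact ⟨g2', g3', by linear_combination g1, by linear_combination g0⟩
  refine h.twoAgree_of_quadratic (y := c) (α := s * q * (1 - t))
    (β := r * (1 - s) - 1 - t * (r * (1 - s) - s * q)) (γ := t * r * (1 - s)) hn3 ?_ ?_ ?_
  · exact mul_ne_zero (mul_ne_zero (h.ne_zero j s hs) (h.ne_zero m q hq))
      (sub_ne_zero.2 (h.ne_one i t ht).symm)
  · intro D hD
    obtain ⟨-, -, g1, g0⟩ := key D hD
    rw [g1] at g0
    linear_combination g0
  · intro D hD D' hD' he x hx hxu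
    have hb := h.bracket D hD
    have hb' := h.bracket D' hD'
    obtain ⟨g0, g1, g2, -⟩ := key D hD
    obtain ⟨g0', g1', g2', -⟩ := key D' hD'
    have : x = v ∨ x = w ∨ x = a ∨ x = b ∨ x = c ∨ x = d := by simpa [hxu] using hW x hx
    rcases this with rfl | rfl | rfl | rfl | rfl | rfl
    · rw [hb.coord_zero, hb'.coord_zero]
    · rw [g2, g2', he]
    · rw [hb.coord_one hn3, hb'.coord_one hn3]
    · rw [g0, g0']
    · exact he
    · rw [g1, g1', he]

/-- Exactly two of four propositions hold. -/
def ExactlyTwo (p q r s : Prop) : Prop :=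
  p ∧ q ∧ ¬r ∧ ¬s ∨ p ∧ ¬q ∧ r ∧ ¬s ∨ p ∧ ¬q ∧ ¬r ∧ s ∨
    ¬p ∧ q ∧ r ∧ ¬s ∨ ¬p ∧ q ∧ ¬r ∧ s ∨ ¬p ∧ ¬q ∧ r ∧ s

lemma exactlyTwo_of_card {A : Finset (Fin 4)} (hA : A.card = 2) {i j l m : Fin 4}
    (hi : [i, j, l, m].Nodup) : ExactlyTwo (i ∈ A) (j ∈ A) (l ∈ A) (m ∈ A) := by
  have hU := Finset.eq_univ_of_card ({i, j, l, m} : Finset (Fin 4))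
    (by simpa using List.toFinset_card_of_nodup hi)
  have hs : A.card = ∑ x : Fin 4, if x ∈ A then 1 else 0 := by simp
  rw [← hU, Finset.sum_insert, Finset.sum_insert, Finset.sum_insert, Finset.sum_singleton] at hs
  all_goals clear hU; grind [ExactlyTwo]

section Fintype

variable [Fintype V]

lemma List.Nodup.mem_of_length_eq {s : List V} (hs : s.Nodup) (hc : s.length = Fintype.card V)
    (x : V) : x ∈ s := by
  rw [← List.mem_toFinset, Finset.eq_univ_of_card s.toFinset
    (by rw [List.toFinset_card_of_nodup hs, hc])]
  exact Finset.mem_univ x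

lemma List.exists_notMem_of_length_lt {s : List V} (hs : s.length < Fintype.card V) :
    ∃ x, x ∉ s := by
  by_contra! h
  have := Finset.card_le_card (fun x _ => List.mem_toFinset.2 (h x) :
    (Finset.univ : Finset V) ⊆ s.toFinset)
  rw [Finset.card_univ] at this
  have := List.toFinset_card_le s
  omega

/-- A vertex on all four edges, where two edges share two further vertices. -/
lemma Datum.twoAgree_of_mem_all_of_mem_two (h : Datum 𝒟 O e) (h𝒟 : 𝒟.Nonempty)
    (hV : Fintype.card V = 7) {u : V} (hu : ∀ i, u ∈ e i)
    (hx : ∀ x ≠ u, ∀ i j l m, [i, j, l, m].Nodup →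
      ExactlyTwo (x ∈ e i) (x ∈ e j) (x ∈ e l) (x ∈ e m))
    {i j l m : Fin 4} (hi : [i, j, l, m].Nodup) {a b : V} (hn : [u, a, b].Nodup)
    (hai : a ∈ e i) (haj : a ∈ e j) (hbi : b ∈ e i) (hbj : b ∈ e j) :
    TwoAgree 𝒟 Finset.univ := by
  obtain ⟨c, hei, hnc⟩ := Finset.exists_eq_four_of_mem_three (h.card i) (hu i) hai hbi hn
  obtain ⟨d, hej, hnd⟩ := Finset.exists_eq_four_of_mem_three (h.card j) (hu j) haj hbj hn
  have hcd : c ≠ d := fun hcd => h.edge_ne h𝒟 (show i ≠ j by grind) (by rw [hei, hej, hcd])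
  have hxi := fun x hxu => hx x hxu i j l m hi
  clear hx
  wlog hcl : c ∈ e l generalizing l m
  · refine this (l := m) (m := l) (by clear * - hi; grind) ?_ ?_
    · intro x hxu
      have := hxi x hxu
      clear * - this
      grind [ExactlyTwo]
    · have := hxi c (by clear * - hnc; grind)
      grind [ExactlyTwo]
  obtain ⟨f, hf⟩ := List.exists_notMem_of_length_lt (s := [u, a, b, c, d]) (by simp [hV])
  obtain ⟨g, hg⟩ := List.exists_notMem_of_length_lt (s := [u, a, b, c, d, f]) (by simp [hV])
  have hn7 : [u, a, b, c, d, f, g].Nodup := by clear * - hnc hnd hcd hf hg; grind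
  have hf' := hxi f (by clear * - hf; grind)
  have hg' := hxi g (by clear * - hg; grind)
  have hd' := hxi d (by clear * - hnd; grind)
  clear hxi
  have hfl : f ∈ e l ∧ f ∈ e m := by grind [ExactlyTwo]
  have hgl : g ∈ e l ∧ g ∈ e m := by grind [ExactlyTwo]
  have hel := Finset.eq_four_of_mem (h.card l) (hu l) hfl.1 hgl.1 hcl (by clear * - hn7; grind)
  have hdm : d ∈ e m := by
    grind [ExactlyTwo]
  have hem := Finset.eq_four_of_mem (h.card m) (hu m) hfl.2 hgl.2 hdm (by clear * - hn7; grind)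
  exact (h.allAgree_square hi hn7 (fun x _ => hn7.mem_of_length_eq (by simp [hV]) x) hei hej
    hel hem).twoAgree

/-- Four edges with a vertex on all of them, every other vertex lying on two of them. -/
lemma Datum.twoAgree_of_mem_all (h : Datum 𝒟 O e) (h𝒟 : 𝒟.Nonempty)
    (hV : Fintype.card V = 7) {u : V} (hu : ∀ i, u ∈ e i)
    (hx : ∀ x ≠ u, ∀ i j l m, [i, j, l, m].Nodup →
      ExactlyTwo (x ∈ e i) (x ∈ e j) (x ∈ e l) (x ∈ e m)) : TwoAgree 𝒟 Finset.univ := by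
  by_cases hpair : ∃ i j l m a b, [i, j, l, m].Nodup ∧ [u, a, b].Nodup ∧
      a ∈ e i ∧ a ∈ e j ∧ b ∈ e i ∧ b ∈ e j
  · obtain ⟨i, j, l, m, a, b, hi, hn, hai, haj, hbi, hbj⟩ := hpair
    exact h.twoAgree_of_mem_all_of_mem_two h𝒟 hV hu hx hi hn hai haj hbi hbj
  have hpair' : ∀ i j l m a b, [i, j, l, m].Nodup → [u, a, b].Nodup →
      a ∈ e i → a ∈ e j → b ∈ e i → b ∉ e j := by
    push Not at hpair
    exact hpair
  have hmeet : ∀ i j l m, [i, j, l, m].Nodup → ∃ x ≠ u, x ∈ e i ∧ x ∈ e j ∧ x ∉ e l ∧ x ∉ e m := by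
    intro i j l m hi
    obtain ⟨a, b, c, he, hn⟩ := Finset.exists_eq_four_of_mem_one (h.card i) (hu i)
    have ha := hx a (by clear * - hn; grind) i j l m hi
    have hb := hx b (by clear * - hn; grind) i j l m hi
    have hc := hx c (by clear * - hn; grind) i j l m hi
    have hab := hpair' i l j m a b (by clear * - hi; grind) (by clear * - hn; grind)
    have hac := hpair' i l j m a c (by clear * - hi; grind) (by clear * - hn; grind)
    have hbc := hpair' i l j m b c (by clear * - hi; grind) (by clear * - hn; grind)
    have hab' := hpair' i m j l a b (by clear * - hi; grind) (by clear * - hn; grind)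
    have hac' := hpair' i m j l a c (by clear * - hi; grind) (by clear * - hn; grind)
    have hbc' := hpair' i m j l b c (by clear * - hi; grind) (by clear * - hn; grind)
    clear hpair hpair' hx
    by_contra! hno
    have hna := hno a (by clear * - hn; grind)
    have hnb := hno b (by clear * - hn; grind)
    have hnc := hno c (by clear * - hn; grind)
    clear hno
    grind [ExactlyTwo]
  obtain ⟨a, hau, ha⟩ := hmeet 0 1 2 3 (by decide)
  obtain ⟨b, hbu, hb⟩ := hmeet 0 2 1 3 (by decide)
  obtain ⟨c, hcu, hc⟩ := hmeet 0 3 1 2 (by decide)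
  obtain ⟨f, hfu, hf⟩ := hmeet 1 2 0 3 (by decide)
  obtain ⟨g, hgu, hg⟩ := hmeet 1 3 0 2 (by decide)
  obtain ⟨k, hku, hk⟩ := hmeet 2 3 0 1 (by decide)
  clear hpair hpair' hmeet hx
  have hn7 : [u, a, b, c, f, g, k].Nodup := by
    simp only [List.nodup_cons, List.mem_cons, List.not_mem_nil, or_false, not_or]
    repeat' apply And.intro
    all_goals first | rintro rfl; tauto | simp
  exact (h.allAgree_tetrahedron (i := 0) (j := 1) (l := 2) (m := 3) (by decide) hn7
    (fun x _ => hn7.mem_of_length_eq (by simp [hV]) x)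
    (Finset.eq_four_of_mem (h.card 0) (hu 0) ha.1 hb.1 hc.1 (by clear * - hn7; grind))
    (Finset.eq_four_of_mem (h.card 1) (hu 1) ha.2.1 hg.1 hf.1 (by clear * - hn7; grind))
    (Finset.eq_four_of_mem (h.card 2) (hu 2) hb.2.1 hk.1 hf.2.1 (by clear * - hn7; grind))
    (Finset.eq_four_of_mem (h.card 3) (hu 3) hc.2.1 hg.2.1 hk.2.1
      (by clear * - hn7; grind))).twoAgree

/-- Two vertices on the same three edges, every other vertex lying on two edges. -/
lemma Datum.twoAgree_of_same_three (h : Datum 𝒟 O e) (hV : Fintype.card V = 7) {u v : V}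
    (huv : u ≠ v) {m : Fin 4} (hu : ∀ i, u ∈ e i ↔ i ≠ m) (hv : ∀ i, v ∈ e i ↔ i ≠ m)
    (hx : ∀ x, x ≠ u → x ≠ v → ∀ i j l m, [i, j, l, m].Nodup →
      ExactlyTwo (x ∈ e i) (x ∈ e j) (x ∈ e l) (x ∈ e m)) : TwoAgree 𝒟 Finset.univ := by
  obtain ⟨w, hwu, hwv, hwm⟩ : ∃ w, w ≠ u ∧ w ≠ v ∧ w ∉ e m := by
    obtain ⟨a, ha⟩ := Finset.card_pos.1 (show 0 < (e m).card by rw [h.card]; norm_num)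
    obtain ⟨b, c, d, he, hn⟩ := Finset.exists_eq_four_of_mem_one (h.card m) ha
    obtain ⟨w, hw⟩ := List.exists_notMem_of_length_lt (s := [u, v, a, b, c, d]) (by simp [hV])
    exact ⟨w, by clear * - hw; grind, by clear * - hw; grind, by clear * - hw he; grind⟩
  obtain ⟨i, j, l, hi, hwi, hwj, hwl⟩ : ∃ i j l, [i, j, l, m].Nodup ∧ w ∈ e i ∧ w ∈ e j ∧
      w ∉ e l := by
    obtain ⟨i, j, l, hi⟩ : ∃ i j l, [i, j, l, m].Nodup := by clear * -; decide +revert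
    have := hx w hwu hwv i j l m hi
    rcases this with h1 | h1 | h1 | h1 | h1 | h1
    · exact ⟨i, j, l, hi, h1.1, h1.2.1, h1.2.2.1⟩
    · exact ⟨i, l, j, by clear * - hi; grind, h1.1, h1.2.2.1, h1.2.1⟩
    · exact absurd h1.2.2.2 hwm
    · exact ⟨j, l, i, by clear * - hi; grind, h1.2.1, h1.2.2.1, h1.1⟩
    · exact absurd h1.2.2.2 hwm
    · exact absurd h1.2.2.2 hwm
  have hui := (hu i).2 (by clear * - hi; grind)
  have huj := (hu j).2 (by clear * - hi; grind)
  have hul := (hu l).2 (by clear * - hi; grind)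
  have hvi := (hv i).2 (by clear * - hi; grind)
  have hvj := (hv j).2 (by clear * - hi; grind)
  have hvl := (hv l).2 (by clear * - hi; grind)
  have hum : u ∉ e m := by simp [hu]
  have hvm : v ∉ e m := by simp [hv]
  have hn : [u, v, w].Nodup := by grind
  obtain ⟨a, hei, hna⟩ := Finset.exists_eq_four_of_mem_three (h.card i) hui hvi hwi hn
  obtain ⟨b, hej, hnb⟩ := Finset.exists_eq_four_of_mem_three (h.card j) huj hvj hwj hn
  obtain ⟨c, d, hel, hncd⟩ :=
    Finset.exists_eq_four_of_mem_two (h.card l) hul hvl (by clear * - hn; grind)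
  have hmem : ∀ x, x ∉ [u, v, w] → x ∈ e m := by
    intro x hxn
    by_contra hxm
    obtain ⟨y, hy⟩ := List.exists_notMem_of_length_lt (s := [u, v, w, x]) (by simp [hV])
    obtain ⟨z, hz⟩ := List.exists_notMem_of_length_lt (s := [u, v, w, x, y]) (by simp [hV])
    obtain ⟨t, ht⟩ := List.exists_notMem_of_length_lt (s := [u, v, w, x, y, z]) (by simp [hV])
    have hn7 : [u, v, w, x, y, z, t].Nodup := by clear * - hn hxn hy hz ht; grind
    have hsub : e m ⊆ {y, z, t} := fun s hs => by
      have := hn7.mem_of_length_eq (by simp [hV]) s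
      clear * - this hs hum hvm hwm hxm
      grind
    have := (Finset.card_le_card hsub).trans Finset.card_le_three
    rw [h.card] at this
    omega
  have hxa := hx a (by clear * - hna; grind) (by clear * - hna; grind) i j l m hi
  have hxb := hx b (by clear * - hnb; grind) (by clear * - hnb; grind) i j l m hi
  have hxc := hx c (by clear * - hncd; grind) (by clear * - hncd; grind) i j l m hi
  have hxd := hx d (by clear * - hncd; grind) (by clear * - hncd; grind) i j l m hi
  have hma := hmem a (by clear * - hna; grind)
  have hmb := hmem b (by clear * - hnb; grind)
  have hmc := hmem c (by
    have : w ≠ c := by rintro rfl; exact hwl (by simp [hel])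
    clear * - hncd this; grind)
  have hmd := hmem d (by
    have : w ≠ d := by rintro rfl; exact hwl (by simp [hel])
    clear * - hncd this; grind)
  have hai : a ∈ e i := by simp [hei]
  have hbj : b ∈ e j := by simp [hej]
  have hcl : c ∈ e l := by simp [hel]
  have hdl : d ∈ e l := by simp [hel]
  have hn7 : [u, v, w, a, b, c, d].Nodup := by
    have hab : a ≠ b := by
      rintro rfl
      clear * - hxa hai hbj hma
      grind [ExactlyTwo]
    have hac : a ≠ c := by
      rintro rfl
      clear * - hxa hai hcl hma
      grind [ExactlyTwo]
    have had : a ≠ d := by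
      rintro rfl
      clear * - hxa hai hdl hma
      grind [ExactlyTwo]
    have hbc : b ≠ c := by
      rintro rfl
      clear * - hxb hbj hcl hmb
      grind [ExactlyTwo]
    have hbd : b ≠ d := by
      rintro rfl
      clear * - hxb hbj hdl hmb
      grind [ExactlyTwo]
    have hwc : w ≠ c := by rintro rfl; exact hwm hmc
    have hwd : w ≠ d := by rintro rfl; exact hwm hmd
    clear * - hna hnb hncd hab hac had hbc hbd hwc hwd
    grind
  exact h.twoAgree_common_pair hn7 (fun x _ => hn7.mem_of_length_eq (by simp [hV]) x) hei hej hel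
    (Finset.eq_four_of_mem (h.card m) hma hmb hmc hmd (by clear * - hn7; grind))

/-- Two vertices on three edges each, both on the edges `e l` and `e m`, which have a further
common vertex. -/
lemma Datum.twoAgree_of_three_of_common (h : Datum 𝒟 O e) (h𝒟 : 𝒟.Nonempty)
    (hV : Fintype.card V = 7) {u v w : V} (hn : [u, v, w].Nodup) {i j l m : Fin 4}
    (hi : [i, j, l, m].Nodup) (hu : ∀ k, u ∈ e k ↔ k ≠ i) (hv : ∀ k, v ∈ e k ↔ k ≠ j)
    (hx : ∀ x, x ≠ u → x ≠ v → ExactlyTwo (x ∈ e i) (x ∈ e j) (x ∈ e l) (x ∈ e m))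
    (hwl : w ∈ e l) (hwm : w ∈ e m) : TwoAgree 𝒟 Finset.univ := by
  have huj := (hu j).2 (by clear * - hi; grind)
  have hul := (hu l).2 (by clear * - hi; grind)
  have hum := (hu m).2 (by clear * - hi; grind)
  have hvi := (hv i).2 (by clear * - hi; grind)
  have hvl := (hv l).2 (by clear * - hi; grind)
  have hvm := (hv m).2 (by clear * - hi; grind)
  obtain ⟨a, hel, hna⟩ := Finset.exists_eq_four_of_mem_three (h.card l) hul hvl hwl hn
  obtain ⟨b, hem, hnb⟩ := Finset.exists_eq_four_of_mem_three (h.card m) hum hvm hwm hn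
  have hab : a ≠ b :=
    fun hab => h.edge_ne h𝒟 (show l ≠ m by clear * - hi; grind) (by rw [hel, hem, hab])
  obtain ⟨y, hy⟩ := List.exists_notMem_of_length_lt (s := [u, v, w, a, b]) (by simp [hV])
  obtain ⟨z, hz⟩ := List.exists_notMem_of_length_lt (s := [u, v, w, a, b, y]) (by simp [hV])
  have hn7 : [u, v, w, a, b, y, z].Nodup := by clear * - hna hnb hab hy hz; grind
  have hn7' : [u, v, w, b, a, y, z].Nodup := by clear * - hn7; grind
  have hxa := hx a (by clear * - hna; grind) (by clear * - hna; grind)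
  have hxb := hx b (by clear * - hnb; grind) (by clear * - hnb; grind)
  have hxy : y ∈ e i ∧ y ∈ e j := by
    have := hx y (by clear * - hy; grind) (by clear * - hy; grind)
    clear * - this hel hem hy
    grind [ExactlyTwo]
  have hxz : z ∈ e i ∧ z ∈ e j := by
    have := hx z (by clear * - hz; grind) (by clear * - hz; grind)
    clear * - this hel hem hz
    grind [ExactlyTwo]
  clear hx
  by_cases haj : a ∈ e j
  · have hej := Finset.eq_four_of_mem (h.card j) huj haj hxz.2 hxy.2 (by clear * - hn7; grind)
    have hbi : b ∈ e i := by
      clear * - hxb hej hem hel hn7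
      grind [ExactlyTwo]
    exact h.twoAgree_common_triple hn7 (fun x _ => hn7.mem_of_length_eq (by simp [hV]) x)
      (Finset.eq_four_of_mem (h.card i) hvi hbi hxz.1 hxy.1 (by clear * - hn7; grind)) hej hel hem
  · have hai : a ∈ e i := by
      clear * - hxa haj hem hel hn7
      grind [ExactlyTwo]
    have hei := Finset.eq_four_of_mem (h.card i) hvi hai hxz.1 hxy.1 (by clear * - hn7; grind)
    have hbj : b ∈ e j := by
      clear * - hxb hei hem hel hn7
      grind [ExactlyTwo]
    exact h.twoAgree_common_triple hn7' (fun x _ => hn7'.mem_of_length_eq (by simp [hV]) x) hei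
      (Finset.eq_four_of_mem (h.card j) huj hbj hxz.2 hxy.2 (by clear * - hn7; grind)) hem hel

/-- Two vertices on three edges each, which are the only common vertices of the edges `e l` and
`e m`. -/
lemma Datum.twoAgree_of_three_of_disjoint (h : Datum 𝒟 O e)
    (hV : Fintype.card V = 7) {u v : V} (huv : u ≠ v) {i j l m : Fin 4}
    (hi : [i, j, l, m].Nodup) (hu : ∀ k, u ∈ e k ↔ k ≠ i) (hv : ∀ k, v ∈ e k ↔ k ≠ j)
    (hx : ∀ x, x ≠ u → x ≠ v → ExactlyTwo (x ∈ e i) (x ∈ e j) (x ∈ e l) (x ∈ e m))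
    (hlm : ∀ x, x ≠ u → x ≠ v → x ∈ e l → x ∉ e m) : TwoAgree 𝒟 Finset.univ := by
  have huj := (hu j).2 (by clear * - hi; grind)
  have hul := (hu l).2 (by clear * - hi; grind)
  have hum := (hu m).2 (by clear * - hi; grind)
  have hvi := (hv i).2 (by clear * - hi; grind)
  have hvl := (hv l).2 (by clear * - hi; grind)
  have hvm := (hv m).2 (by clear * - hi; grind)
  have hui : u ∉ e i := by simp [hu]
  have hvj : v ∉ e j := by simp [hv]
  obtain ⟨a, b, hel, hnab⟩ :=
    Finset.exists_eq_four_of_mem_two (h.card l) hul hvl (by simpa using huv)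
  obtain ⟨c, d, hem, hncd⟩ :=
    Finset.exists_eq_four_of_mem_two (h.card m) hum hvm (by simpa using huv)
  have hal : a ∈ e l := by simp [hel]
  have hbl : b ∈ e l := by simp [hel]
  have hcm : c ∈ e m := by simp [hem]
  have hdm : d ∈ e m := by simp [hem]
  have ham := hlm a (by clear * - hnab; grind) (by clear * - hnab; grind) hal
  have hbm := hlm b (by clear * - hnab; grind) (by clear * - hnab; grind) hbl
  have hn6 : [u, v, a, b, c, d].Nodup := by
    have hac : a ≠ c := by rintro rfl; exact ham hcm
    have had : a ≠ d := by rintro rfl; exact ham hdm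
    have hbc : b ≠ c := by rintro rfl; exact hbm hcm
    have hbd : b ≠ d := by rintro rfl; exact hbm hdm
    clear * - hnab hncd hac had hbc hbd
    grind
  obtain ⟨w, hw⟩ := List.exists_notMem_of_length_lt (s := [u, v, a, b, c, d]) (by simp [hV])
  have hxa := hx a (by clear * - hnab; grind) (by clear * - hnab; grind)
  have hxb := hx b (by clear * - hnab; grind) (by clear * - hnab; grind)
  have hxc := hx c (by clear * - hncd; grind) (by clear * - hncd; grind)
  have hxd := hx d (by clear * - hncd; grind) (by clear * - hncd; grind)
  have hxw : w ∈ e i ∧ w ∈ e j := by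
    have := hx w (by clear * - hw; grind) (by clear * - hw; grind)
    clear * - this hel hem hw
    grind [ExactlyTwo]
  have hel' : e l = {u, v, b, a} := by rw [hel, Finset.pair_comm a b]
  have hem' : e m = {u, v, d, c} := by rw [hem, Finset.pair_comm c d]
  have step : ∀ a b c d, [u, v, a, b, c, d].Nodup → w ∉ [u, v, a, b, c, d] →
      e l = {u, v, a, b} → e m = {u, v, c, d} → a ∈ e i → b ∈ e j → c ∈ e i → d ∈ e j →
      TwoAgree 𝒟 Finset.univ := by
    intro a b c d hn hw hel hem ha hb hc hd
    have hn7 : [u, v, w, a, b, c, d].Nodup := by clear * - hn hw; grind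
    exact h.twoAgree_crossed hn7 (fun x _ => hn7.mem_of_length_eq (by simp [hV]) x)
      (Finset.eq_four_of_mem (h.card i) hvi ha hc hxw.1 (by clear * - hn7; grind))
      (Finset.eq_four_of_mem (h.card j) huj hb hd hxw.2 (by clear * - hn7; grind)) hel hem
  have par : ∀ l m a b c d, [i, j, l, m].Nodup → [u, v, a, b, c, d].Nodup →
      w ∉ [u, v, a, b, c, d] → e l = {u, v, a, b} → e m = {u, v, c, d} → a ∈ e i → b ∈ e i →
      c ∈ e j → d ∈ e j → TwoAgree 𝒟 Finset.univ := by
    intro l m a b c d hi hn hw hel hem ha hb hc hd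
    have hn7 : [u, v, w, a, b, c, d].Nodup := by clear * - hn hw; grind
    exact (h.allAgree_parallel hi hn7 (fun x _ => hn7.mem_of_length_eq (by simp [hV]) x)
      (Finset.eq_four_of_mem (h.card i) hvi ha hb hxw.1 (by clear * - hn7; grind))
      (Finset.eq_four_of_mem (h.card j) huj hxw.2 hc hd (by clear * - hn7; grind)) hel hem).twoAgree
  have hbal : ∀ k s x y z, (e k).card = 4 → s ∈ e k → w ∈ e k → x ∈ e k → y ∈ e k →
      [s, w, x, y, z].Nodup → z ∉ e k := by
    intro k s x y z hk hs hw hx hy hn hz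
    have := Finset.eq_four_of_mem hk hs hw hx hy (by clear * - hn; grind)
    rw [this] at hz
    clear * - hn hz
    simp only [List.nodup_cons, List.mem_cons, List.not_mem_nil, or_false, not_or,
      Finset.mem_insert, Finset.mem_singleton] at hn hz
    tauto
  have hn7 : [u, v, w, a, b, c, d].Nodup := by clear * - hn6 hw; grind
  have hai : a ∈ e i ∨ a ∈ e j := by clear * - hxa ham; grind [ExactlyTwo]
  have hbi : b ∈ e i ∨ b ∈ e j := by clear * - hxb hbm; grind [ExactlyTwo]
  have hcl : c ∉ e l := by
    rw [hel]
    clear * - hn6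
    grind
  have hdl : d ∉ e l := by
    rw [hel]
    clear * - hn6
    grind
  have hci : c ∈ e i ∨ c ∈ e j := by clear * - hxc hcl; grind [ExactlyTwo]
  have hdi : d ∈ e i ∨ d ∈ e j := by clear * - hxd hdl; grind [ExactlyTwo]
  by_cases ha : a ∈ e i <;> by_cases hb : b ∈ e i
  · have hc := hbal i v a b c (h.card i) hvi hxw.1 ha hb (by clear * - hn7; grind)
    have hd := hbal i v a b d (h.card i) hvi hxw.1 ha hb (by clear * - hn7; grind)
    exact par l m a b c d hi hn6 hw hel hem ha hb (hci.resolve_left hc) (hdi.resolve_left hd)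
  · have hb' := hbi.resolve_left hb
    by_cases hc : c ∈ e i
    · have hd := hbal i v a c d (h.card i) hvi hxw.1 ha hc (by clear * - hn7; grind)
      exact step a b c d hn6 hw hel hem ha hb' hc (hdi.resolve_left hd)
    · have hc' := hci.resolve_left hc
      have hd := hbal j u b c d (h.card j) huj hxw.2 hb' hc' (by clear * - hn7; grind)
      exact step a b d c (by clear * - hn6; grind)
        (by clear * - hw; grind) hel hem' ha hb' (hdi.resolve_right hd) hc'
  · have ha' := hai.resolve_left ha
    by_cases hc : c ∈ e i
    · have hd := hbal i v b c d (h.card i) hvi hxw.1 hb hc (by clear * - hn7; grind)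
      exact step b a c d (by clear * - hn6; grind)
        (by clear * - hw; grind) hel' hem hb ha' hc (hdi.resolve_left hd)
    · have hc' := hci.resolve_left hc
      have hd := hbal j u a c d (h.card j) huj hxw.2 ha' hc' (by clear * - hn7; grind)
      exact step b a d c (by clear * - hn6; grind)
        (by clear * - hw; grind) hel' hem' hb ha' (hdi.resolve_right hd) hc'
  · have ha' := hai.resolve_left ha
    have hb' := hbi.resolve_left hb
    have hc := hbal j u a b c (h.card j) huj hxw.2 ha' hb' (by clear * - hn7; grind)
    have hd := hbal j u a b d (h.card j) huj hxw.2 ha' hb' (by clear * - hn7; grind)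
    exact par m l c d a b (by clear * - hi; grind) (by clear * - hn6; grind)
      (by clear * - hw; grind) hem hel
      (hci.resolve_right hc) (hdi.resolve_right hd) ha' hb'

lemma Datum.twoAgree_univ_of_mem_unique (h : Datum 𝒟 O e) (h𝒟 : 𝒟.Nonempty)
    (hV : Fintype.card V = 7) {i : Fin 4} {x : V} (hx : ∀ k, x ∈ e k ↔ k = i) :
    TwoAgree 𝒟 Finset.univ := by
  obtain ⟨j, l, m, hi⟩ : ∃ j l m, [i, j, l, m].Nodup := by clear * -; decide +revert
  have hn : [j, l, m].Nodup := by clear * - hi; grind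
  have h6 := h.six_le_card h𝒟 hn
  have hxW : x ∉ e j ∪ e l ∪ e m := by
    simp only [Finset.mem_union, hx]
    clear * - hi
    grind
  have hle := Finset.card_le_univ (insert x (e j ∪ e l ∪ e m))
  rw [Finset.card_insert_of_notMem hxW, hV] at hle
  have huniv := Finset.eq_univ_of_card (insert x (e j ∪ e l ∪ e m))
    (by rw [Finset.card_insert_of_notMem hxW, hV]; omega)
  rw [← huniv]
  refine h.twoAgree_insert (h.twoAgree_three h𝒟 hn (by omega)) ((hx i).2 rfl) fun y _ hyx => ?_
  exact Finset.mem_of_mem_insert_of_ne (by rw [huniv]; exact Finset.mem_univ y) hyx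

lemma exists_of_sum_eq_two {f : V → ℕ} (hf : ∑ x, f x = 2) :
    (∃ u, f u = 2 ∧ ∀ x ≠ u, f x = 0) ∨
      ∃ u v, u ≠ v ∧ f u = 1 ∧ f v = 1 ∧ ∀ x, x ≠ u → x ≠ v → f x = 0 := by
  obtain ⟨u, -, hu⟩ := Finset.exists_ne_zero_of_sum_ne_zero (hf.trans_ne two_ne_zero)
  have hsum := Finset.add_sum_erase _ f (Finset.mem_univ u)
  by_cases h0 : ∑ x ∈ Finset.univ.erase u, f x = 0
  · refine Or.inl ⟨u, by omega, fun x hx => ?_⟩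
    exact Finset.sum_eq_zero_iff.1 h0 x (by simp [hx])
  · obtain ⟨v, hvu, hv⟩ := Finset.exists_ne_zero_of_sum_ne_zero h0
    have hsum' := Finset.add_sum_erase _ f hvu
    refine Or.inr ⟨u, v, (Finset.ne_of_mem_erase hvu).symm, by omega, by omega, ?_⟩
    intro x hxu hxv
    have h0' : ∑ x ∈ (Finset.univ.erase u).erase v, f x = 0 := by omega
    exact Finset.sum_eq_zero_iff.1 h0' x (by simp [hxu, hxv])

lemma Datum.twoAgree_univ (h : Datum 𝒟 O e) (h𝒟 : 𝒟.Nonempty) (hV : Fintype.card V = 7)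
    (hcov : ∀ x, ∃ i, x ∈ e i) : TwoAgree 𝒟 Finset.univ := by
  let A : V → Finset (Fin 4) := fun x => {i | x ∈ e i}
  have hA : ∀ x i, i ∈ A x ↔ x ∈ e i := by simp [A]
  have hsum : ∑ x, (A x).card = 16 := by
    simp only [A, Finset.card_filter]
    rw [Finset.sum_comm]
    simp [h.card]
  by_cases hone : ∃ x, (A x).card = 1
  · obtain ⟨x, hx⟩ := hone
    obtain ⟨i, hi⟩ := Finset.card_eq_one.1 hx
    exact h.twoAgree_univ_of_mem_unique h𝒟 hV (i := i) (x := x) fun k => by simp [← hA, hi]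
  have htwo : ∀ x, 2 ≤ (A x).card := by
    intro x
    obtain ⟨i, hi⟩ := hcov x
    have : 0 < (A x).card := Finset.card_pos.2 ⟨i, (hA x i).2 hi⟩
    have : (A x).card ≠ 1 := fun h1 => hone ⟨x, h1⟩
    omega
  have hexc : ∑ x, ((A x).card - 2) = 2 := by
    have : ∑ x, (((A x).card - 2) + 2) = 16 := by
      rw [← hsum]
      exact Finset.sum_congr rfl fun x _ => Nat.sub_add_cancel (htwo x)
    rw [Finset.sum_add_distrib, Finset.sum_const, Finset.card_univ, hV, smul_eq_mul] at this
    omega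
  have hex : ∀ x, (A x).card - 2 = 0 → ∀ i j l m, [i, j, l, m].Nodup →
      ExactlyTwo (x ∈ e i) (x ∈ e j) (x ∈ e l) (x ∈ e m) := by
    intro x hx i j l m hi
    have := htwo x
    simpa only [hA] using exactlyTwo_of_card (show (A x).card = 2 by omega) hi
  have hmiss : ∀ x, (A x).card - 2 = 1 → ∃ m, ∀ i, x ∈ e i ↔ i ≠ m := by
    intro x hx
    obtain ⟨m, hm⟩ := Finset.card_eq_one.1 (show (A x)ᶜ.card = 1 by
      rw [Finset.card_compl, Fintype.card_fin]; omega)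
    refine ⟨m, fun i => ?_⟩
    rw [← hA, ← not_iff_not, not_not, ← Finset.mem_compl, hm, Finset.mem_singleton]
  rcases exists_of_sum_eq_two hexc with ⟨u, hu, hx⟩ | ⟨u, v, huv, hu, hv, hx⟩
  · refine h.twoAgree_of_mem_all h𝒟 hV (u := u) (fun i => ?_) fun x hxu => hex x (hx x hxu)
    rw [← hA, Finset.eq_univ_of_card (A u) (by rw [Fintype.card_fin]; omega)]
    exact Finset.mem_univ i
  · obtain ⟨i, hui⟩ := hmiss u hu
    obtain ⟨j, hvj⟩ := hmiss v hv
    by_cases hij : i = j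
    · subst hij
      exact h.twoAgree_of_same_three hV huv hui hvj fun x hxu hxv => hex x (hx x hxu hxv)
    · obtain ⟨l, m, hi⟩ : ∃ l m, [i, j, l, m].Nodup := by clear * - hij; decide +revert
      have hx' := fun x hxu hxv => hex x (hx x hxu hxv) i j l m hi
      by_cases hw : ∃ w, w ≠ u ∧ w ≠ v ∧ w ∈ e l ∧ w ∈ e m
      · obtain ⟨w, hwu, hwv, hwl, hwm⟩ := hw
        exact h.twoAgree_of_three_of_common h𝒟 hV (w := w)
          (by simp [huv, hwu.symm, hwv.symm]) hi hui hvj hx' hwl hwm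
      · push Not at hw
        exact h.twoAgree_of_three_of_disjoint hV huv hi hui hvj hx' hw

end Fintype

end Datum

/-- Numerators of the six values of the cross-ratio of four points in the possible orders. -/
def orbitNum {R : Type*} [CommRing R] (x : R) : Fin 6 → R := ![x, 1, 1 - x, 1, x - 1, x]

/-- Denominators of the six values of the cross-ratio of four points in the possible orders. -/
def orbitDen {R : Type*} [CommRing R] (x : R) : Fin 6 → R := ![1, x, 1, 1 - x, x, x - 1]

/-- The values of the cross-ratio of four points in all orders, where `x` is one of them. -/
def crossOrbit (x : ℂ) : Set ℂ := {t | ∃ k, t * orbitDen x k = orbitNum x k}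

lemma map_orbitNum {R S : Type*} [CommRing R] [CommRing S] (f : R →+* S) (x : R) (k : Fin 6) :
    f (orbitNum x k) = orbitNum (f x) k := by
  fin_cases k <;> simp [orbitNum]

lemma map_orbitDen {R S : Type*} [CommRing R] [CommRing S] (f : R →+* S) (x : R) (k : Fin 6) :
    f (orbitDen x k) = orbitDen (f x) k := by
  fin_cases k <;> simp [orbitDen]

lemma orbitNum_ne_zero {x : ℂ} (h0 : x ≠ 0) (h1 : x ≠ 1) (k : Fin 6) : orbitNum x k ≠ 0 := by
  have := sub_ne_zero.2 h1
  have := sub_ne_zero.2 h1.symm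
  fin_cases k <;> simp [orbitNum, *]

lemma orbitDen_ne_zero {x : ℂ} (h0 : x ≠ 0) (h1 : x ≠ 1) (k : Fin 6) : orbitDen x k ≠ 0 := by
  have := sub_ne_zero.2 h1
  have := sub_ne_zero.2 h1.symm
  fin_cases k <;> simp [orbitDen, *]

lemma exists_orbit_eq_zero (k : Fin 6) : ∃ z : ℂ,
    orbitNum z k = 0 ∧ orbitDen z k ≠ 0 ∨ orbitNum z k ≠ 0 ∧ orbitDen z k = 0 := by
  fin_cases k
  · exact ⟨0, by simp [orbitNum, orbitDen]⟩
  · exact ⟨0, by simp [orbitNum, orbitDen]⟩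
  · exact ⟨1, by simp [orbitNum, orbitDen]⟩
  · exact ⟨1, by simp [orbitNum, orbitDen]⟩
  · exact ⟨1, by simp [orbitNum, orbitDen]⟩
  · exact ⟨0, by simp [orbitNum, orbitDen]⟩

lemma self_mem_crossOrbit (x : ℂ) : x ∈ crossOrbit x := ⟨0, by simp [orbitNum, orbitDen]⟩

lemma ne_zero_of_mem_crossOrbit {x t : ℂ} (h0 : x ≠ 0) (h1 : x ≠ 1) (ht : t ∈ crossOrbit x) :
    t ≠ 0 := by
  rintro rfl
  obtain ⟨k, hk⟩ := ht
  exact orbitNum_ne_zero h0 h1 k (by rw [← hk, zero_mul])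

lemma inv_mem_crossOrbit {x t : ℂ} (h0 : x ≠ 0) (h1 : x ≠ 1) (ht : t ∈ crossOrbit x) :
    t⁻¹ ∈ crossOrbit x := by
  have ht0 := ne_zero_of_mem_crossOrbit h0 h1 ht
  obtain ⟨k, hk⟩ := ht
  refine ⟨![1, 0, 3, 2, 5, 4] k, ?_⟩
  rw [inv_mul_eq_iff_eq_mul₀ ht0]
  fin_cases k <;> simpa [orbitNum, orbitDen] using hk.symm

lemma one_sub_mem_crossOrbit {x t : ℂ} (ht : t ∈ crossOrbit x) : 1 - t ∈ crossOrbit x := by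
  obtain ⟨k, hk⟩ := ht
  refine ⟨![2, 4, 0, 5, 1, 3] k, ?_⟩
  fin_cases k <;> simp [orbitNum, orbitDen] at hk ⊢ <;>
    first | linear_combination -hk | linear_combination hk

lemma ne_one_of_mem_crossOrbit {x t : ℂ} (h0 : x ≠ 0) (h1 : x ≠ 1) (ht : t ∈ crossOrbit x) :
    t ≠ 1 := by
  have := ne_zero_of_mem_crossOrbit h0 h1 (one_sub_mem_crossOrbit ht)
  rintro rfl
  simp at this

open MvPolynomial in
lemma orbit_sub_ne_zero {σ : Type*} {i j : σ} (hij : i ≠ j) (k k' : Fin 6) :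
    orbitNum (X i : MvPolynomial σ ℂ) k * orbitDen (X j) k' -
      orbitDen (X i) k * orbitNum (X j) k' ≠ 0 := by
  classical
  obtain ⟨z, hz⟩ := exists_orbit_eq_zero k
  have hn := orbitNum_ne_zero two_ne_zero (by norm_num : (2 : ℂ) ≠ 1) k'
  have hd := orbitDen_ne_zero two_ne_zero (by norm_num : (2 : ℂ) ≠ 1) k'
  intro h
  have := congrArg (eval (Function.update (fun _ => (2 : ℂ)) i z)) h
  simp only [map_sub, map_mul, map_orbitNum, map_orbitDen, eval_X, map_zero,
    Function.update_self, Function.update_of_ne hij.symm] at this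
  rcases hz with ⟨h1, h2⟩ | ⟨h1, h2⟩ <;> simp_all

open MvPolynomial in
lemma orbit_sub_mul_ne_zero {σ : Type*} {i j l : σ} (hij : i ≠ j) (hil : i ≠ l)
    (k k' k'' : Fin 6) :
    orbitNum (X i : MvPolynomial σ ℂ) k * (orbitDen (X j) k' * orbitDen (X l) k'') -
      orbitDen (X i) k * (orbitNum (X j) k' * orbitNum (X l) k'') ≠ 0 := by
  classical
  obtain ⟨z, hz⟩ := exists_orbit_eq_zero k
  have hn := orbitNum_ne_zero two_ne_zero (by norm_num : (2 : ℂ) ≠ 1)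
  have hd := orbitDen_ne_zero two_ne_zero (by norm_num : (2 : ℂ) ≠ 1)
  intro h
  have := congrArg (eval (Function.update (fun _ => (2 : ℂ)) i z)) h
  simp only [map_sub, map_mul, map_orbitNum, map_orbitDen, eval_X, map_zero,
    Function.update_self, Function.update_of_ne hij.symm, Function.update_of_ne hil.symm] at this
  rcases hz with ⟨h1, h2⟩ | ⟨h1, h2⟩ <;> simp_all

open MvPolynomial in
/-- The genericity conditions on cross-ratios hold outside a hypersurface. -/
lemma exists_polynomial_generic {σ : Type*} [Fintype σ] : ∃ q : MvPolynomial σ ℂ, q ≠ 0 ∧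
    ∀ a : σ → ℂ, eval a q ≠ 0 →
      (∀ i j, i ≠ j → ∀ t ∈ crossOrbit (a i), ∀ s ∈ crossOrbit (a j), t ≠ s) ∧
      ∀ i j l, [i, j, l].Nodup → ∀ t ∈ crossOrbit (a i), ∀ s ∈ crossOrbit (a j),
        ∀ r ∈ crossOrbit (a l), t ≠ s * r := by
  classical
  let F : σ × σ × Fin 6 × Fin 6 → MvPolynomial σ ℂ := fun p =>
    orbitNum (X p.1) p.2.2.1 * orbitDen (X p.2.1) p.2.2.2 -
      orbitDen (X p.1) p.2.2.1 * orbitNum (X p.2.1) p.2.2.2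
  let G : σ × σ × σ × Fin 6 × Fin 6 × Fin 6 → MvPolynomial σ ℂ := fun p =>
    orbitNum (X p.1) p.2.2.2.1 *
        (orbitDen (X p.2.1) p.2.2.2.2.1 * orbitDen (X p.2.2.1) p.2.2.2.2.2) -
      orbitDen (X p.1) p.2.2.2.1 *
        (orbitNum (X p.2.1) p.2.2.2.2.1 * orbitNum (X p.2.2.1) p.2.2.2.2.2)
  refine ⟨(∏ p with p.1 ≠ p.2.1, F p) * ∏ p with p.1 ≠ p.2.1 ∧ p.1 ≠ p.2.2.1, G p, ?_, ?_⟩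
  · refine mul_ne_zero (Finset.prod_ne_zero_iff.2 fun p hp => ?_)
      (Finset.prod_ne_zero_iff.2 fun p hp => ?_)
    · exact orbit_sub_ne_zero (Finset.mem_filter.1 hp).2 _ _
    · exact orbit_sub_mul_ne_zero (Finset.mem_filter.1 hp).2.1 (Finset.mem_filter.1 hp).2.2 _ _ _
  · intro a ha
    rw [map_mul, mul_ne_zero_iff, map_prod, map_prod, Finset.prod_ne_zero_iff,
      Finset.prod_ne_zero_iff] at ha
    refine ⟨?_, ?_⟩
    · rintro i j hij t ⟨k, hk⟩ s ⟨k', hk'⟩ rfl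
      refine ha.1 (i, j, k, k') (by simpa using hij) ?_
      simp only [F, map_sub, map_mul, map_orbitNum, map_orbitDen, eval_X]
      rw [← hk, ← hk']
      ring
    · rintro i j l hn t ⟨k, hk⟩ s ⟨k', hk'⟩ r ⟨k'', hk''⟩ rfl
      refine ha.2 (i, j, l, k, k', k'') (by
        simp only [List.nodup_cons, List.mem_cons, List.not_mem_nil, or_false, not_or] at hn
        simpa using hn.1) ?_
      simp only [G, map_sub, map_mul, map_orbitNum, map_orbitDen, eval_X]
      rw [← hk, ← hk', ← hk'']
      ring

/-- First homogeneous coordinate of a point of `ℙ¹`. -/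
def homX : OnePoint ℂ → ℂ
  | Option.none => 1
  | Option.some z => z

/-- Second homogeneous coordinate of a point of `ℙ¹`. -/
def homY : OnePoint ℂ → ℂ
  | Option.none => 0
  | Option.some _ => 1

/-- The determinant of the homogeneous coordinates of two points of a configuration. -/
def pointBracket {V : Type*} (p : V → OnePoint ℂ) (x y : V) : ℂ :=
  homX (p x) * homY (p y) - homX (p y) * homY (p x)

lemma hom_ne_zero {x y : OnePoint ℂ} (h : x ≠ y) : homX x * homY y - homX y * homY x ≠ 0 := by
  rcases x with _ | x <;> rcases y with _ | y
  · exact absurd rfl h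
  · simp [homX, homY]
  · simp [homX, homY]
  · simpa [homX, homY, sub_eq_zero] using fun hxy => h (congrArg _ hxy)

lemma isBracket_pointBracket {V : Type*} {p : V → OnePoint ℂ} (hp : Function.Injective p) :
    IsBracket (pointBracket p) where
  anti x y := by simp only [pointBracket]; ring
  plucker x y u v := by simp only [pointBracket]; ring
  ne_zero x y hxy := hom_ne_zero (hp.ne hxy)

lemma crossRel_of_CR_eq {V : Type*} {p : V → OnePoint ℂ} (hp : Function.Injective p) {t : ℂ}
    {a b c d : V} (hn : [a, b, c, d].Nodup) (h : CR (p a) (p b) (p c) (p d) = t) :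
    CrossRel (pointBracket p) t a b c d := by
  have h1 := hom_ne_zero (hp.ne (show c ≠ b by grind))
  have h2 := hom_ne_zero (hp.ne (show d ≠ a by grind))
  have h3 := hp.ne (show a ≠ b by grind)
  have h4 := hp.ne (show a ≠ c by grind)
  have h5 := hp.ne (show a ≠ d by grind)
  have h6 := hp.ne (show b ≠ c by grind)
  have h7 := hp.ne (show b ≠ d by grind)
  have h8 := hp.ne (show c ≠ d by grind)
  simp only [CrossRel, pointBracket]
  generalize p a = A at *
  generalize p b = B at *
  generalize p c = C at *
  generalize p d = D at *
  subst h
  rcases A with _ | A <;> rcases B with _ | B <;> rcases C with _ | C <;> rcases D with _ | D <;>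
    first
    | exact absurd rfl ‹_›
    | (simp only [homX, homY, CR, mul_one, mul_zero, one_mul, sub_zero, zero_sub] at *
       field_simp)

lemma of_perm_four {V : Type*} {P : V → V → V → V → Prop}
    (h1 : ∀ a b c d, P a b c d → P b a c d) (h2 : ∀ a b c d, P a b c d → P a c b d)
    (h3 : ∀ a b c d, P a b c d → P a b d c) {a b c d w x y z : V} (h : P a b c d)
    (hw : w = a ∨ w = b ∨ w = c ∨ w = d) (hx : x = a ∨ x = b ∨ x = c ∨ x = d)
    (hy : y = a ∨ y = b ∨ y = c ∨ y = d) (hz : z = a ∨ z = b ∨ z = c ∨ z = d)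
    (hn : [w, x, y, z].Nodup) : P w x y z := by
  simp only [List.nodup_cons, List.mem_cons, List.not_mem_nil, or_false, not_or] at hn
  obtain ⟨⟨hwx, hwy, hwz⟩, ⟨hxy, hxz⟩, hyz, -⟩ := hn
  rcases hw with rfl | rfl | rfl | rfl <;> rcases hx with rfl | rfl | rfl | rfl <;>
    first
    | exact absurd rfl hwx
    | (rcases hy with rfl | rfl | rfl | rfl <;>
        first
        | exact absurd rfl hwy
        | exact absurd rfl hxy
        | (rcases hz with rfl | rfl | rfl | rfl <;>
            first
            | exact absurd rfl hwz
            | exact absurd rfl hxz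
            | exact absurd rfl hyz
            | solve_by_elim (maxDepth := 8)))

lemma exists_crossRel_of_perm {V : Type*} {𝒟 : Set (V → V → ℂ)} (h𝒟 : ∀ D ∈ 𝒟, IsBracket D)
    {r : ℂ} (hr0 : r ≠ 0) (hr1 : r ≠ 1) {a b c d w x y z : V}
    (h : ∀ D ∈ 𝒟, CrossRel D r a b c d)
    (hw : w = a ∨ w = b ∨ w = c ∨ w = d) (hx : x = a ∨ x = b ∨ x = c ∨ x = d)
    (hy : y = a ∨ y = b ∨ y = c ∨ y = d) (hz : z = a ∨ z = b ∨ z = c ∨ z = d)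
    (hn : [w, x, y, z].Nodup) : ∃ t ∈ crossOrbit r, ∀ D ∈ 𝒟, CrossRel D t w x y z := by
  refine of_perm_four (P := fun a b c d => ∃ t ∈ crossOrbit r, ∀ D ∈ 𝒟, CrossRel D t a b c d)
    ?_ ?_ ?_ ⟨r, self_mem_crossOrbit r, h⟩ hw hx hy hz hn
  · rintro a b c d ⟨t, ht, h⟩
    have ht0 := ne_zero_of_mem_crossOrbit hr0 hr1 ht
    refine ⟨t⁻¹, inv_mem_crossOrbit hr0 hr1 ht, fun D hD => ?_⟩
    rw [CrossRel, h D hD, inv_mul_cancel_left₀ ht0]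
  · rintro a b c d ⟨t, ht, h⟩
    refine ⟨1 - t, one_sub_mem_crossOrbit ht, fun D hD => ?_⟩
    have hrel := h D hD
    have h1 := (h𝒟 D hD).plucker a b c d
    have h2 := (h𝒟 D hD).anti
    rw [CrossRel] at hrel ⊢
    rw [h2 a b, h2 c d, h2 a c, h2 b d, h2 a d] at h1
    rw [h2 b c]
    rw [h2 b c] at h1
    linear_combination h1 + hrel
  · rintro a b c d ⟨t, ht, h⟩
    have ht0 := ne_zero_of_mem_crossOrbit hr0 hr1 ht
    refine ⟨t⁻¹, inv_mem_crossOrbit hr0 hr1 ht, fun D hD => ?_⟩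
    have := h D hD
    rw [CrossRel] at this ⊢
    rw [mul_comm (D d b), this, inv_mul_cancel_left₀ ht0, mul_comm]

lemma eq_coord_of_normalized {V : Type*} {p : V → OnePoint ℂ} (hp : Function.Injective p)
    {u v w : V} (hu : p u = ∞) (hv : p v = ((0 : ℂ) : OnePoint ℂ))
    (hw : p w = ((1 : ℂ) : OnePoint ℂ)) {x : V} (hx : x ≠ u) :
    p x = (coord (pointBracket p) u v w x : OnePoint ℂ) := by
  have hxu := hp.ne hx
  rw [coord]
  simp only [pointBracket]
  rw [hu] at hxu ⊢
  rw [hv, hw]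
  generalize p x = X at *
  rcases X with _ | z
  · exact absurd rfl hxu
  · change (z : OnePoint ℂ) = _
    congr 1
    change z = (z * 1 - 0 * 1) * (1 * 0 - 1 * 1) / ((z * 0 - 1 * 1) * (1 * 1 - 0 * 1))
    norm_num

lemma eq_of_agree {V : Type*} [Fintype V] {p p' : V → OnePoint ℂ} (hp : Function.Injective p)
    (hp' : Function.Injective p') {u v w : V} (hn : [u, v, w].Nodup) (hu : p u = ∞)
    (hv : p v = ((0 : ℂ) : OnePoint ℂ)) (hw : p w = ((1 : ℂ) : OnePoint ℂ)) (hu' : p' u = ∞)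
    (hv' : p' v = ((0 : ℂ) : OnePoint ℂ)) (hw' : p' w = ((1 : ℂ) : OnePoint ℂ))
    (hA : Agree (pointBracket p) (pointBracket p') Finset.univ) : p = p' := by
  funext x
  by_cases hx : x = u
  · rw [hx, hu, hu']
  · rw [eq_coord_of_normalized hp hu hv hw hx, eq_coord_of_normalized hp' hu' hv' hw' hx,
      hA.coord_eq (isBracket_pointBracket hp) hn (Finset.mem_univ _) (Finset.mem_univ _)
        (Finset.mem_univ _) (Finset.mem_univ _) hx]

lemma Set.finite_and_ncard_le_two {α : Type*} {S : Set α}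
    (h : ∀ x ∈ S, ∀ y ∈ S, ∀ z ∈ S, x = y ∨ x = z ∨ y = z) : S.Finite ∧ S.ncard ≤ 2 := by
  have hle : S.encard ≤ 2 := by
    by_contra! hlt
    obtain ⟨t, hts, ht⟩ := Set.exists_subset_encard_eq
      (show (3 : ℕ∞) ≤ S.encard from Order.add_one_le_of_lt hlt)
    obtain ⟨x, y, z, hxy, hxz, hyz, rfl⟩ := Set.encard_eq_three.1 ht
    rcases h x (hts (by simp)) y (hts (by simp)) z (hts (by simp)) with h | h | h <;>
      contradiction
  refine ⟨Set.finite_of_encard_le_coe (k := 2) hle, ?_⟩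
  rw [Set.ncard_def]
  exact ENat.toNat_le_of_le_natCast hle

/-- Any cross-ratio datum on 7 points (four 4-tuples of pairwise distinct indices,
covering every index) has cross-ratio degree at most 2. -/
theorem maxCrossRatioDegree_seven_points_le_two
    (T : Fin 4 → Fin 4 → Fin 7)
    (hT : ∀ i, Function.Injective (T i))
    (hcov : ∀ v : Fin 7, ∃ i j, T i j = v) :
    ∃ q : MvPolynomial (Fin 4) ℂ, q ≠ 0 ∧
      ∀ a : Fin 4 → ℂ, (∀ i, a i ≠ 0 ∧ a i ≠ 1) → MvPolynomial.eval a q ≠ 0 →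
        let S : Set (Fin 7 → OnePoint ℂ) :=
          {p | Function.Injective p ∧ p 0 = ∞ ∧ p 1 = ((0 : ℂ) : OnePoint ℂ) ∧
            p 2 = ((1 : ℂ) : OnePoint ℂ) ∧
            ∀ i, CR (p (T i 0)) (p (T i 1)) (p (T i 2)) (p (T i 3)) = a i}
        S.Finite ∧ S.ncard ≤ 2 := by
  obtain ⟨q, hq, hgen⟩ := exists_polynomial_generic (σ := Fin 4)
  refine ⟨q, hq, fun a ha haq => ?_⟩
  obtain ⟨hne, hne_mul⟩ := hgen a haq
  intro S
  have hmem : ∀ i x, x ∈ Finset.univ.image (T i) →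
      x = T i 0 ∨ x = T i 1 ∨ x = T i 2 ∨ x = T i 3 := by
    intro i x hx
    obtain ⟨j, -, rfl⟩ := Finset.mem_image.1 hx
    fin_cases j <;> simp
  have hbr : ∀ D ∈ pointBracket '' S, IsBracket D := by
    rintro D ⟨p, hp, rfl⟩
    exact isBracket_pointBracket hp.1
  have hD : Datum (pointBracket '' S) (fun i => crossOrbit (a i))
      (fun i => Finset.univ.image (T i)) :=
    { bracket := hbr
      card := fun i => by rw [Finset.card_image_of_injective _ (hT i)]; rfl
      rel := fun i w x y z hw hx hy hz hn => by
        refine exists_crossRel_of_perm hbr (ha i).1 (ha i).2 ?_ (hmem i w hw) (hmem i x hx)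
          (hmem i y hy) (hmem i z hz) hn
        rintro D ⟨p, hp, rfl⟩
        refine crossRel_of_CR_eq hp.1 ?_ (hp.2.2.2.2 i)
        simp [(hT i).eq_iff]
      ne_zero := fun i t => ne_zero_of_mem_crossOrbit (ha i).1 (ha i).2
      ne_one := fun i t => ne_one_of_mem_crossOrbit (ha i).1 (ha i).2
      ne := hne
      ne_mul := hne_mul }
  refine Set.finite_and_ncard_le_two fun x hx y hy z hz => ?_
  have htwo := hD.twoAgree_univ ⟨_, x, hx, rfl⟩ (by simp) (fun v => by
    obtain ⟨i, j, hij⟩ := hcov v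
    exact ⟨i, Finset.mem_image.2 ⟨j, Finset.mem_univ j, hij⟩⟩)
  have huniq : ∀ p ∈ S, ∀ p' ∈ S, Agree (pointBracket p) (pointBracket p') Finset.univ → p = p' :=
    fun p hp p' hp' => eq_of_agree hp.1 hp'.1 (u := 0) (v := 1) (w := 2) (by decide) hp.2.1
      hp.2.2.1 hp.2.2.2.1 hp'.2.1 hp'.2.2.1 hp'.2.2.2.1
  exact (htwo _ ⟨x, hx, rfl⟩ _ ⟨y, hy, rfl⟩ _ ⟨z, hz, rfl⟩).imp (huniq x hx y hy)
    (Or.imp (huniq x hx z hz) (huniq y hy z hz))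
end

section
/- The number of isomorphism classes of 4-uniform hypergraphs with exactly 5 hyperedges on 8 vertices having no isolated vertices is 484. Precisely, the action of the symmetric group on Fin 8 on the set of families E of 4-element subsets of Fin 8 with |E| = 5 such that every vertex of Fin 8 lies in at least one member of E has exactly 484 orbits. -/
/-- Relabeling action: a permutation `σ` sends a family `E` of subsets to `{σ(e) : e ∈ E}`. -/
def permImage {n : ℕ} (σ : Equiv.Perm (Fin n)) (E : Finset (Finset (Fin n))) :
    Finset (Finset (Fin n)) :=
  E.image fun e => e.image σ

lemma permImage_permImage {n : ℕ} (σ τ : Equiv.Perm (Fin n)) (E : Finset (Finset (Fin n))) :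
    permImage τ (permImage σ E) = permImage (τ * σ) E := by
  unfold permImage
  rw [Finset.image_image]
  refine Finset.image_congr ?_
  intro e _
  simp [Function.comp, Finset.image_image]

lemma permImage_one {n : ℕ} (E : Finset (Finset (Fin n))) : permImage 1 E = E := by
  unfold permImage
  simp

/-- The isomorphism (relabeling) setoid on hypergraphs on `Fin n` satisfying a
property `P`: two hypergraphs are isomorphic iff one is obtained from the other by
relabeling the vertices by a permutation. -/
def hypergraphSetoid (n : ℕ) (P : Finset (Finset (Fin n)) → Prop) :
    Setoid {E : Finset (Finset (Fin n)) // P E} where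
  r E F := ∃ σ : Equiv.Perm (Fin n), F.1 = permImage σ E.1
  iseqv := by
    constructor
    · intro E; exact ⟨1, (permImage_one E.1).symm⟩
    · rintro E F ⟨σ, h⟩
      refine ⟨σ⁻¹, ?_⟩
      rw [h, permImage_permImage]
      simp [permImage_one]
    · rintro E F G ⟨σ, h⟩ ⟨τ, h'⟩
      exact ⟨τ * σ, by rw [h', h, permImage_permImage]⟩

section Computation

open Finset

/-- Prepend a block of `n` vertices with code `x`, unless it is empty. The case distinction on `x`
makes the kernel store evaluated codes. -/
def consBlock (x n : ℕ) (u : List (ℕ × ℕ)) : List (ℕ × ℕ) :=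
  match x, n with
  | _, 0 => u
  | 0, n + 1 => (0, n + 1) :: u
  | x + 1, n + 1 => (x + 1, n + 1) :: u

/-- All ways to refine a list of blocks `(code, size)` by a new hyperedge of size `s`: a vertex
with code `x` gets the code `2 * x + 1` if it belongs to the new hyperedge and `2 * x` if not. -/
def splits : List (ℕ × ℕ) → ℕ → List (List (ℕ × ℕ))
  | [], 0 => [[]]
  | [], _ + 1 => []
  | p :: t, s => (List.range (min p.2 s + 1)).flatMap fun a =>
      (splits t (s - a)).map fun u => consBlock (2 * p.1 + 1) a (consBlock (2 * p.1) (p.2 - a) u)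

/-- The sum of `g` over the codes of all vertices. It is written in a form which the kernel
evaluates quickly. -/
def blockSum (g : ℕ → ℕ) (l : List (ℕ × ℕ)) : ℕ :=
  List.rec Nat.zero (fun p _ r => Nat.add (Nat.mul (Prod.snd p) (g (Prod.fst p))) r) l

/-- The contribution of a vertex with code `x` to the key of a list of `k` hyperedges. -/
def weight : ℕ → ℕ → ℕ
  | 0, _ => 0
  | k + 1, x => 16 ^ 2 ^ (k + 1) * weight k (x / 2) + 16 ^ x

/-- The code whose binary digits are those of `x` at the positions listed in `p`. -/
def permCode (x : ℕ) : List ℕ → ℕ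
  | [] => 0
  | i :: p => Nat.add (Nat.mul 2 (permCode x p)) (Nat.mod (Nat.shiftRight x i) 2)

/-- No reordering of the `k` hyperedges has a smaller key. -/
def isMin (k : ℕ) (st : List (ℕ × ℕ)) : Bool :=
  (List.range k).permutations'.all fun p =>
    (blockSum (weight k) st).ble (blockSum (fun x => weight k (permCode x p)) st)

/-- The block lists of the lists of `k` hyperedges with minimal key. -/
def minimalStates : ℕ → List (List (ℕ × ℕ))
  | 0 => [[(0, 8)]]
  | k + 1 => ((minimalStates k).flatMap fun st => splits st 4).filter (isMin (k + 1))

/-- The five hyperedges are distinct and cover all vertices. -/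
def isProper (st : List (ℕ × ℕ)) : Bool :=
  (blockSum (fun x => if x = 0 then 1 else 0) st).beq 0 &&
  (List.range 5).all fun i => (List.range i).all fun j =>
    !(blockSum (fun x => (x / 2 ^ i + x / 2 ^ j) % 2) st).beq 0

/-- The minimal keys of the hypergraphs with five hyperedges and no isolated vertices. -/
def minimalKeys : List ℕ :=
  ((((minimalStates 4).flatMap fun st => splits st 4).filter isProper).filter (isMin 5)).map
    (blockSum (weight 5))

lemma minimalKeys_length_and_isChain :
    minimalKeys.length = 484 ∧ minimalKeys.IsChain (· < ·) := by
  decide +kernel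

lemma card_toFinset_minimalKeys : minimalKeys.toFinset.card = 484 := by
  obtain ⟨h, h'⟩ := minimalKeys_length_and_isChain
  have : minimalKeys.Nodup := (List.isChain_iff_pairwise.1 h').imp fun h => h.ne
  rw [List.toFinset_card_of_nodup this, h]

lemma blockSum_cons (g : ℕ → ℕ) (p : ℕ × ℕ) (l : List (ℕ × ℕ)) :
    blockSum g (p :: l) = p.2 * g p.1 + blockSum g l := rfl

lemma permCode_cons (x i : ℕ) (p : List ℕ) :
    permCode x (i :: p) = 2 * permCode x p + x / 2 ^ i % 2 := by
  rw [← Nat.shiftRight_eq_div_pow]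
  rfl

end Computation

section Blocks

open Finset

variable {V : Type*} [DecidableEq V]

/-- The vertex set `S` splits into blocks with the codes and sizes listed in `st`. -/
def Blocks (c : V → ℕ) : List (ℕ × ℕ) → Finset V → Prop
  | [], S => S = ∅
  | p :: t, S => ∃ A ⊆ S, #A = p.2 ∧ (∀ v ∈ A, c v = p.1) ∧ Blocks c t (S \ A)

lemma Blocks.congr {c c' : V → ℕ} {st : List (ℕ × ℕ)} {S : Finset V}
    (h : Blocks c st S) (hc : ∀ v ∈ S, c v = c' v) : Blocks c' st S := by
  induction st generalizing S with
  | nil => exact h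
  | cons p t ih =>
    obtain ⟨A, hA, hcard, hp, ht⟩ := h
    exact ⟨A, hA, hcard, fun v hv => (hc v (hA hv)).symm.trans (hp v hv),
      ih ht fun v hv => hc v (mem_sdiff.1 hv).1⟩

lemma Blocks.blockSum_eq {c : V → ℕ} {st : List (ℕ × ℕ)} {S : Finset V} (h : Blocks c st S)
    (g : ℕ → ℕ) : blockSum g st = ∑ v ∈ S, g (c v) := by
  induction st generalizing S with
  | nil =>
    obtain rfl : S = ∅ := h
    rfl
  | cons p t ih =>
    obtain ⟨A, hA, hcard, hp, ht⟩ := h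
    rw [blockSum_cons, ih ht, ← sum_sdiff hA, add_comm,
      sum_congr (s₁ := A) rfl fun v hv => by rw [hp v hv], sum_const, hcard, smul_eq_mul]

lemma blocks_consBlock {c : V → ℕ} {x n : ℕ} {u : List (ℕ × ℕ)} {S : Finset V} :
    Blocks c (consBlock x n u) S ↔ Blocks c ((x, n) :: u) S := by
  match x, n with
  | _, 0 =>
    constructor
    · intro h
      exact ⟨∅, by simp, by simp, by simp, by simpa [consBlock] using h⟩
    · rintro ⟨A, -, hA, -, h⟩
      obtain rfl : A = ∅ := card_eq_zero.1 hA
      simpa [consBlock] using h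
  | 0, n + 1 => rfl
  | x + 1, n + 1 => rfl

/-- The codes after adding the hyperedge `r`. -/
def addEdge (c : V → ℕ) (r : Finset V) (v : V) : ℕ := 2 * c v + if v ∈ r then 1 else 0

lemma Blocks.exists_mem_splits {c : V → ℕ} {st : List (ℕ × ℕ)} {S : Finset V}
    (h : Blocks c st S) (r : Finset V) :
    ∃ u ∈ splits st #(S ∩ r), Blocks (addEdge c r) u S := by
  induction st generalizing S with
  | nil =>
    obtain rfl : S = ∅ := h
    exact ⟨[], by simp [splits], rfl⟩
  | cons p t ih =>
    obtain ⟨A, hA, hcard, hp, ht⟩ := h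
    obtain ⟨u, hu, hu'⟩ := ih ht
    have h1 : #(A ∩ r) + #((S \ A) ∩ r) = #(S ∩ r) := by
      rw [← card_union_of_disjoint, ← union_inter_distrib_right, union_sdiff_of_subset hA]
      exact disjoint_sdiff.mono inter_subset_left inter_subset_left
    have h2 : #(A ∩ r) ≤ p.2 := hcard ▸ card_le_card inter_subset_left
    refine ⟨consBlock (2 * p.1 + 1) #(A ∩ r) (consBlock (2 * p.1) (p.2 - #(A ∩ r)) u), ?_, ?_⟩
    · simp only [splits, List.mem_flatMap, List.mem_range, List.mem_map]
      refine ⟨#(A ∩ r), by omega, u, ?_, rfl⟩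
      rwa [show #(S ∩ r) - #(A ∩ r) = #((S \ A) ∩ r) by omega]
    · refine blocks_consBlock.2 ⟨A ∩ r, inter_subset_left.trans hA, rfl, ?_,
        blocks_consBlock.2 ⟨A \ r, ?_, ?_, ?_, ?_⟩⟩
      · intro v hv
        rw [mem_inter] at hv
        simp [addEdge, hp v hv.1, hv.2]
      · intro v hv
        rw [mem_sdiff] at hv
        simp [hA hv.1, hv.2]
      · have := card_inter_add_card_sdiff A r
        dsimp only
        omega
      · intro v hv
        rw [mem_sdiff] at hv
        simp [addEdge, hp v hv.1, hv.2]
      · convert hu' using 1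
        ext v
        simp only [mem_sdiff, mem_inter]
        tauto

lemma Blocks.exists_of_mem_splits {c : V → ℕ} {st u : List (ℕ × ℕ)} {S : Finset V} {s : ℕ}
    (h : Blocks c st S) (hu : u ∈ splits st s) :
    ∃ r ⊆ S, #r = s ∧ Blocks (addEdge c r) u S := by
  induction st generalizing S s u with
  | nil =>
    obtain rfl : S = ∅ := h
    match s with
    | 0 =>
      obtain rfl : u = [] := by simpa [splits] using hu
      exact ⟨∅, by simp, rfl, rfl⟩
    | s + 1 => simp [splits] at hu
  | cons p t ih =>
    obtain ⟨A, hA, hcard, hp, ht⟩ := h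
    simp only [splits, List.mem_flatMap, List.mem_range, List.mem_map] at hu
    obtain ⟨a, ha, u, hu, rfl⟩ := hu
    obtain ⟨r, hr, hrs, hru⟩ := ih ht hu
    obtain ⟨B, hBA, hB⟩ := exists_subset_card_eq (s := A) (n := a) (by omega)
    have hdisj : Disjoint B r :=
      disjoint_of_subset_left hBA (disjoint_of_subset_right hr disjoint_sdiff)
    refine ⟨B ∪ r, union_subset (hBA.trans hA) (hr.trans sdiff_subset), ?_,
      blocks_consBlock.2 ⟨B, hBA.trans hA, hB, ?_, blocks_consBlock.2 ⟨A \ B, ?_, ?_, ?_, ?_⟩⟩⟩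
    · rw [card_union_of_disjoint hdisj]
      omega
    · intro v hv
      simp [addEdge, hp v (hBA hv), hv]
    · exact sdiff_subset_sdiff hA le_rfl
    · rw [card_sdiff_of_subset hBA, hcard, hB]
    · intro v hv
      rw [mem_sdiff] at hv
      have : v ∉ r := fun hvr => (mem_sdiff.1 (hr hvr)).2 hv.1
      simp [addEdge, hp v hv.1, hv.2, this]
    · have : (S \ B) \ (A \ B) = S \ A := by
        ext v
        simp only [mem_sdiff]
        have := @hBA v
        tauto
      rw [this]
      refine hru.congr fun v hv => ?_
      have : v ∉ B := fun hvB => (mem_sdiff.1 hv).2 (hBA hvB)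
      simp [addEdge, this]

end Blocks

section Code

open Finset

variable {V : Type*} [DecidableEq V]

/-- The binary number whose digits say which members of `l` contain `v`. -/
def code : List (Finset V) → V → ℕ
  | [] => fun _ => 0
  | e :: l => addEdge (code l) e

lemma code_cons_div_two (e : Finset V) (l : List (Finset V)) (v : V) :
    code (e :: l) v / 2 = code l v := by
  simp only [code, addEdge]
  split_ifs <;> omega

lemma code_lt (l : List (Finset V)) (v : V) : code l v < 2 ^ l.length := by
  induction l with
  | nil => simp [code]
  | cons e l ih =>
    simp only [code, addEdge, List.length_cons, pow_succ]
    split_ifs <;> omega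

lemma code_div_two_pow_mod_two (l : List (Finset V)) (v : V) (i : ℕ) :
    code l v / 2 ^ i % 2 = if v ∈ l.getD i ∅ then 1 else 0 := by
  induction l generalizing i with
  | nil => simp [code]
  | cons e l ih =>
    cases i with
    | zero =>
      simp only [code, addEdge, List.getD_cons_zero]
      split_ifs <;> omega
    | succ i => rw [pow_succ', ← Nat.div_div_eq_div_mul, code_cons_div_two, ih, List.getD_cons_succ]

lemma permCode_code (l : List (Finset V)) (v : V) (p : List ℕ) :
    permCode (code l v) p = code (p.map fun i => l.getD i ∅) v := by
  induction p with
  | nil => rfl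
  | cons i p ih => rw [permCode_cons, ih, code_div_two_pow_mod_two]; rfl

lemma code_eq_zero_iff (l : List (Finset V)) (v : V) : code l v = 0 ↔ ∀ e ∈ l, v ∉ e := by
  induction l with
  | nil => simp [code]
  | cons e l ih => simp [code, addEdge, ih, and_comm]

lemma code_map_image (l : List (Finset V)) (σ : Equiv.Perm V) (v : V) :
    code (l.map (image σ)) (σ v) = code l v := by
  induction l with
  | nil => rfl
  | cons e l ih => simp [code, addEdge, ih]

lemma eq_map_image_of_code_eq {l l' : List (Finset V)} (σ : Equiv.Perm V)
    (hl : l.length = l'.length) (h : ∀ v, code l v = code l' (σ v)) :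
    l' = l.map (image σ) := by
  induction l generalizing l' with
  | nil => simpa using hl.symm
  | cons e l ih =>
    obtain _ | ⟨e', l'⟩ := l'
    · simp at hl
    have htail : l' = l.map (image σ) := ih (by simpa using hl) fun v => by
      rw [← code_cons_div_two e, h, code_cons_div_two]
    rw [List.map_cons, ← htail]
    congr 1
    ext w
    obtain ⟨v, rfl⟩ := σ.surjective w
    have := h v
    simp only [code, addEdge] at this
    rw [(Equiv.injective σ).mem_finset_image]
    split_ifs at this <;> first | omega | tauto

end Code

section Key

open Finset

lemma eq_of_sum_mul_pow_eq {b : ℕ} {N : ℕ} {f g : ℕ → ℕ} (hf : ∀ i, f i < b) (hg : ∀ i, g i < b)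
    (h : ∑ i ∈ range N, f i * b ^ i = ∑ i ∈ range N, g i * b ^ i) {i : ℕ} (hi : i < N) :
    f i = g i := by
  induction N generalizing f g i with
  | zero => omega
  | succ N ih =>
    have key : ∀ f : ℕ → ℕ, ∑ i ∈ range (N + 1), f i * b ^ i =
        f 0 + b * ∑ i ∈ range N, f (i + 1) * b ^ i := by
      intro f
      rw [sum_range_succ', add_comm, mul_sum]
      simp only [pow_zero, mul_one, pow_succ]
      congr 1
      exact sum_congr rfl fun i _ => by ring
    have hb : 0 < b := (Nat.zero_le _).trans_lt (hf 0)
    rw [key, key] at h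
    have h0 : f 0 = g 0 := by
      have := congrArg (· % b) h
      simpa [Nat.mod_eq_of_lt (hf 0), Nat.mod_eq_of_lt (hg 0)] using this
    cases i with
    | zero => exact h0
    | succ i =>
      rw [h0] at h
      exact ih (f := fun i => f (i + 1)) (g := fun i => g (i + 1)) (fun i => hf _) (fun i => hg _)
        (Nat.eq_of_mul_eq_mul_left hb (by omega)) (by omega)

lemma exists_perm_of_sum_pow_eq {V : Type*} [Fintype V] [DecidableEq V] {b : ℕ}
    (hb : Fintype.card V < b) {c d : V → ℕ} (h : ∑ v, b ^ c v = ∑ v, b ^ d v) :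
    ∃ σ : Equiv.Perm V, ∀ v, c v = d (σ v) := by
  obtain ⟨N, hN⟩ : ∃ N, ∀ v, c v < N ∧ d v < N :=
    ⟨∑ v, (c v + d v) + 1, fun v => by
      have := single_le_sum (f := fun v => c v + d v) (fun _ _ => Nat.zero_le _) (mem_univ v)
      omega⟩
  have key : ∀ c : V → ℕ, (∀ v, c v < N) →
      ∑ v, b ^ c v = ∑ i ∈ range N, #{v | c v = i} * b ^ i := by
    intro c hc
    rw [← sum_fiberwise_of_maps_to (g := c) (t := range N) (fun v _ => mem_range.2 (hc v))]
    refine sum_congr rfl fun i _ => ?_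
    rw [sum_congr rfl fun v hv => by rw [(mem_filter.1 hv).2], sum_const, smul_eq_mul]
  rw [key c fun v => (hN v).1, key d fun v => (hN v).2] at h
  have hcard : ∀ i, #{v | c v = i} = #{v | d v = i} := by
    intro i
    by_cases hi : i < N
    · exact eq_of_sum_mul_pow_eq (fun i => (card_le_univ _).trans_lt hb)
        (fun i => (card_le_univ _).trans_lt hb) h hi
    · rw [filter_false_of_mem, filter_false_of_mem]
      · exact fun v _ hv => hi (hv ▸ (hN v).2)
      · exact fun v _ hv => hi (hv ▸ (hN v).1)
  have e : ∀ i, Nonempty ({v // c v = i} ≃ {v // d v = i}) := fun i =>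
    Fintype.card_eq.1 (by rw [Fintype.card_subtype, Fintype.card_subtype, hcard])
  replace e := fun i => (e i).some
  refine ⟨(Equiv.sigmaFiberEquiv c).symm.trans
    ((Equiv.sigmaCongrRight e).trans (Equiv.sigmaFiberEquiv d)), fun v => ?_⟩
  exact (e (c v) ⟨v, rfl⟩).2.symm

/-- A number which determines a list of hyperedges up to relabeling of the vertices, and in which
the key of the tail takes precedence. -/
def key (l : List (Finset (Fin 8))) : ℕ := ∑ v, weight l.length (code l v)

lemma key_cons (e : Finset (Fin 8)) (l : List (Finset (Fin 8))) :
    key (e :: l) = 16 ^ 2 ^ (e :: l).length * key l + ∑ v, 16 ^ code (e :: l) v := by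
  simp only [key, List.length_cons, weight, code_cons_div_two, sum_add_distrib, mul_sum]

lemma sum_pow_code_lt (l : List (Finset (Fin 8))) :
    ∑ v, 16 ^ code l v < 16 ^ 2 ^ l.length := by
  obtain ⟨n, hn⟩ : ∃ n, 2 ^ l.length = n + 1 :=
    Nat.exists_eq_add_one.2 (Nat.two_pow_pos l.length)
  calc ∑ v, 16 ^ code l v ≤ ∑ v : Fin 8, 16 ^ n := by
        refine sum_le_sum fun v _ => Nat.pow_le_pow_right (by norm_num) ?_
        have := code_lt l v
        omega
    _ < 16 ^ 2 ^ l.length := by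
        have : 0 < 16 ^ n := by positivity
        rw [hn, pow_succ]
        simp only [sum_const, card_univ, Fintype.card_fin, smul_eq_mul]
        omega

lemma key_map_image (l : List (Finset (Fin 8))) (σ : Equiv.Perm (Fin 8)) :
    key (l.map (image σ)) = key l := by
  unfold key
  rw [← Equiv.sum_comp σ]
  simp [code_map_image]

lemma exists_eq_map_image_of_key_eq {l l' : List (Finset (Fin 8))} (hl : l.length = l'.length)
    (h : key l = key l') : ∃ σ : Equiv.Perm (Fin 8), l' = l.map (image σ) := by
  obtain _ | ⟨e, l⟩ := l
  · exact ⟨1, by simpa using hl.symm⟩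
  obtain _ | ⟨e', l'⟩ := l'
  · simp at hl
  rw [key_cons, key_cons, hl] at h
  have h' := congrArg (· % 16 ^ 2 ^ (e' :: l').length) h
  simp only [Nat.mul_add_mod] at h'
  rw [Nat.mod_eq_of_lt (hl ▸ sum_pow_code_lt _), Nat.mod_eq_of_lt (sum_pow_code_lt _)] at h'
  obtain ⟨σ, hσ⟩ := exists_perm_of_sum_pow_eq (by simp) h'
  exact ⟨σ, eq_map_image_of_code_eq σ hl hσ⟩

/-- No reordering of `l` has a smaller key. -/
def IsMinimal (l : List (Finset (Fin 8))) : Prop := ∀ l', l'.Perm l → key l ≤ key l'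

lemma IsMinimal.tail {e : Finset (Fin 8)} {l : List (Finset (Fin 8))} (h : IsMinimal (e :: l)) :
    IsMinimal l := by
  intro l' hl'
  have h1 := h (e :: l') (hl'.cons e)
  rw [key_cons, key_cons] at h1
  have h2 := sum_pow_code_lt (e :: l')
  rw [show (e :: l').length = (e :: l).length from (hl'.cons e).length_eq] at h1 h2
  by_contra! h3
  have := Nat.mul_le_mul_left (16 ^ 2 ^ (e :: l).length) (Nat.succ_le_of_lt h3)
  rw [Nat.mul_succ] at this
  omega

lemma exists_perm_isMinimal (l : List (Finset (Fin 8))) : ∃ l', l'.Perm l ∧ IsMinimal l' := by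
  obtain ⟨l', hl', h⟩ := (measure key).wf.has_min {l' | l'.Perm l} ⟨l, List.Perm.refl l⟩
  exact ⟨l', hl', fun m hm => not_lt.1 (h m (hm.trans hl'))⟩

lemma IsMinimal.key_eq {l l' : List (Finset (Fin 8))} (h : IsMinimal l) (h' : IsMinimal l')
    (hl : l.Perm l') : key l = key l' :=
  (h l' hl.symm).antisymm (h' l hl)

lemma IsMinimal.map_image {l : List (Finset (Fin 8))} (h : IsMinimal l)
    (σ : Equiv.Perm (Fin 8)) : IsMinimal (l.map (image σ)) := by
  intro m hm
  have h1 := hm.map (image (σ⁻¹ : Equiv.Perm (Fin 8)))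
  have h2 : (l.map (image σ)).map (image (σ⁻¹ : Equiv.Perm (Fin 8))) = l := by
    simp [Function.comp_def, image_image]
  rw [h2] at h1
  rw [key_map_image, ← key_map_image m σ⁻¹]
  exact h _ h1

end Key

section Correctness

open Finset

lemma key_eq_blockSum {l : List (Finset (Fin 8))} {st : List (ℕ × ℕ)}
    (h : Blocks (code l) st univ) : key l = blockSum (weight l.length) st := by
  rw [h.blockSum_eq]
  rfl

lemma map_getD_range {α : Type*} (l : List α) (a : α) :
    (List.range l.length).map (fun i => l.getD i a) = l := by
  refine List.ext_getElem (by simp) fun i h _ => ?_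
  simp at h
  simp [h]

lemma isMin_iff {l : List (Finset (Fin 8))} {st : List (ℕ × ℕ)}
    (h : Blocks (code l) st univ) : isMin l.length st = true ↔ IsMinimal l := by
  have hp : ∀ p ∈ (List.range l.length).permutations',
      blockSum (fun x => weight l.length (permCode x p)) st =
        key (p.map fun i => l.getD i ∅) := by
    intro p hp
    have : p.length = l.length := by simpa using (List.mem_permutations'.1 hp).length_eq
    rw [h.blockSum_eq]
    simp [key, permCode_code, this]
  have hl : l.permutations' =
      (List.range l.length).permutations'.map (List.map fun i => l.getD i ∅) := by
    rw [List.map_permutations', map_getD_range]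
  simp only [isMin, List.all_eq_true, Nat.ble_eq, IsMinimal, ← List.mem_permutations', hl,
    List.forall_mem_map]
  refine forall₂_congr fun p h' => ?_
  rw [hp p h', key_eq_blockSum h]

lemma exists_mem_minimalStates {l : List (Finset (Fin 8))} (hl : ∀ e ∈ l, #e = 4)
    (h : IsMinimal l) : ∃ st ∈ minimalStates l.length, Blocks (code l) st univ := by
  induction l with
  | nil => exact ⟨[(0, 8)], by simp [minimalStates], univ, by simp, by simp, by simp [code],
      Finset.sdiff_self _⟩
  | cons e l ih =>
    obtain ⟨st, hst, hst'⟩ := ih (fun e he => hl e (by simp [he])) h.tail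
    obtain ⟨u, hu, hu'⟩ := hst'.exists_mem_splits e
    rw [univ_inter, hl e (by simp)] at hu
    exact ⟨u, List.mem_filter.2 ⟨List.mem_flatMap.2 ⟨st, hst, hu⟩,
      (isMin_iff (l := e :: l) hu').2 h⟩, hu'⟩

lemma exists_blocks_of_mem_minimalStates {k : ℕ} {st : List (ℕ × ℕ)}
    (hst : st ∈ minimalStates k) : ∃ l : List (Finset (Fin 8)), l.length = k ∧
      (∀ e ∈ l, #e = 4) ∧ Blocks (code l) st univ := by
  induction k generalizing st with
  | zero =>
    obtain rfl : st = [(0, 8)] := by simpa [minimalStates] using hst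
    exact ⟨[], rfl, by simp, univ, by simp, by simp, by simp [code], Finset.sdiff_self _⟩
  | succ k ih =>
    obtain ⟨st', hst', hu⟩ := List.mem_flatMap.1 (List.mem_filter.1 hst).1
    obtain ⟨l, rfl, hl, hb⟩ := ih hst'
    obtain ⟨r, -, hr, hb'⟩ := hb.exists_of_mem_splits hu
    exact ⟨r :: l, rfl, by simpa [hr] using hl, hb'⟩

lemma isProper_iff {l : List (Finset (Fin 8))} {st : List (ℕ × ℕ)} (hl : l.length = 5)
    (h : Blocks (code l) st univ) :
    isProper st = true ↔ l.Nodup ∧ ∀ v, ∃ e ∈ l, v ∈ e := by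
  have h1 : (blockSum (fun x => if x = 0 then 1 else 0) st = 0) ↔ ∀ v, ∃ e ∈ l, v ∈ e := by
    rw [h.blockSum_eq, sum_eq_zero_iff]
    simp [code_eq_zero_iff]
  have h2 : ∀ i j, blockSum (fun x => (x / 2 ^ i + x / 2 ^ j) % 2) st = 0 ↔
      l.getD i ∅ = l.getD j ∅ := by
    intro i j
    rw [h.blockSum_eq, sum_eq_zero_iff, Finset.ext_iff]
    refine ⟨fun H v => ?_, fun H v _ => ?_⟩
    · have := H v (mem_univ v)
      have h3 := code_div_two_pow_mod_two l v i
      have h4 := code_div_two_pow_mod_two l v j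
      split_ifs at h3 h4 <;> first | omega | tauto
    · have := H v
      have h3 := code_div_two_pow_mod_two l v i
      have h4 := code_div_two_pow_mod_two l v j
      split_ifs at h3 h4 <;> first | omega | tauto
  simp only [isProper, Bool.and_eq_true, Nat.beq_eq, List.all_eq_true, List.mem_range,
    Bool.not_eq_true', ← Bool.not_eq_true, h1, h2]
  rw [and_comm]
  refine and_congr_left fun _ => ?_
  rw [List.nodup_iff_pairwise_ne, List.pairwise_iff_getElem]
  constructor
  · intro H i j hi hj hij
    simpa [hi, hj, eq_comm] using H j (by omega) i hij
  · intro H i hi j hj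
    simpa [hl, hi, hj.trans hi, eq_comm] using H j i (by omega) (by omega) hj

lemma mem_minimalKeys {w : ℕ} : w ∈ minimalKeys ↔ ∃ l : List (Finset (Fin 8)),
    l.length = 5 ∧ (∀ e ∈ l, #e = 4) ∧ l.Nodup ∧ (∀ v, ∃ e ∈ l, v ∈ e) ∧ IsMinimal l ∧
      key l = w := by
  simp only [minimalKeys, List.mem_map, List.mem_filter, List.mem_flatMap]
  constructor
  · rintro ⟨u, ⟨⟨⟨st, hst, hu⟩, hp⟩, hm⟩, rfl⟩
    obtain ⟨l, hl5, hl, hb⟩ := exists_blocks_of_mem_minimalStates hst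
    obtain ⟨r, -, hr, hb'⟩ := hb.exists_of_mem_splits hu
    have hb' : Blocks (code (r :: l)) u univ := hb'
    have h5 : (r :: l).length = 5 := by simp [hl5]
    obtain ⟨hn, hc⟩ := (isProper_iff h5 hb').1 hp
    rw [← h5] at hm ⊢
    exact ⟨r :: l, rfl, by simpa [hr] using hl, hn, hc, (isMin_iff hb').1 hm, key_eq_blockSum hb'⟩
  · rintro ⟨l, h5, hl, hn, hc, hm, rfl⟩
    obtain _ | ⟨e, l⟩ := l
    · simp at h5
    obtain ⟨st, hst, hst'⟩ := exists_mem_minimalStates (fun e he => hl e (by simp [he])) hm.tail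
    obtain ⟨u, hu, hu'⟩ := hst'.exists_mem_splits e
    have hu' : Blocks (code (e :: l)) u univ := hu'
    rw [univ_inter, hl e (by simp)] at hu
    rw [show l.length = 4 by simpa using h5] at hst
    refine ⟨u, ⟨⟨⟨st, hst, hu⟩, (isProper_iff h5 hu').2 ⟨hn, hc⟩⟩, ?_⟩, ?_⟩
    · rw [← h5]
      exact (isMin_iff hu').2 hm
    · rw [← h5, key_eq_blockSum hu']

lemma toFinset_map_image (l : List (Finset (Fin 8))) (σ : Equiv.Perm (Fin 8)) :
    (l.map (image σ)).toFinset = permImage σ l.toFinset := by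
  ext e
  simp [permImage]

end Correctness

/-- There are exactly 484 isomorphism classes of 4-uniform hypergraphs with 5
hyperedges on 8 vertices with no isolated vertices. -/
theorem card_hypergraph_classes_eight_vertices_no_isolated :
    Nat.card (Quotient (hypergraphSetoid 8 fun E =>
      E.card = 5 ∧ (∀ e ∈ E, e.card = 4) ∧ ∀ v : Fin 8, ∃ e ∈ E, v ∈ e)) = 484 := by
  choose m hm hmin using fun E : Finset (Finset (Fin 8)) => exists_perm_isMinimal E.toList
  have hmem : ∀ E e, e ∈ m E ↔ e ∈ E := fun E e => by rw [(hm E).mem_iff, Finset.mem_toList]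
  have hmE : ∀ E, (m E).toFinset = E := fun E => by ext e; simp [hmem]
  have hlen : ∀ E, (m E).length = E.card := fun E => by
    rw [(hm E).length_eq, Finset.length_toList]
  have hnodup : ∀ E, (m E).Nodup := fun E => (hm E).nodup_iff.2 (Finset.nodup_toList E)
  have hkey : ∀ l : List (Finset (Fin 8)), l.Nodup → IsMinimal l →
      key (m l.toFinset) = key l := fun l hl hl' =>
    (hmin _).key_eq hl' ((List.perm_ext_iff_of_nodup (hnodup _) hl).2 fun e => by simp [hmem])
  have hcard : Nat.card minimalKeys.toFinset = 484 := by
    rw [Nat.card_eq_fintype_card, Fintype.card_coe, card_toFinset_minimalKeys]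
  rw [← hcard]
  refine Nat.card_eq_of_bijective (Quotient.lift (fun E => ⟨key (m E.1), ?_⟩) ?_) ⟨?_, ?_⟩
  · obtain ⟨h5, h4, hcover⟩ := E.2
    rw [List.mem_toFinset, mem_minimalKeys]
    exact ⟨m E.1, (hlen _).trans h5, fun e he => h4 e ((hmem _ _).1 he), hnodup _,
      fun v => by simpa [hmem] using hcover v, hmin _, rfl⟩
  · rintro E F ⟨σ, h⟩
    refine Subtype.ext ?_
    dsimp only
    rw [h, ← hmE E.1, ← toFinset_map_image,
      hkey _ ((hnodup _).map (Finset.image_injective σ.injective)) ((hmin _).map_image σ),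
      key_map_image, hmE]
  · rintro ⟨E⟩ ⟨F⟩ h
    obtain ⟨σ, hσ⟩ := exists_eq_map_image_of_key_eq
      (by rw [hlen, hlen, E.2.1, F.2.1]) (Subtype.ext_iff.1 h)
    refine Quotient.sound ⟨σ, ?_⟩
    rw [← hmE F.1, hσ, toFinset_map_image, hmE]
  · rintro ⟨w, hw⟩
    rw [List.mem_toFinset, mem_minimalKeys] at hw
    obtain ⟨l, h5, h4, hn, hc, hmin', rfl⟩ := hw
    exact ⟨Quotient.mk _ ⟨l.toFinset, by rw [List.toFinset_card_of_nodup hn, h5],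
      by simpa using h4, by simpa using hc⟩, Subtype.ext (hkey l hn hmin')⟩
end

section
/- The number of isomorphism classes of 4-uniform hypergraphs with exactly 5 hyperedges on 8 vertices (isolated vertices allowed) is 621. Precisely, the action of the symmetric group on Fin 8 on the set of families E of 4-element subsets of Fin 8 with |E| = 5 has exactly 621 orbits. (In Palmer's notation this is s³₈,₅ = 621.) -/
open Finset PowerSeries in
/-- Logarithmic differentiation of `1 + X ^ w`. -/
lemma derivative_one_add_X_pow {w : ℕ} (hw : 0 < w) :
    d⁄dX ℤ (1 + X ^ w : ℤ⟦X⟧) = (1 + X ^ w) * PowerSeries.mk fun j =>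
      (if w ∣ j + 1 then (w : ℤ) else 0) - 2 * if 2 * w ∣ j + 1 then (w : ℤ) else 0 := by
  ext j
  rw [coeff_derivative, add_mul, one_mul, map_add, map_add, coeff_X_pow, coeff_X_pow_mul',
    coeff_one, coeff_mk, coeff_mk]
  have hne : j + 1 ≠ 0 := by omega
  rw [if_neg hne]
  rcases lt_trichotomy (j + 1) w with h | h | h
  · rw [if_neg (by omega), if_neg (Nat.not_dvd_of_pos_of_lt (by omega) h),
      if_neg (Nat.not_dvd_of_pos_of_lt (by omega) (by omega)), if_neg (by omega)]
    simp
  · rw [if_pos h, h, if_pos dvd_rfl, if_neg (Nat.not_dvd_of_pos_of_lt hw (by omega)),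
      if_neg (by omega), ← h]
    simp
  · rw [if_neg (by omega), if_pos (show w ≤ j by omega)]
    by_cases hd : w ∣ j + 1
    · obtain ⟨m, hm⟩ := hd
      obtain ⟨n, rfl⟩ : ∃ n, m = n + 1 := ⟨m - 1, by rcases m with _ | m <;> simp_all⟩
      have hs : j - w + 1 = w * n := by rw [mul_add] at hm; omega
      simp only [hm, hs, mul_comm 2 w, Nat.mul_dvd_mul_iff_left hw]
      rcases Nat.even_or_odd n with hn | hn
      · have h2 : 2 ∣ n := hn.two_dvd
        simp [h2, show ¬ 2 ∣ n + 1 by omega]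
        ring
      · have h2 : ¬ 2 ∣ n := hn.not_two_dvd_nat
        simp [h2, show 2 ∣ n + 1 by obtain ⟨c, rfl⟩ := hn; omega]
        ring
    · have hd' : ¬ w ∣ j - w + 1 := by
        rw [show j - w + 1 = j + 1 - w by omega]
        exact fun h' => hd ((Nat.dvd_sub_self_right.1 h').resolve_right (by omega))
      rw [if_neg hd, if_neg hd', if_neg fun h' => hd (dvd_of_mul_left_dvd h'),
        if_neg fun h' => hd' (dvd_of_mul_left_dvd h')]
      simp

open Finset PowerSeries in
lemma derivative_prod_one_add_X_pow {ι : Type*} (s : Finset ι) {w : ι → ℕ} (hw : ∀ q, 0 < w q) :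
    d⁄dX ℤ (∏ q ∈ s, (1 + X ^ w q) : ℤ⟦X⟧) = (∏ q ∈ s, (1 + X ^ w q)) *
      ∑ q ∈ s, PowerSeries.mk fun j =>
        (if w q ∣ j + 1 then (w q : ℤ) else 0) - 2 * if 2 * w q ∣ j + 1 then (w q : ℤ) else 0 := by
  classical
  induction s using Finset.induction_on with
  | empty => simp
  | insert a s ha ih =>
    rw [prod_insert ha, sum_insert ha, Derivation.leibniz, ih, derivative_one_add_X_pow (hw a)]
    simp only [smul_eq_mul]
    ring

open Finset PowerSeries in
lemma coeff_prod_one_add_X_pow {ι : Type*} [Fintype ι] [DecidableEq ι] (w : ι → ℕ) (k : ℕ) :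
    coeff k (∏ q, (1 + X ^ w q) : ℤ⟦X⟧) = #{T : Finset ι | ∑ q ∈ T, w q = k} := by
  rw [prod_one_add, map_sum, powerset_univ, card_filter, Nat.cast_sum]
  refine sum_congr rfl fun T _ => ?_
  rw [prod_pow_eq_pow_sum, coeff_X_pow]
  simp [eq_comm]

/-- A Newton-type recurrence for the number of subfamilies of given total weight. -/
lemma newton_card_weight {ι : Type*} [Fintype ι] [DecidableEq ι] {w : ι → ℕ} (hw : ∀ q, 0 < w q)
    (f : ℕ → ℤ) (hf : ∀ e, f e = ∑ q, if w q ∣ e then (w q : ℤ) else 0) (k : ℕ) :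
    (∑ i ∈ Finset.range (k + 1), (Finset.card {T : Finset ι | ∑ q ∈ T, w q = k - i} : ℤ) *
      (f (i + 1) - if 2 ∣ i + 1 then 2 * f ((i + 1) / 2) else 0)) =
    (Finset.card {T : Finset ι | ∑ q ∈ T, w q = k + 1} : ℤ) * (k + 1) := by
  have h := congrArg (PowerSeries.coeff k) (derivative_prod_one_add_X_pow Finset.univ hw)
  rw [PowerSeries.coeff_derivative, coeff_prod_one_add_X_pow, PowerSeries.coeff_mul,
    Finset.Nat.sum_antidiagonal_eq_sum_range_succ_mk, ← Finset.sum_range_reflect] at h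
  rw [h]
  refine Finset.sum_congr rfl fun i hi => ?_
  have hi' : i ≤ k := by simpa [Nat.lt_succ_iff] using hi
  rw [show k + 1 - 1 - i = k - i by omega, coeff_prod_one_add_X_pow,
    show k - (k - i) = i by omega, map_sum]
  congr 1
  simp only [PowerSeries.coeff_mk]
  rw [Finset.sum_sub_distrib, ← hf, ← Finset.mul_sum]
  congr 1
  split_ifs with h2
  · rw [hf]
    simp only [Nat.dvd_div_iff_mul_dvd h2]
  · rw [Finset.sum_eq_zero, mul_zero]
    exact fun q _ => if_neg fun h' => h2 (dvd_of_mul_right_dvd h')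

/-- If `f e` is the number of fixed points of the `e`-th power of a permutation, this is the list
of the numbers of invariant subsets of sizes `k, k - 1, …, 0`. -/
def invariantCounts (f : ℕ → ℤ) : ℕ → List ℤ
  | 0 => [1]
  | k + 1 =>
    let l := invariantCounts f k
    ((∑ i ∈ Finset.range (k + 1),
      l.getD i 0 * (f (i + 1) - if 2 ∣ i + 1 then 2 * f ((i + 1) / 2) else 0)) / (k + 1)) :: l

lemma invariantCounts_getD {ι : Type*} [Fintype ι] [DecidableEq ι] {w : ι → ℕ}
    (hw : ∀ q, 0 < w q) (f : ℕ → ℤ)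
    (hf : ∀ e, f e = ∑ q, if w q ∣ e then (w q : ℤ) else 0) (k i : ℕ) (hi : i ≤ k) :
    (invariantCounts f k).getD i 0 = Finset.card {T : Finset ι | ∑ q ∈ T, w q = k - i} := by
  induction k generalizing i with
  | zero =>
    obtain rfl : i = 0 := by omega
    have : ({T : Finset ι | ∑ q ∈ T, w q = 0} : Finset (Finset ι)) = {∅} := by
      ext T
      simp [Finset.eq_empty_iff_forall_notMem, (hw _).ne']
    simp [invariantCounts, this, -Finset.sum_eq_zero_iff]
  | succ k ih =>
    rcases i with _ | i
    · rw [invariantCounts, List.getD_cons_zero, Finset.sum_congr rfl fun i hi => by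
        rw [ih i (by simpa [Nat.lt_succ_iff] using hi)], newton_card_weight hw f hf,
        Int.mul_ediv_cancel _ (by omega), Nat.sub_zero]
    · rw [invariantCounts, List.getD_cons_succ, ih i (by omega), Nat.add_sub_add_right]

section Action

open MulAction Pointwise

variable {G X : Type*} [Group G] [MulAction G X]

lemma pow_smul_eq_iff_card_orbit_dvd [Finite X] (g : G) (x : X) (e : ℕ) :
    g ^ e • x = x ↔ Nat.card (orbit (Subgroup.zpowers g) x) ∣ e := by
  classical
  have := Fintype.ofFinite (orbit (Subgroup.zpowers g) x)
  rw [Nat.card_eq_fintype_card, ← minimalPeriod_eq_card, pow_smul_eq_iff_minimalPeriod_dvd]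

/-- The fixed points of `g ^ e` fill exactly the `g`-orbits whose size divides `e`. -/
lemma card_fixedBy_pow [Finite X] (g : G)
    [Fintype (orbitRel.Quotient (Subgroup.zpowers g) X)] (e : ℕ) :
    (Nat.card (fixedBy X (g ^ e)) : ℤ) = ∑ q : orbitRel.Quotient (Subgroup.zpowers g) X,
      if Nat.card q.orbit ∣ e then (Nat.card q.orbit : ℤ) else 0 := by
  classical
  have := Fintype.ofFinite X
  rw [Nat.card_eq_card_toFinset, Finset.card_eq_sum_card_fiberwise
    (f := (Quotient.mk'' : X → orbitRel.Quotient (Subgroup.zpowers g) X))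
    (t := Finset.univ) (fun _ _ => Finset.mem_coe.2 (Finset.mem_univ _)), Nat.cast_sum]
  refine Finset.sum_congr rfl fun q _ => ?_
  have hq : ∀ x, (Quotient.mk'' x : orbitRel.Quotient (Subgroup.zpowers g) X) = q →
      (g ^ e • x = x ↔ Nat.card (orbitRel.Quotient.orbit q) ∣ e) := by
    rintro x rfl
    rw [pow_smul_eq_iff_card_orbit_dvd, orbitRel.Quotient.orbit_mk]
  split_ifs with h
  · rw [Nat.card_eq_card_toFinset]
    congr 2
    ext x
    simpa [orbitRel.Quotient.mem_orbit] using fun hx => (hq x hx).2 h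
  · rw [Nat.cast_eq_zero, Finset.card_eq_zero, Finset.filter_eq_empty_iff]
    exact fun x hx hxq => h ((hq x hxq).1 (by simpa using hx))

/-- Subsets invariant under `g` correspond to sets of `g`-orbits. -/
lemma card_fixedBy_powersetCard [Fintype X] [DecidableEq X] (g : G) (k : ℕ)
    [Fintype (orbitRel.Quotient (Subgroup.zpowers g) X)]
    [DecidableEq (orbitRel.Quotient (Subgroup.zpowers g) X)] :
    Nat.card (fixedBy (Set.powersetCard X k) g) =
      Finset.card {T : Finset (orbitRel.Quotient (Subgroup.zpowers g) X) |
        ∑ q ∈ T, Nat.card q.orbit = k} := by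
  have hcard : ∀ T : Finset (orbitRel.Quotient (Subgroup.zpowers g) X),
      ∑ q ∈ T, Nat.card q.orbit = Finset.card {x : X | Quotient.mk'' x ∈ T} := by
    intro T
    rw [Finset.card_eq_sum_card_fiberwise
      (f := fun x => (Quotient.mk'' x : orbitRel.Quotient (Subgroup.zpowers g) X)) (t := T)
      (fun x hx => by simpa using hx)]
    refine Finset.sum_congr rfl fun q hq => ?_
    classical
    rw [Nat.card_eq_card_toFinset]
    congr 1
    ext x
    simp only [Set.mem_toFinset, orbitRel.Quotient.mem_orbit, Finset.mem_filter, Finset.mem_univ,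
      true_and]
    exact ⟨fun h => ⟨h ▸ hq, h⟩, fun h => h.2⟩
  simp only [hcard]
  rw [← Fintype.card_subtype, ← Nat.card_eq_fintype_card]
  have hinv : ∀ T : Finset (orbitRel.Quotient (Subgroup.zpowers g) X),
      ∀ h : Finset.card {x : X | Quotient.mk'' x ∈ T} = k,
      (⟨_, h⟩ : Set.powersetCard X k) ∈ fixedBy (Set.powersetCard X k) g := by
    intro T h
    rw [mem_fixedBy, Subtype.ext_iff, Set.powersetCard.coe_smul]
    ext x
    have hx : (Quotient.mk'' (g⁻¹ • x) : orbitRel.Quotient (Subgroup.zpowers g) X) =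
        Quotient.mk'' x :=
      Quotient.sound' ⟨⟨g⁻¹, inv_mem (Subgroup.mem_zpowers g)⟩, rfl⟩
    rw [← Finset.inv_smul_mem_iff]
    simp [hx]
  refine (Nat.card_eq_of_bijective
    (fun T => ⟨⟨_, T.2⟩, hinv _ T.2⟩ : _ → fixedBy (Set.powersetCard X k) g)
    ⟨fun T T' h => ?_, fun S => ?_⟩).symm
  · have h' := congrArg (fun S => (S.1.1 : Finset X)) h
    refine Subtype.ext (Finset.ext fun q => ?_)
    induction q using Quotient.inductionOn' with
    | h x => simpa using Finset.ext_iff.1 h' x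
  · have hS : g • S.1.1 = S.1.1 := by
      rw [← Set.powersetCard.coe_smul, mem_fixedBy.1 S.2]
    have hle : Subgroup.zpowers g ≤ stabilizer G S.1.1 := by
      simpa [Subgroup.zpowers_le] using hS
    have key : Finset.filter (fun x : X =>
        (Quotient.mk'' x : orbitRel.Quotient (Subgroup.zpowers g) X) ∈
          S.1.1.image Quotient.mk'') Finset.univ = S.1.1 := by
      ext x
      simp only [Finset.mem_filter, Finset.mem_univ, true_and, Finset.mem_image]
      refine ⟨fun ⟨y, hy, hyx⟩ => ?_, fun hx => ⟨x, hx, rfl⟩⟩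
      obtain ⟨⟨a, ha⟩, rfl⟩ := Quotient.exact' hyx.symm
      have := Finset.smul_mem_smul_finset (a := a) hy
      rwa [mem_stabilizer_iff.1 (hle ha)] at this
    exact ⟨⟨S.1.1.image Quotient.mk'', by
      rw [key]; exact S.1.2⟩, Subtype.ext (Subtype.ext key)⟩

lemma card_fixedBy_powersetCard_eq_invariantCounts [Finite X] [DecidableEq X] (g : G) (k : ℕ) :
    (Nat.card (fixedBy (Set.powersetCard X k) g) : ℤ) =
      (invariantCounts (fun e => Nat.card (fixedBy X (g ^ e))) k).getD 0 0 := by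
  classical
  have := Fintype.ofFinite X
  have := Fintype.ofFinite (orbitRel.Quotient (Subgroup.zpowers g) X)
  rw [card_fixedBy_powersetCard,
    invariantCounts_getD (w := fun q : orbitRel.Quotient (Subgroup.zpowers g) X =>
      Nat.card q.orbit) (fun q => ?_) _ (card_fixedBy_pow g) k 0 k.zero_le, Nat.sub_zero]
  have : Nonempty (orbitRel.Quotient.orbit q) :=
    ⟨⟨q.out, orbitRel.Quotient.mem_orbit.2 (Quotient.out_eq' q)⟩⟩
  exact Nat.card_pos

end Action

lemma Equiv.Perm.card_support_pow {α : Type*} [Fintype α] [DecidableEq α] (σ : Equiv.Perm α)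
    (e : ℕ) : (σ ^ e).support.card = (σ.cycleType.map fun d => if d ∣ e then 0 else d).sum := by
  induction σ using Equiv.Perm.cycle_induction_on with
  | base_one => simp
  | base_cycles σ hσ =>
    rw [hσ.cycleType]
    simp only [Multiset.map_singleton, Multiset.sum_singleton, ← hσ.orderOf]
    split_ifs with h
    · simp [orderOf_dvd_iff_pow_eq_one.1 h]
    · rw [hσ.support_pow_eq_iff.2 h, hσ.orderOf]
  | induction_disjoint σ τ h _ h₁ h₂ =>
    rw [h.commute.mul_pow, (h.pow_disjoint_pow e e).card_support_mul, h₁, h₂, h.cycleType_mul]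
    simp

lemma Equiv.Perm.card_fixedBy_pow {n : ℕ} (σ : Equiv.Perm (Fin n)) (e : ℕ) :
    (Nat.card (MulAction.fixedBy (Fin n) (σ ^ e)) : ℤ) =
      n - ((σ.cycleType.map fun d => if d ∣ e then 0 else d).sum : ℕ) := by
  rw [← card_support_pow, eq_sub_iff_add_eq]
  have h := Finset.card_compl_add_card (σ ^ e).support
  rw [Fintype.card_fin] at h
  rw [← Nat.cast_add, Nat.cast_inj]
  refine Eq.trans ?_ h
  rw [Nat.card_eq_card_toFinset]
  congr 2
  ext
  simp

/-- The number of 4-uniform hypergraphs with 5 edges on 8 vertices that are invariant under a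
permutation of cycle type `m`. -/
def fixedHypergraphs (m : Multiset ℕ) : ℤ :=
  (invariantCounts (fun e => (invariantCounts
    (fun j => 8 - ((m.map fun d => if d ∣ e * j then 0 else d).sum : ℕ)) 4).getD 0 0) 5).getD 0 0

lemma card_fixedBy_eq_fixedHypergraphs (σ : Equiv.Perm (Fin 8)) :
    (Nat.card (MulAction.fixedBy (Set.powersetCard (Set.powersetCard (Fin 8) 4) 5) σ) : ℤ) =
      fixedHypergraphs σ.cycleType := by
  rw [card_fixedBy_powersetCard_eq_invariantCounts, fixedHypergraphs]
  simp only [card_fixedBy_powersetCard_eq_invariantCounts, ← pow_mul,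
    Equiv.Perm.card_fixedBy_pow, Nat.cast_ofNat]

/-- The cycle types, without fixed points, of the permutations of eight points. -/
def cycleTypesEight : Finset (Multiset ℕ) :=
  {0, {2}, {2, 2}, {2, 2, 2}, {2, 2, 2, 2}, {2, 2, 3}, {2, 2, 4}, {2, 3}, {2, 3, 3}, {2, 4},
    {2, 5}, {2, 6}, {3}, {3, 3}, {3, 4}, {3, 5}, {4}, {4, 4}, {5}, {6}, {7}, {8}}

/-- The size of the conjugacy class of permutations of eight points of cycle type `m`. -/
def classSizeEight (m : Multiset ℕ) : ℕ :=
  if m.sum ≤ 8 ∧ ∀ a ∈ m, 2 ≤ a then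
    Nat.factorial 8 / (Nat.factorial (8 - m.sum) * m.prod *
      ∏ n ∈ m.toFinset, Nat.factorial (m.count n))
  else 0

lemma card_cycleType_eq (m : Multiset ℕ) :
    Finset.card {σ : Equiv.Perm (Fin 8) | σ.cycleType = m} = classSizeEight m := by
  rw [Equiv.Perm.card_of_cycleType, classSizeEight, Fintype.card_fin]

lemma sum_classSizeEight : ∑ m ∈ cycleTypesEight, classSizeEight m = Nat.factorial 8 := by
  decide +kernel

lemma sum_classSizeEight_mul_fixedHypergraphs :
    ∑ m ∈ cycleTypesEight, (classSizeEight m : ℤ) * fixedHypergraphs m =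
      621 * Nat.factorial 8 := by
  decide +kernel

lemma cycleType_mem_cycleTypesEight (σ : Equiv.Perm (Fin 8)) : σ.cycleType ∈ cycleTypesEight := by
  have h : Finset.card {σ : Equiv.Perm (Fin 8) | σ.cycleType ∈ cycleTypesEight} =
      (Finset.univ : Finset (Equiv.Perm (Fin 8))).card := by
    rw [Finset.card_eq_sum_card_fiberwise (f := Equiv.Perm.cycleType) (t := cycleTypesEight)
      (fun σ hσ => by simpa using hσ), Finset.card_univ, Fintype.card_perm, Fintype.card_fin,
      ← sum_classSizeEight]
    refine Finset.sum_congr rfl fun m hm => ?_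
    rw [← card_cycleType_eq, Finset.filter_filter]
    congr 1
    ext σ
    simp only [Finset.mem_filter, Finset.mem_univ, true_and, and_iff_right_iff_imp]
    rintro rfl
    exact hm
  simpa using Finset.card_filter_eq_iff.1 h σ

/-- Hypergraphs as finsets of edges correspond to the subsets of the type of possible edges. -/
noncomputable def uniformHypergraphEquiv (n r k : ℕ) :
    Set.powersetCard (Set.powersetCard (Fin n) r) k ≃
      {E : Finset (Finset (Fin n)) // E.card = k ∧ ∀ e ∈ E, e.card = r} :=
  Equiv.ofBijective
    (fun S => ⟨S.1.map (Function.Embedding.subtype _), by simp, by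
      simp only [Finset.mem_map]
      rintro _ ⟨e, -, rfl⟩
      exact e.2⟩) <| by
    classical
    refine ⟨fun S T h => Subtype.ext (Finset.map_injective _ (congrArg Subtype.val h)), fun E => ?_⟩
    have h := Finset.subtype_map_of_mem (p := (· ∈ Set.powersetCard (Fin n) r)) E.2.2
    exact ⟨⟨E.1.subtype _, by
      rw [Set.powersetCard.mem_iff, ← Finset.card_map, h, E.2.1]⟩, Subtype.ext h⟩

lemma coe_uniformHypergraphEquiv_smul {n r k : ℕ} (σ : Equiv.Perm (Fin n))
    (S : Set.powersetCard (Set.powersetCard (Fin n) r) k) :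
    (uniformHypergraphEquiv n r k (σ • S)).1 =
      permImage σ (uniformHypergraphEquiv n r k S).1 := by
  simp only [uniformHypergraphEquiv, Equiv.ofBijective_apply, permImage,
    Set.powersetCard.coe_smul, Finset.map_eq_image, Finset.smul_finset_def, Finset.image_image]
  rfl

lemma card_quotient_hypergraphSetoid (n r k : ℕ) :
    Nat.card (Quotient (hypergraphSetoid n fun E => E.card = k ∧ ∀ e ∈ E, e.card = r)) =
      Nat.card (MulAction.orbitRel.Quotient (Equiv.Perm (Fin n))
        (Set.powersetCard (Set.powersetCard (Fin n) r) k)) := by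
  refine (Nat.card_congr (Quotient.congr (uniformHypergraphEquiv n r k) fun S T => ?_)).symm
  rw [MulAction.orbitRel_apply, MulAction.mem_orbit_symm]
  refine exists_congr fun σ => ?_
  rw [← coe_uniformHypergraphEquiv_smul, ← Subtype.ext_iff, Equiv.apply_eq_iff_eq, eq_comm]

/-- There are exactly 621 isomorphism classes of 4-uniform hypergraphs with 5
hyperedges on 8 vertices (isolated vertices allowed): `s³₈,₅ = 621`. -/
theorem card_hypergraph_classes_eight_vertices :
    Nat.card (Quotient (hypergraphSetoid 8 fun E =>
      E.card = 5 ∧ ∀ e ∈ E, e.card = 4)) = 621 := by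
  classical
  rw [card_quotient_hypergraphSetoid, Nat.card_eq_fintype_card]
  have burnside := MulAction.sum_card_fixedBy_eq_card_orbits_mul_card_group
    (Equiv.Perm (Fin 8)) (Set.powersetCard (Set.powersetCard (Fin 8) 4) 5)
  rw [Fintype.card_perm, Fintype.card_fin] at burnside
  have key : (∑ σ : Equiv.Perm (Fin 8), (Nat.card (MulAction.fixedBy
      (Set.powersetCard (Set.powersetCard (Fin 8) 4) 5) σ) : ℤ)) = 621 * Nat.factorial 8 := by
    rw [← sum_classSizeEight_mul_fixedHypergraphs,
      ← Finset.sum_fiberwise_of_maps_to fun σ _ => cycleType_mem_cycleTypesEight σ]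
    refine Finset.sum_congr rfl fun m _ => ?_
    rw [← card_cycleType_eq, ← nsmul_eq_mul]
    refine Finset.sum_eq_card_nsmul fun σ hσ => ?_
    rw [card_fixedBy_eq_fixedHypergraphs, (Finset.mem_filter.1 hσ).2]
  simp only [Nat.card_eq_fintype_card] at key
  refine Nat.eq_of_mul_eq_mul_right (Nat.factorial_pos 8) (burnside.symm.trans ?_)
  exact_mod_cast key
end

section
/- The number of isomorphism classes of 4-uniform hypergraphs with exactly 5 hyperedges on 7 vertices (isolated vertices allowed) is 137. Precisely, the action of the symmetric group on Fin 7 on the set of families E of 4-element subsets of Fin 7 with |E| = 5 has exactly 137 orbits. (In Palmer's notation this is s³₇,₅ = 137.) -/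
namespace HypergraphCount

open Finset

/-- The subset of `Fin 7` encoded by the bit mask `m`. -/
def edge (m : ℕ) : Finset (Fin 7) := univ.filter fun v => m.testBit v

/-- The hypergraph encoded by a list of bit masks. -/
def hypergraph (l : List ℕ) : Finset (Finset (Fin 7)) := (l.map edge).toFinset

/-- The number of bits of `m` in the positions `0, …, 6`. -/
def popcount (m : ℕ) : ℕ := (List.range 7).countP m.testBit

/-- The bit masks of the four-element subsets of `Fin 7`. -/
def fourMasks : List ℕ := (List.range 128).filter fun m => popcount m == 4

@[simp]
lemma mem_edge {m : ℕ} {v : Fin 7} : v ∈ edge m ↔ m.testBit v = true := by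
  simp [edge]

lemma card_edge (m : ℕ) : (edge m).card = popcount m := by
  rw [edge, card_filter, Fin.sum_univ_seven]
  simp [popcount, List.range_succ, List.countP_cons]
  ring

lemma edge_land (a b : ℕ) : edge (a &&& b) = edge a ∩ edge b := by
  ext v
  simp

lemma edge_injOn {a b : ℕ} (ha : a < 128) (hb : b < 128) (h : edge a = edge b) : a = b := by
  refine Nat.eq_of_testBit_eq fun i => ?_
  by_cases hi : i < 7
  · have := Finset.ext_iff.1 h ⟨i, hi⟩
    simpa only [mem_edge, ← Bool.eq_iff_iff] using this
  · have h7 : 2 ^ 7 ≤ 2 ^ i := Nat.pow_le_pow_right two_pos (not_lt.1 hi)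
    rw [Nat.testBit_eq_false_of_lt (by omega), Nat.testBit_eq_false_of_lt (by omega)]

lemma exists_edge_eq (e : Finset (Fin 7)) : ∃ m < 128, edge m = e := by
  have h : Function.Bijective fun m : Fin 128 => edge m :=
    (Fintype.bijective_iff_injective_and_card _).2
      ⟨fun a b hab => Fin.ext (edge_injOn a.2 b.2 hab), by simp⟩
  obtain ⟨m, hm⟩ := h.2 e
  exact ⟨m, m.2, hm⟩

lemma exists_mem_fourMasks {e : Finset (Fin 7)} (he : e.card = 4) :
    ∃ m ∈ fourMasks, edge m = e := by
  obtain ⟨m, hm, rfl⟩ := exists_edge_eq e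
  exact ⟨m, by simp [fourMasks, hm, ← card_edge, he], rfl⟩

lemma nodup_map_edge {l : List ℕ} (hl : l.Nodup) (h : l ⊆ fourMasks) : (l.map edge).Nodup := by
  have hlt : ∀ m ∈ l, m < 128 := fun m hm => by
    have := h hm
    simp only [fourMasks, List.mem_filter, List.mem_range] at this
    exact this.1
  exact hl.map_on fun a ha b hb hab => edge_injOn (hlt a ha) (hlt b hb) hab

lemma card_hypergraph {l : List ℕ} (hl : (l.map edge).Nodup) :
    (hypergraph l).card = l.length := by
  rw [hypergraph, List.toFinset_card_of_nodup hl, List.length_map]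

/-! ### Relabelings -/

/-- The image of the set of positions `v < n` with `m.testBit v` under the map that sends `v` to
the `v`-th octal digit of `c`, as a bit mask. -/
def imageMask (c m : ℕ) : ℕ → ℕ
  | 0 => 0
  | n + 1 => imageMask c m n ||| if m.testBit n then 2 ^ (c / 8 ^ n % 8) else 0

lemma testBit_imageMask (c m n w : ℕ) :
    (imageMask c m n).testBit w = true ↔ ∃ v < n, m.testBit v = true ∧ c / 8 ^ v % 8 = w := by
  induction n with
  | zero => simp [imageMask]
  | succ n ih =>
    rw [imageMask, Nat.testBit_or, Bool.or_eq_true, ih, Nat.exists_lt_succ_right]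
    refine or_congr_right ?_
    split_ifs with h <;> simp [h, Nat.testBit_two_pow]

lemma exists_perm_edge_imageMask {c : ℕ} (hc : imageMask c 127 7 = 127) :
    ∃ σ : Equiv.Perm (Fin 7), ∀ m, edge (imageMask c m 7) = (edge m).image σ := by
  have h127 : ∀ v, Nat.testBit 127 v = true ↔ v < 7 := fun v => by
    simpa using congrArg (· = true) (Nat.testBit_two_pow_sub_one 7 v)
  have hlt : ∀ v : Fin 7, c / 8 ^ (v : ℕ) % 8 < 7 := fun v => by
    rw [← h127, ← hc, testBit_imageMask]
    exact ⟨v, v.2, (h127 v).2 v.2, rfl⟩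
  let f : Fin 7 → Fin 7 := fun v => ⟨c / 8 ^ (v : ℕ) % 8, hlt v⟩
  have hf : Function.Surjective f := fun w => by
    have hw := (h127 w).2 w.2
    rw [← hc, testBit_imageMask] at hw
    obtain ⟨v, hv, -, h⟩ := hw
    exact ⟨⟨v, hv⟩, Fin.ext h⟩
  refine ⟨Equiv.ofBijective f (Finite.surjective_iff_bijective.1 hf), fun m => ?_⟩
  ext w
  simp only [mem_edge, testBit_imageMask, mem_image, Equiv.ofBijective_apply, Fin.ext_iff, f]
  exact ⟨fun ⟨v, hv, h⟩ => ⟨⟨v, hv⟩, h⟩, fun ⟨v, h⟩ => ⟨v, v.2, h⟩⟩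

lemma card_permImage {n : ℕ} (σ : Equiv.Perm (Fin n)) (E : Finset (Finset (Fin n))) :
    (permImage σ E).card = E.card :=
  card_image_of_injective _ (image_injective σ.injective)

lemma permImage_insert {n : ℕ} (σ : Equiv.Perm (Fin n)) (e : Finset (Fin n))
    (E : Finset (Finset (Fin n))) :
    permImage σ (insert e E) = insert (e.image σ) (permImage σ E) :=
  image_insert _ _ _

lemma exists_permImage_eq_of_imageMask_mem {c : ℕ} {l l' : List ℕ}
    (hc : imageMask c 127 7 = 127) (h : ∀ m ∈ l, imageMask c m 7 ∈ l')
    (hcard : l'.length ≤ (hypergraph l).card) :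
    ∃ σ : Equiv.Perm (Fin 7), hypergraph l' = permImage σ (hypergraph l) := by
  obtain ⟨σ, hσ⟩ := exists_perm_edge_imageMask hc
  refine ⟨σ, (eq_of_subset_of_card_le ?_ ?_).symm⟩
  · intro e he
    simp only [permImage, hypergraph, mem_image, List.mem_toFinset, List.mem_map] at he ⊢
    obtain ⟨_, ⟨m, hm, rfl⟩, rfl⟩ := he
    exact ⟨_, h m hm, hσ m⟩
  · rw [card_permImage]
    refine le_trans ?_ hcard
    simpa [hypergraph] using List.toFinset_card_le (l'.map edge)

/-! ### Completeness of the representatives -/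

/-- The representatives of the 4-uniform hypergraphs on `Fin 7` with `k ≤ 5` edges. -/
def representatives : ℕ → List (List ℕ)
  | 0 => [[]]
  | 1 => [[15]]
  | 2 => [[15, 23], [15, 51], [15, 113]]
  | 3 => [[15, 23, 27], [15, 23, 39], [15, 23, 43], [15, 23, 57], [15, 23, 99], [15, 23, 105],
    [15, 23, 120], [15, 51, 60], [15, 51, 85], [15, 51, 92]]
  | 4 => [[15, 23, 27, 29], [15, 23, 27, 39], [15, 23, 27, 45], [15, 23, 27, 60],
    [15, 23, 27, 99], [15, 23, 27, 101], [15, 23, 27, 108], [15, 23, 39, 57],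
    [15, 23, 39, 71], [15, 23, 39, 75], [15, 23, 39, 89], [15, 23, 39, 120],
    [15, 23, 43, 51], [15, 23, 43, 53], [15, 23, 43, 60], [15, 23, 43, 77],
    [15, 23, 43, 83], [15, 23, 43, 85], [15, 23, 43, 89], [15, 23, 43, 92],
    [15, 23, 43, 113], [15, 23, 43, 116], [15, 23, 57, 58], [15, 23, 57, 89],
    [15, 23, 57, 90], [15, 23, 57, 99], [15, 23, 57, 102], [15, 23, 57, 105],
    [15, 23, 57, 106], [15, 23, 57, 120], [15, 23, 99, 108], [15, 23, 99, 120],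
    [15, 23, 105, 113], [15, 23, 105, 114], [15, 23, 105, 120], [15, 51, 60, 85],
    [15, 51, 85, 105], [15, 51, 85, 106]]
  | 5 => [[15, 51, 60, 85, 106], [15, 51, 60, 85, 90], [15, 23, 57, 106, 116],
    [15, 23, 57, 90, 108], [15, 23, 57, 99, 108], [15, 23, 57, 102, 120],
    [15, 23, 57, 90, 101], [15, 23, 99, 108, 120], [15, 23, 57, 106, 114],
    [15, 23, 57, 90, 99], [15, 23, 57, 99, 120], [15, 23, 57, 102, 106],
    [15, 23, 43, 116, 120], [15, 23, 99, 108, 116], [15, 23, 43, 92, 113],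
    [15, 23, 57, 102, 105], [15, 23, 43, 89, 116], [15, 23, 57, 89, 102],
    [15, 23, 57, 58, 101], [15, 23, 57, 90, 105], [15, 23, 43, 60, 113],
    [15, 23, 43, 113, 116], [15, 23, 43, 92, 120], [15, 23, 57, 89, 106],
    [15, 23, 43, 92, 116], [15, 23, 43, 89, 114], [15, 23, 43, 89, 108],
    [15, 23, 57, 58, 92], [15, 23, 43, 85, 120], [15, 23, 27, 101, 120],
    [15, 23, 43, 113, 114], [15, 23, 43, 89, 102], [15, 23, 43, 60, 116],
    [15, 23, 27, 108, 116], [15, 23, 43, 60, 89], [15, 23, 43, 89, 120],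
    [15, 23, 43, 92, 108], [15, 23, 43, 53, 120], [15, 23, 57, 89, 99],
    [15, 23, 43, 85, 108], [15, 23, 43, 89, 101], [15, 23, 27, 101, 106],
    [15, 23, 43, 89, 92], [15, 23, 43, 77, 114], [15, 23, 43, 83, 120],
    [15, 23, 43, 53, 108], [15, 23, 43, 83, 108], [15, 23, 43, 60, 92],
    [15, 23, 27, 99, 108], [15, 23, 27, 101, 108], [15, 23, 27, 60, 101],
    [15, 23, 43, 89, 113], [15, 23, 39, 89, 120], [15, 23, 43, 60, 85],
    [15, 23, 43, 53, 90], [15, 23, 43, 85, 102], [15, 23, 43, 85, 106],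
    [15, 23, 39, 89, 106], [15, 23, 43, 60, 83], [15, 23, 43, 77, 113],
    [15, 23, 27, 60, 108], [15, 23, 27, 60, 99], [15, 23, 43, 89, 90],
    [15, 23, 39, 57, 120], [15, 23, 43, 53, 102], [15, 23, 39, 57, 90],
    [15, 23, 27, 101, 102], [15, 23, 43, 53, 106], [15, 23, 27, 101, 105],
    [15, 23, 43, 85, 105], [15, 23, 43, 53, 89], [15, 23, 27, 45, 116],
    [15, 23, 43, 60, 77], [15, 23, 43, 51, 92], [15, 23, 39, 89, 90],
    [15, 23, 27, 45, 114], [15, 23, 43, 83, 101], [15, 23, 39, 89, 105],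
    [15, 23, 43, 53, 105], [15, 23, 43, 53, 58], [15, 23, 43, 53, 78],
    [15, 23, 39, 75, 120], [15, 23, 27, 45, 113], [15, 23, 27, 45, 102],
    [15, 23, 27, 99, 101], [15, 23, 27, 60, 92], [15, 23, 43, 83, 105],
    [15, 23, 43, 51, 60], [15, 23, 39, 57, 58], [15, 23, 39, 57, 89],
    [15, 23, 27, 45, 92], [15, 23, 27, 45, 108], [15, 23, 39, 75, 116],
    [15, 23, 43, 53, 99], [15, 23, 43, 51, 89], [15, 23, 43, 53, 77],
    [15, 23, 27, 45, 99], [15, 23, 39, 75, 92], [15, 23, 39, 57, 78],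
    [15, 23, 39, 75, 113], [15, 23, 27, 39, 120], [15, 23, 27, 45, 86],
    [15, 23, 27, 45, 60], [15, 23, 43, 53, 57], [15, 23, 27, 45, 101],
    [15, 23, 43, 51, 77], [15, 23, 27, 45, 54], [15, 23, 39, 57, 75],
    [15, 23, 27, 39, 108], [15, 23, 27, 39, 92], [15, 23, 27, 29, 102],
    [15, 23, 27, 45, 78], [15, 23, 39, 75, 89], [15, 23, 27, 45, 85],
    [15, 23, 27, 39, 105], [15, 23, 27, 39, 60], [15, 23, 43, 83, 99],
    [15, 23, 27, 45, 46], [15, 23, 27, 29, 99], [15, 23, 27, 45, 53],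
    [15, 23, 39, 75, 85], [15, 23, 27, 39, 89], [15, 23, 27, 39, 57],
    [15, 23, 27, 39, 101], [15, 23, 27, 29, 46], [15, 23, 27, 45, 77],
    [15, 23, 27, 39, 77], [15, 23, 39, 71, 120], [15, 23, 39, 75, 83],
    [15, 23, 27, 39, 99], [15, 23, 27, 39, 45], [15, 23, 39, 57, 71],
    [15, 23, 27, 29, 39], [15, 23, 27, 39, 75], [15, 23, 27, 39, 43],
    [15, 23, 27, 29, 30], [15, 23, 27, 39, 71]]
  | _ => []

/-- The relabeling table. Its entries for `k` correspond to the lists in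
`extensions (representatives k)`; the low seven octal digits of an entry are the values of a
permutation and the remaining ones form an index into `representatives (k + 1)`. -/
def relabelings : ℕ → List ℕ
  | 0 => [1754760, 1751176, 1750280, 1750112, 1750084, 1693832, 1692936, 1692768, 1692740,
    1682184, 1682016, 1681988, 1680224, 1680196, 1679916, 1005704, 1004808, 1004640,
    1004612, 994056, 993888, 993860, 992096, 992068, 991788, 879368, 879200, 879172,
    877408, 877380, 877100, 859488, 859460, 859180, 856492]
  | 1 => [1754760, 1754312, 1754200, 1754179, 1726088, 1725640, 1725528, 1725507, 3851912,
    3851856, 3851842, 3850960, 3850946, 3850778, 1267336, 1266888, 1266776, 1266755,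
    3622536, 3622480, 3622466, 3621584, 3621570, 3621402, 3565192, 3565136, 3565122,
    3564240, 3564226, 3564058, 5949064, 5949057, 5948945, 5947601]
  | 2 => [1754760, 1754704, 1754690, 3851912, 5949064, 5949008, 5948994, 5945480, 5945424,
    5945410, 8046216, 8046209, 8046097, 3622536, 5719688, 5719632, 5719618, 5716104,
    5716048, 5716034, 7816840, 7816833, 7816721, 10143368, 10143312, 10143298, 12240520,
    12240513, 12240401, 12236936, 12236929, 12236817, 14337672, 5945480, 5944584, 8045656,
    8045635, 5888136, 5887240, 8016984, 8016963, 7936792, 7936771, 7936344, 7936323,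
    16434824, 9655944, 9655496, 11752536, 11752515, 9547080, 18531976, 18531969, 18531528,
    18531521, 20629128, 9518408, 18503304, 18503297, 18502856, 18502849, 20600456,
    11607384, 11607363, 20556552, 20556104, 12236936, 12236040, 12235872, 14337091,
    12179592, 12178696, 12178528, 14308419, 11607384, 11607272, 20556356, 11605928,
    20554564, 20554284, 11491464, 11490568, 11490400, 13849667, 11148632, 11148520,
    19868228, 11147176, 19866436, 19866156, 11062616, 11062504, 19753540, 11061160,
    19751748, 19751468, 13143395, 13143339, 13142443]
  | 3 => [1754760, 1754753, 3851912, 3851464, 5949064, 5949057, 3844296, 5945480, 5945473,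
    5944584, 5944577, 8046216, 3622536, 3622088, 5719688, 5719681, 3614920, 5716104,
    5716097, 5715208, 5715201, 7816840, 10143368, 12240520, 12240513, 12240072, 12240065,
    14337672, 12232904, 12232897, 14334088, 14333192, 3851912, 3851856, 3851842, 3823240,
    3823184, 3823170, 3816072, 3816016, 3816002, 16434824, 16434817, 16434705, 18531976,
    20629128, 20629072, 20629058, 20625544, 20625488, 20625474, 22726280, 22726273,
    22726161, 20568200, 20568144, 20568130, 22697608, 22697601, 22697489, 22690440,
    22690433, 22690321, 24823432, 3851464, 5949008, 5948994, 3823240, 5919440, 5919426,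
    26920584, 29017736, 29017729, 28988616, 28988609, 31114888, 20399752, 20341960,
    33212040, 33212033, 35309192, 37406344, 37406337, 39503496, 39503489, 41600648,
    35280072, 39474376, 39474369, 37377224, 37377217, 41571528, 43697800, 43697793,
    45794952, 45765832, 5944584, 5944416, 8046146, 16434824, 28988616, 28988504, 31114818,
    28977864, 28977752, 31111234, 47892104, 47892048, 22496904, 39274120, 39274064,
    41371202, 39270536, 39270480, 41367618, 49989256, 52086408, 52086352, 54183560,
    54183504, 56280712, 58377864, 60475016, 60474960, 58374280, 60471432, 60471376,
    62572168, 10143368, 12240464, 12240450, 20568200, 35280072, 39474264, 39474243,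
    35269320, 39463512, 39463491, 54183560, 54183553, 56280593, 19880072, 34821320,
    39015512, 39015491, 34810568, 39004760, 39004739, 53954184, 53954177, 56051217,
    48818968, 48818947, 57207128, 57207107, 64669320, 57199960, 57199939, 64665736,
    66766472, 12240072, 12239960, 14337602, 22697608, 37377224, 37377112, 41571395,
    43694216, 43694160, 45791298, 58377864, 60475009, 60474897, 22238856, 36918472,
    36918360, 41112643, 43464840, 43464784, 45561922, 58148488, 60245633, 60245521,
    57207128, 57207016, 64669250, 61399395, 61399339, 68863624, 70960776, 70960720,
    73057928, 14333192, 14333024, 14332996, 24823432, 45765832, 45765720, 45765699,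
    45755080, 45754968, 45754947, 62572168, 62572161, 62572049, 24594056, 45307080,
    45306968, 45306947, 45296328, 45296216, 45296195, 62342792, 62342785, 62342673,
    66766472, 66766416, 66766402, 73057928, 73057921, 73057809, 73054344, 73054337,
    73054225, 31111304, 31110408, 31109666, 31109652, 31053960, 31053064, 31052322,
    31052308, 30968546, 30968532, 30967650, 30967636, 64181896, 64181448, 64180762,
    64180755, 64073032, 75155080, 75155073, 75154632, 75154625, 64070197, 64044360,
    75126408, 75126401, 75125960, 75125953, 64041525, 63999322, 63999315, 63997621,
    63997173, 33208456, 39499016, 39269472, 52085827, 39406280, 43635976, 54154328,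
    60445763, 39132384, 51976963, 54073688, 60365123, 75155080, 38488664, 53695688,
    42947680, 59986955, 38444312, 51059235, 53156072, 74925648, 59447339, 53558600,
    53099624, 74816784, 77252232, 79349384, 79119952, 42802528, 59837771, 59378795,
    79011088, 41597064, 41596168, 41366050, 41366036, 45734024, 45733128, 56251480,
    56251459, 60365536, 60365508, 60364640, 60364612, 64070197, 55793169, 55791825,
    45044258, 45044244, 63843656, 59447339, 59447325, 59445547, 59445533, 66141512,
    79062608, 79062594, 79061712, 79061698, 65679925, 70327640, 70327619, 69867061,
    69865717]
  | 4 => [284870280, 278578824, 278578376, 278578264, 261801608, 278571208, 278571096,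
    261798024, 278569752, 261797128, 261796960, 278349448, 278349000, 278348888,
    261572232, 278341832, 278341720, 261568648, 278340376, 261567752, 261567584,
    249218696, 249218640, 232441480, 249217744, 232441032, 232440920, 249206992,
    232433864, 232433752, 232432408, 278578824, 278578817, 282773128, 274384520,
    274384513, 282769544, 274380936, 274380929, 257607304, 257607297, 242927240,
    286967432, 280675976, 265995912, 265995905, 280672392, 265992328, 265992321,
    255510152, 255510145, 230344328, 272287368, 259704456, 259704449, 240830088,
    240830081, 228247176, 240826504, 240826497, 228243592, 211469960, 278578264,
    261801601, 274384520, 274384072, 247121544, 257599688, 251315848, 224052872,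
    251315400, 224052424, 215664264, 265766536, 265766088, 263898760, 234538632,
    255273160, 238732936, 213567112, 238732488, 213566664, 190498440, 203081352,
    219858568, 175818376, 219858120, 175817928, 192595592, 173721224, 159041160,
    150652552, 150652104, 261796960, 261796932, 242927240, 242926792, 215664264,
    215664257, 242919624, 215660680, 215660673, 215659784, 215659777, 230114952,
    230114504, 190269064, 190269057, 230107336, 190265480, 190265473, 190264584,
    190264577, 180012680, 129681032, 106612360, 106612353, 106611912, 106611905,
    127583880, 106604744, 106604737, 127580296, 127579400, 249218696, 249218689,
    272287368, 272286920, 203081352, 203081345, 272279752, 203077768, 203077761,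
    203076872, 203076865, 129681032, 272057992, 272057544, 202851976, 202851969,
    272050376, 202848392, 202848385, 202847496, 202847489, 129451656, 177915528,
    177915521, 177915080, 177915073, 102418056, 177907912, 177907905, 102414472,
    102413576, 249218640, 232441473, 259704456, 240829640, 219858568, 175818369,
    240822472, 219854984, 175814785, 173716744, 159036673, 106612360, 259475080,
    240600264, 219629192, 175588993, 240593096, 219625608, 175585409, 173487368,
    158807297, 106382984, 177915528, 140166792, 144361096, 87737992, 104515208, 144357512,
    87734408, 104511624, 62572168, 232440920, 232440899, 228247176, 228246728, 192595592,
    192595585, 211462344, 150648968, 150648961, 150648072, 150648065, 127583880,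
    228017800, 228017352, 192366216, 192366209, 211232968, 150419592, 150419585,
    150418696, 150418689, 127354504, 102418056, 104515208, 104515201, 104514760,
    104514753, 62564552, 62564545, 70960776, 70960328, 257607304, 257607248, 242927170,
    257578632, 257578576, 242898498, 257571464, 257571408, 242891330, 186304136,
    186304080, 276481672, 226150024, 226149968, 207275656, 226146440, 226146384,
    207272072, 188401288, 138069640, 138069584, 226089096, 226089040, 207214728,
    188372616, 138040968, 138040912, 188365448, 138033800, 138033744, 133875336,
    286967432, 286967376, 286967362, 286938760, 286938704, 286938690, 286931592,
    286931536, 286931522, 276481672, 276481665, 276481553, 286480008, 286479952,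
    286479938, 286472840, 286472784, 286472770, 276252296, 276252289, 276252177,
    286386824, 286386768, 286386754, 276194952, 276194945, 276194833, 276184200,
    276184193, 276184081, 268093064, 280675976, 265995856, 265995842, 280647304,
    265967184, 265967170, 272251528, 259668560, 259668546, 226150024, 226150017,
    207275537, 286480008, 263410384, 263410370, 270190216, 253413000, 253412993,
    236635784, 236635777, 205178504, 270161544, 253384328, 253384321, 236607112,
    236607105, 205149832, 209372808, 209372801, 194692744, 171624072, 255510152,
    255510096, 230344258, 240801416, 240801360, 228218434, 240794248, 240794192,
    228211266, 188401288, 138069633, 138069521, 276252296, 236635784, 236635728,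
    205178434, 236632200, 236632144, 205174850, 156944008, 156943952, 209311880,
    209311824, 194631746, 163235464, 121292424, 121292368, 163231880, 121288840,
    121288784, 110806664, 211469960, 211469904, 211469890, 211441288, 211441232,
    211441218, 211434120, 211434064, 211434050, 133875336, 133875329, 133875217,
    268093064, 171624072, 171624016, 171624002, 171620488, 171620432, 171620418,
    110806664, 110806657, 110806545, 171563144, 171563088, 171563074, 110777992,
    110777985, 110777873, 110770824, 110770817, 110770705, 282768648, 251315792,
    251315778, 282712200, 251286224, 251286210, 251271888, 251271874, 251184976,
    251184962, 184206984, 269960840, 269903048, 221955720, 221955713, 269888712,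
    221952136, 221952129, 198887048, 198887041, 154846856, 269830024, 198857928,
    198857921, 221893896, 221893889, 154817736, 221883144, 221883137, 154806984,
    154748744, 257606856, 257599576, 224052802, 274323592, 251286168, 215634626,
    251271888, 215620122, 217761416, 167429768, 167426128, 253183624, 236348616,
    200984200, 169526920, 200980560, 236334168, 169523280, 148555400, 115000968,
    114997328, 196789896, 196786256, 135972488, 165332616, 142263944, 96126600, 165328976,
    96122960, 142260304, 79349384, 242926792, 224052312, 224052291, 242898568, 224023192,
    224023171, 184206984, 167426128, 167426114, 167367440, 167367426, 204949128,
    204891336, 152749704, 152749697, 123389576, 112903816, 112903809, 73057928, 73057921,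
    100320904, 123360456, 73028808, 73028801, 112874696, 112874689, 100291784, 43697800,
    43697793, 68863624, 68834504, 265995464, 265765976, 234538562, 265967240, 265708184,
    234508994, 221955720, 200984200, 169526913, 200955080, 169497793, 152749704,
    265508432, 265478864, 234050074, 200754768, 221726288, 169297425, 200496216,
    152520272, 169038873, 200696528, 200467096, 152462032, 221668048, 169238737,
    169009305, 125486728, 91932296, 91702864, 91644624, 280671496, 238732880, 238732866,
    272258696, 219828944, 219828930, 269888712, 200980560, 200980546, 196760776,
    196760769, 123389576, 271792776, 269673672, 200754768, 200754754, 219355856,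
    219355842, 196291272, 196291265, 123156616, 245024392, 161138312, 161138305,
    182109832, 182109825, 98223752, 181876872, 181876865, 97990792, 94029448, 255509704,
    255273048, 213567042, 259675784, 219828888, 192565954, 221952136, 236334168,
    169523266, 165303496, 142234817, 112903816, 259209808, 236119240, 221726288,
    169297418, 219355856, 192092698, 164833880, 112670800, 141765145, 182080712,
    181611096, 117098120, 146458248, 119195272, 83543688, 146225232, 83310672, 118962256,
    60475016, 265991432, 238732376, 190498370, 240801416, 203051728, 175788738, 198887048,
    148555400, 115000961, 196727568, 135943361, 73057928, 225920648, 252896456, 200496216,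
    152520258, 196291272, 164833880, 112670786, 131778184, 89835144, 161109192, 85640840,
    66766472, 181494616, 117068993, 56280712, 108709512, 54183560, 35309192, 75155080,
    230343880, 213566552, 213566531, 228218504, 175788696, 175788675, 154846856,
    114997328, 114997314, 96097480, 96097473, 100320904, 207046161, 204661960, 169038873,
    169038859, 123156616, 141765145, 141765131, 89835144, 89835137, 98194632, 56251592,
    56251585, 83514568, 83514561, 77252232, 31114888, 31114881, 52086408, 47892104,
    240825608, 173721168, 150652482, 240769160, 173691600, 150622914, 221883144,
    165328976, 96122946, 165270288, 96064258, 43697800, 209143432, 209085640, 125486728,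
    91932289, 181876872, 146225232, 83310658, 108709512, 54183553, 31114888, 181789960,
    108680392, 54154433, 146137872, 83223298, 31085768, 64669320, 45794952, 45765832,
    211469512, 159041104, 159041090, 228186248, 150622872, 150622851, 154806984,
    142260304, 142260290, 79320264, 79320257, 68863624, 194463368, 171336904, 91702864,
    91702850, 97990792, 118962256, 118962242, 35309192, 35309185, 52086408, 94000328,
    75125960, 75125953, 60445896, 60445889, 47862984, 45794952, 45794945, 26920584,
    247117064, 215659616, 215659588, 186304136, 215531866, 167367328, 167367300,
    215517530, 167352992, 167352964, 186192227, 156714632, 131548808, 89605712, 89605698,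
    131545224, 89602128, 89602114, 131404195, 131404188, 58377864, 58265955, 39503496,
    39503489, 89432483, 89432476, 39391587, 89425315, 89425308, 39388003, 156570019,
    263894280, 263894112, 180012610, 188401288, 196727568, 196727456, 100320834,
    196713232, 196713120, 100317250, 131404195, 131404083, 188171912, 196039440,
    196039328, 100091458, 196025104, 196024992, 100087874, 130716067, 130715955, 81446536,
    81446480, 37406344, 177316776, 49989256, 49989200, 177313192, 49985672, 49985616,
    139563434, 234534152, 190493792, 190264388, 138069640, 135943368, 96097368, 73057858,
    135932616, 96086616, 73054274, 131404188, 58377808, 137840257, 135484609, 72828496,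
    95638595, 135473857, 72824912, 95627843, 130716067, 58148418, 20629128, 14337672,
    14108289, 41600648, 41371265, 8046216, 41597064, 41367681, 8042632, 63771052,
    203076872, 173716576, 106612290, 226089096, 200921872, 148526168, 73028675, 200907536,
    148515416, 73017923, 58265955, 39503440, 208623752, 160650440, 85411408, 55792707,
    160639688, 85407824, 55781955, 81446536, 20629128, 14337616, 80276248, 48818947,
    107534240, 40429891, 10143368, 107527072, 40422723, 10139784, 22726280, 159036680,
    159036512, 129680962, 207214728, 114971848, 114971736, 123360323, 114961096,
    114960984, 123349571, 39503489, 39503377, 193943618, 66537096, 66537040, 97735747,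
    66533512, 66533456, 97724995, 37406344, 14108289, 14108177, 48818947, 48818723,
    33212040, 24823432, 24823376, 33208456, 24819848, 24819792, 12240520, 219854088,
    219853920, 127583810, 188372616, 236274584, 236274416, 100291651, 165255952,
    165255840, 68859970, 89432483, 89432371, 163006088, 181035864, 181035752, 77022786,
    108476552, 108476496, 51853378, 177316776, 41600648, 41600592, 107534240, 107534128,
    33212040, 73978275, 73978163, 143701416, 24130985, 24130929, 103854506, 175813896,
    150647904, 106611779, 138040968, 169464592, 114938528, 112874563, 96049936, 79309400,
    43694146, 89432476, 39391531, 121063048, 116610241, 56051280, 83055683, 53950600,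
    35076176, 30881858, 49989256, 41371265, 8046160, 40429891, 10143312, 24823432,
    73978275, 21553437, 24127401, 18531976, 5949064, 44868012, 192591112, 192590944,
    127579204, 133875336, 142201616, 142201504, 68834371, 142187280, 142187168, 68823619,
    156570019, 156569907, 110577288, 74925704, 74925648, 47662658, 74922120, 74922064,
    47659074, 139563434, 63771052, 63770996, 22726280, 22726224, 12240520, 103854506,
    44868012, 44867956, 103843754, 44860844, 44860788, 102418056, 87737936, 87737922,
    205117576, 123069704, 112583202, 112583188, 93989576, 54143576, 54143555, 10143368,
    10143361, 33211921, 204429448, 122610952, 112124450, 112124436, 93530824, 53684824,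
    53684803, 9913992, 9913985, 32982545, 98855650, 98855636, 67397474, 67397460,
    32034136, 32034115, 29017736, 16434824, 102413576, 62572112, 62572098, 171563144,
    97903880, 35279960, 35279939, 97889544, 35269208, 35269187, 22726280, 22726273,
    12240401, 170875016, 97445128, 34821208, 34821187, 97430792, 34810456, 34810435,
    22496904, 22496897, 12011025, 36236056, 36236035, 50616226, 50616212, 16434824,
    50609058, 50609044, 16431240, 144356616, 144356448, 70960706, 163174536, 146137872,
    146137760, 47862851, 146119952, 146119840, 47852099, 143701416, 18531969, 18531857,
    162486408, 145679120, 145679008, 47404099, 145661200, 145661088, 47393347, 143013288,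
    18302593, 18302481, 162060696, 162060528, 29017666, 46421411, 46421299, 46410659,
    46410547, 69486506, 87733512, 62571608, 62564419, 121231496, 83223312, 60445784,
    31085635, 83205378, 31074904, 60435011, 24130985, 24127373, 5948945, 120543368,
    82764560, 59987032, 30626883, 82746626, 30616152, 59976259, 23213481, 23209869,
    5719569, 75782554, 32041192, 32033989, 46421404, 11067691, 46410659, 11046173,
    25441708, 104510728, 104510560, 70960195, 110777992, 118874896, 118874784, 52057155,
    45755080, 45754968, 26916930, 103854506, 44868005, 44867893, 110319240, 118416144,
    118416032, 51598403, 45296328, 45296216, 26687554, 103166378, 44409253, 44409141,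
    50616226, 50616114, 16434754, 109629859, 109629747, 69486506, 25441708, 25441652,
    152746120, 73053448, 152744482, 73052692, 72960712, 43635976, 72958507, 43635220,
    152603362, 72911572, 72910123, 43550548, 53168728, 9655496, 53167657, 9654803,
    53124376, 19601955, 19601640, 3851912, 53122612, 9518408, 19545192, 3779336, 3777068,
    1754760, 9515573, 53054761, 9473363, 53054068, 9471221, 125483144, 85636360, 85406816,
    8045635, 85579912, 125424904, 85320352, 8016515, 85269728, 7936771, 85239712, 7907651,
    3777068, 84891728, 84861712, 124736608, 7557651, 84811088, 7019043, 84322096, 3089220,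
    6760491, 84724624, 84265648, 2976324, 6873443, 6644011, 124591456, 7376211, 6687915,
    6571435, 91928712, 66761992, 35075168, 14337091, 66669256, 91870465, 14307992,
    34988676, 34938080, 14228227, 14199128, 34908036, 1754760, 55265880, 55206723,
    30364768, 30335620, 55221528, 7019036, 9115432, 9057157, 4921387, 55105923, 9030760,
    8972485, 6873443, 4776221, 30219616, 30190468, 4852843, 4735901]
  | _ => []

/-- All lists obtained by adding a new four-element edge to one of the given lists. -/
def extensions (L : List (List ℕ)) : List (List ℕ) :=
  L.flatMap fun l => (fourMasks.filter fun m => !l.elem m).map (· :: l)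

/-- The table entry `c` relabels `l` to an element of `L`. -/
def relabels (L : List (List ℕ)) (l : List ℕ) (c : ℕ) : Bool :=
  imageMask c 127 7 == 127 && l.all fun m => (L.getD (c / 8 ^ 7) []).elem (imageMask c m 7)

/-- Each list is relabeled to an element of `L` by the corresponding table entry. -/
def relabelsAll (L : List (List ℕ)) : List (List ℕ) → List ℕ → Bool
  | [], _ => true
  | _ :: _, [] => false
  | l :: ls, c :: cs => relabels L l c && relabelsAll L ls cs

lemma exists_relabels {L ls : List (List ℕ)} {cs : List ℕ} (h : relabelsAll L ls cs = true)
    {l : List ℕ} (hl : l ∈ ls) : ∃ c, relabels L l c = true := by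
  induction ls generalizing cs with
  | nil => simp at hl
  | cons a ls ih =>
    cases cs with
    | nil => simp [relabelsAll] at h
    | cons c cs =>
      simp only [relabelsAll, Bool.and_eq_true] at h
      rcases List.mem_cons.1 hl with rfl | hl
      · exact ⟨c, h.1⟩
      · exact ih h.2 hl

lemma relabelsAll_extensions :
    ∀ k < 5, relabelsAll (representatives (k + 1)) (extensions (representatives k))
      (relabelings k) = true := by
  decide +kernel

lemma representatives_valid :
    ∀ k < 6, ∀ l ∈ representatives k, l.length = k ∧ l.Nodup ∧ l ⊆ fourMasks := by
  decide +kernel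

lemma exists_representative {k : ℕ} (hk : k < 6) {E : Finset (Finset (Fin 7))}
    (hE : E.card = k) (h4 : ∀ e ∈ E, e.card = 4) :
    ∃ l ∈ representatives k, ∃ σ : Equiv.Perm (Fin 7), hypergraph l = permImage σ E := by
  induction k generalizing E with
  | zero =>
    refine ⟨[], by simp [representatives], 1, ?_⟩
    rw [card_eq_zero.1 hE]
    rfl
  | succ k ih =>
    obtain ⟨e, E', he, rfl, hE'⟩ := card_eq_succ.1 hE
    obtain ⟨l, hl, σ, hσ⟩ := ih (by omega) hE' fun f hf => h4 f (mem_insert_of_mem hf)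
    obtain ⟨m, hm, hme⟩ := exists_mem_fourMasks (e := e.image σ)
      (by rw [card_image_of_injective _ σ.injective, h4 e (mem_insert_self _ _)])
    have hins : hypergraph (m :: l) = permImage σ (insert e E') := by
      rw [permImage_insert, ← hσ, ← hme]
      simp [hypergraph]
    have hml : m ∉ l := fun hml => he <| by
      have : e.image σ ∈ permImage σ E' := by
        rw [← hσ, ← hme]
        exact List.mem_toFinset.2 (List.mem_map_of_mem hml)
      obtain ⟨f, hf, hfe⟩ := mem_image.1 this
      rwa [← image_injective σ.injective hfe]
    obtain ⟨c, hc⟩ := exists_relabels (relabelsAll_extensions k (by omega)) (l := m :: l) <| by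
      simp only [extensions, List.mem_flatMap, List.mem_map, List.mem_filter]
      exact ⟨l, hl, m, ⟨hm, by simpa using hml⟩, rfl⟩
    simp only [relabels, Bool.and_eq_true, beq_iff_eq, List.all_eq_true, List.elem_eq_mem,
      decide_eq_true_eq] at hc
    have hmem : (representatives (k + 1)).getD (c / 8 ^ 7) [] ∈ representatives (k + 1) := by
      by_cases hlt : c / 8 ^ 7 < (representatives (k + 1)).length
      · rw [List.getD_eq_getElem _ _ hlt]
        exact List.getElem_mem hlt
      · rw [List.getD_eq_default _ _ (not_lt.1 hlt)] at hc
        simpa using hc.2 m List.mem_cons_self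
    obtain ⟨τ, hτ⟩ := exists_permImage_eq_of_imageMask_mem hc.1 hc.2 <| by
      rw [(representatives_valid _ hk _ hmem).1, hins, card_permImage, hE]
    exact ⟨_, hmem, τ * σ, by rw [hτ, hins, permImage_permImage]⟩

/-! ### Separation of the representatives -/

/-- An isomorphism invariant of hypergraphs built from triple intersections of edges. -/
def tripleInvariant {n : ℕ} (E : Finset (Finset (Fin n))) : ℕ :=
  ∑ e ∈ E, ∑ f ∈ E, (∑ g ∈ E, 2 ^ (e ∩ f ∩ g).card) ^ 3

lemma tripleInvariant_permImage {n : ℕ} (σ : Equiv.Perm (Fin n))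
    (E : Finset (Finset (Fin n))) : tripleInvariant (permImage σ E) = tripleInvariant E := by
  have hσ := image_injective σ.injective
  simp only [tripleInvariant, permImage, sum_image hσ.injOn, ← image_inter _ _ σ.injective,
    card_image_of_injective _ σ.injective]

/-- The computation of `tripleInvariant` on bit masks. -/
def maskInvariant (l : List ℕ) : ℕ :=
  (l.map fun a => (l.map fun b =>
    (l.map fun c => 2 ^ popcount (a &&& b &&& c)).sum ^ 3).sum).sum

lemma tripleInvariant_hypergraph {l : List ℕ} (hl : (l.map edge).Nodup) :
    tripleInvariant (hypergraph l) = maskInvariant l := by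
  simp only [tripleInvariant, hypergraph, List.sum_toFinset _ hl, List.map_map, maskInvariant,
    Function.comp_def, ← edge_land, card_edge]

lemma isChain_maskInvariant :
    ((representatives 5).map maskInvariant).IsChain (· < ·) := by
  decide +kernel

lemma length_representatives_five : (representatives 5).length = 137 := by
  decide +kernel

end HypergraphCount

open HypergraphCount in
/-- There are exactly 137 isomorphism classes of 4-uniform hypergraphs with 5
hyperedges on 7 vertices (isolated vertices allowed): `s³₇,₅ = 137`. -/
theorem card_hypergraph_classes_seven_vertices :
    Nat.card (Quotient (hypergraphSetoid 7 fun E =>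
      E.card = 5 ∧ ∀ e ∈ E, e.card = 4)) = 137 := by
  have hvalid := representatives_valid 5 (by norm_num)
  have hnodup : ∀ l ∈ representatives 5, (l.map edge).Nodup := fun l hl =>
    nodup_map_edge (hvalid l hl).2.1 (hvalid l hl).2.2
  have hprop : ∀ l ∈ representatives 5,
      (hypergraph l).card = 5 ∧ ∀ e ∈ hypergraph l, e.card = 4 := fun l hl => by
    refine ⟨(card_hypergraph (hnodup l hl)).trans (hvalid l hl).1, fun e he => ?_⟩
    obtain ⟨m, hm, rfl⟩ := List.mem_map.1 (List.mem_toFinset.1 he)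
    have := (hvalid l hl).2.2 hm
    rw [card_edge]
    simpa [fourMasks] using (List.mem_filter.1 this).2
  let cls : Fin (representatives 5).length → Quotient (hypergraphSetoid 7 fun E =>
      E.card = 5 ∧ ∀ e ∈ E, e.card = 4) := fun i =>
    Quotient.mk _ ⟨hypergraph ((representatives 5)[(i : ℕ)]), hprop _ (List.getElem_mem i.2)⟩
  have hcls : Function.Bijective cls := by
    constructor
    · intro i j hij
      obtain ⟨σ, hσ⟩ := Quotient.exact hij
      have hinv := congrArg tripleInvariant hσ
      simp only [tripleInvariant_permImage] at hinv
      rw [tripleInvariant_hypergraph (hnodup _ (List.getElem_mem _)),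
        tripleInvariant_hypergraph (hnodup _ (List.getElem_mem _))] at hinv
      have hnd : ((representatives 5).map maskInvariant).Nodup :=
        (List.isChain_iff_pairwise.1 isChain_maskInvariant).imp fun h => h.ne
      refine Fin.ext ((hnd.getElem_inj_iff (hi := by simp) (hj := by simp)).1 ?_)
      simpa using hinv.symm
    · intro q
      induction q using Quotient.inductionOn with
      | h E =>
        obtain ⟨l, hl, σ, hσ⟩ := exists_representative (by norm_num) E.2.1 E.2.2
        obtain ⟨i, hi, rfl⟩ := List.getElem_of_mem hl
        exact ⟨⟨i, hi⟩, (Quotient.sound (s := hypergraphSetoid 7 _) ⟨σ, hσ⟩).symm⟩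
  rw [← Nat.card_eq_of_bijective cls hcls, Nat.card_fin, length_representatives_five]
end
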